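/- The progressive run problem for VASSB reduces to the reachability problem for VASSB: there is a computable function mapping each pair (V, s) of a VASSB and a semiconfiguration to a triple (V', s1', s2') of a VASSB and two semiconfigurations such that V has an infinite progressive run from s if and only if V' has a run s1' →* s2'. -/

import Mathlib

/-!
Formalization of context-bounded liveness for dynamic networks of concurrent
pushdown systems (DCPS) and VASS with balloons (VASSB).
Global states, stack symbols, places, balloon states etc. are drawn from ℕ;
the finite components of the systems are recorded as `Finset`s.
-/

noncomputable section

namespace CBL

/-! ### VASS with balloons (VASSB) -/

/-- A vector in `ℕ^P` (finitely supported, places drawn from `ℕ`). -/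
abbrev Vec : Type := ℕ →₀ ℕ

/-- A vector in `ℤ^P`. -/
abbrev ZVec : Type := ℕ →₀ ℤ

/-- A balloon: a balloon state together with its contents, a vector over the
balloon places. -/
abbrev Balloon : Type := ℕ × Vec

/-- A representation of a semilinear subset of `ℕ^Φ`: a finite union of
linear sets, each given by a base vector and a list of period vectors. -/
abbrev SemilinRep : Type := List (Vec × List Vec)

/-- Membership in the semilinear set denoted by a representation. -/
def memSL (k : Vec) (L : SemilinRep) : Prop :=
  ∃ bp ∈ L, ∃ cs : List ℕ, cs.length = bp.2.length ∧
    k = bp.1 + (List.zipWith (fun (c : ℕ) (v : Vec) => c • v) cs bp.2).sum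

/-- Operations labelling the edges of a VASSB. -/
inductive VOp : Type where
  | delta : ZVec → VOp
  | inflate : ℕ → SemilinRep → VOp
  | deflate : ℕ → ℕ → ℕ → ℕ → VOp
  | burst : ℕ → VOp

/-- An edge of a VASSB: source state, operation, target state. -/
abbrev VEdge : Type := ℕ × VOp × ℕ

/-- A VASS with balloons `(Q, P, Ω, Φ, E)`. -/
structure VASSB where
  states : Finset ℕ
  places : Finset ℕ
  bstates : Finset ℕ
  bplaces : Finset ℕ
  edges : Finset VEdge

/-- A configuration `(q, m, n)` of a VASSB. -/
structure VConfig where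
  q : ℕ
  m : Vec
  bag : Multiset Balloon

/-- The effect of an operation on the places and the multiset of balloons. -/
def OpRel : VOp → Vec → Multiset Balloon → Vec → Multiset Balloon → Prop
  | .delta d, m, n, m', n' =>
      (∀ p, (m' p : ℤ) = (m p : ℤ) + d p) ∧ n' = n
  | .inflate s L, m, n, m', n' =>
      m' = m ∧ ∃ k : Vec, memSL k L ∧ n' = n + {(s, k)}
  | .deflate s s' pl p, m, n, m', n' =>
      ∃ (k : Vec) (n0 : Multiset Balloon),
        n = n0 + {(s, k)} ∧ m' = m + Finsupp.single p (k pl) ∧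
        n' = n0 + {(s', Finsupp.erase pl k)}
  | .burst s, m, n, m', n' =>
      m' = m ∧ ∃ (k : Vec) (n0 : Multiset Balloon), n = n0 + {(s, k)} ∧ n' = n0

/-- The step relation induced by the edge `e`. -/
def EdgeRel (e : VEdge) (c c' : VConfig) : Prop :=
  c.q = e.1 ∧ c'.q = e.2.2 ∧ OpRel e.2.1 c.m c.bag c'.m c'.bag

/-- One step of the VASSB `V`. -/
def VStep (V : VASSB) (c c' : VConfig) : Prop :=
  ∃ e ∈ V.edges, EdgeRel e c c'

/-- Reachability in a VASSB. -/
def VReach (V : VASSB) : VConfig → VConfig → Prop :=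
  Relation.ReflTransGen (VStep V)

/-- Semiconfigurations: configurations with no balloons. -/
def IsSemi (c : VConfig) : Prop := c.bag = 0

/-- An infinite run of the VASSB `V` from `c0`, given by its sequence of
configurations and the sequence of edges taken. -/
def IsInfRunV (V : VASSB) (c0 : VConfig) (rho : ℕ → VConfig) (es : ℕ → VEdge) : Prop :=
  rho 0 = c0 ∧ ∀ i, es i ∈ V.edges ∧ EdgeRel (es i) (rho i) (rho (i + 1))

/-- A finite run of length `n` of the VASSB `V` (the first `n` steps). -/
def IsFinRunV (V : VASSB) (n : ℕ) (rho : ℕ → VConfig) (es : ℕ → VEdge) : Prop :=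
  ∀ i < n, es i ∈ V.edges ∧ EdgeRel (es i) (rho i) (rho (i + 1))

/-- The step from `c` to `c'` via the edge `e` applies a deflate or a burst
operation to (an instance of) the balloon `b`. -/
def Touches (e : VEdge) (c c' : VConfig) (b : Balloon) : Prop :=
  (∃ (s' pl p : ℕ), e.2.1 = VOp.deflate b.1 s' pl p ∧
     ∃ n0, c.bag = n0 + {b} ∧ c'.bag = n0 + {(s', Finsupp.erase pl b.2)}) ∨
  (e.2.1 = VOp.burst b.1 ∧ ∃ n0, c.bag = n0 + {b} ∧ c'.bag = n0)

/-- A progressive infinite run: every balloon present in some configuration is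
deflated or burst at some later point, and every place carrying a token is
decremented by some later edge. -/
def ProgressiveV (V : VASSB) (c0 : VConfig) (rho : ℕ → VConfig) (es : ℕ → VEdge) : Prop :=
  IsInfRunV V c0 rho es ∧
  (∀ k, ∀ b ∈ (rho k).bag, ∃ j ≥ k, Touches (es j) (rho j) (rho (j + 1)) b) ∧
  (∀ k p, (rho k).m p ≠ 0 → ∃ j ≥ k, ∃ d : ZVec, (es j).2.1 = VOp.delta d ∧ d p < 0)

/-- `V` has an infinite progressive run from `c0`. -/
def HasProgRunV (V : VASSB) (c0 : VConfig) : Prop :=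
  ∃ rho es, ProgressiveV V c0 rho es

/-- A run of a VASSB is shallow if there is a bound `B` such that every
balloon inflated along the run contains at most `B` tokens. -/
def ShallowVRun (rho : ℕ → VConfig) (es : ℕ → VEdge) : Prop :=
  ∃ B, ∀ (i : ℕ) (s : ℕ) (L : SemilinRep) (k : Vec),
    (es i).2.1 = VOp.inflate s L →
    (rho (i + 1)).bag = (rho i).bag + {(s, k)} →
    (k.sum fun _ x => x) ≤ B

/-- A VASSB is zero-base if every linear set occurring in an inflate label of
one of its edges has base vector `0`. -/
def ZeroBase (V : VASSB) : Prop :=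
  ∀ e ∈ V.edges, ∀ (s : ℕ) (L : SemilinRep), e.2.1 = VOp.inflate s L →
    ∀ bp ∈ L, bp.1 = (0 : Vec)

/-! ### Effective encodings of VASSB and their configurations -/

def encodeVec (v : Vec) : ℕ := Encodable.encode v.graph.val

def encodeZVec (v : ZVec) : ℕ := Encodable.encode v.graph.val

def encodeSL (L : SemilinRep) : ℕ :=
  Encodable.encode (L.map fun bp => (encodeVec bp.1, bp.2.map encodeVec))

def encodeVOp : VOp → ℕ
  | .delta d => Nat.pair 0 (encodeZVec d)
  | .inflate s L => Nat.pair 1 (Nat.pair s (encodeSL L))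
  | .deflate s s' pl p => Nat.pair 2 (Encodable.encode (s, s', pl, p))
  | .burst s => Nat.pair 3 s

/-- An effective encoding of VASSB by natural numbers. -/
def encodeVASSB (V : VASSB) : ℕ :=
  Encodable.encode (V.states.val, V.places.val, V.bstates.val, V.bplaces.val,
    V.edges.val.map fun e => (e.1, encodeVOp e.2.1, e.2.2))

def encodeBalloon (b : Balloon) : ℕ := Encodable.encode (b.1, encodeVec b.2)

/-- An effective encoding of VASSB configurations by natural numbers. -/
def encodeVConfig (c : VConfig) : ℕ :=
  Encodable.encode (c.q, encodeVec c.m, c.bag.map encodeBalloon)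

/-! ### Raw machines: VASS with balloons in list form -/

/-- A vector given as a list of (place, amount) pairs. -/
abbrev Raw : Type := List (ℕ × ℕ)

/-- The vector denoted by a raw list. -/
def vec (l : Raw) : Vec := (l.map fun x => Finsupp.single x.1 x.2).sum

/-- Raw operations: updates (decrement, increment), inflations with a single
linear set, deflations and bursts. -/
abbrev ROp : Type := (Raw × Raw) ⊕ (ℕ × Raw × List Raw) ⊕ (ℕ × ℕ × ℕ × ℕ) ⊕ ℕ

abbrev REdge : Type := ℕ × ROp × ℕ

abbrev ROp.upd (d i : Raw) : ROp := Sum.inl (d, i)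
abbrev ROp.infl (s : ℕ) (b : Raw) (vs : List Raw) : ROp := Sum.inr (Sum.inl (s, b, vs))
abbrev ROp.defl (s s' pl p : ℕ) : ROp := Sum.inr (Sum.inr (Sum.inl (s, s', pl, p)))
abbrev ROp.brst (s : ℕ) : ROp := Sum.inr (Sum.inr (Sum.inr s))

/-- The vectors generated by a list of periods. -/
def span (vs : List Raw) : AddSubmonoid Vec := AddSubmonoid.closure {v | ∃ x ∈ vs, vec x = v}

/-- The effect of a raw operation. -/
def ROpRel : ROp → Vec → Multiset Balloon → Vec → Multiset Balloon → Prop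
  | .inl (d, i), m, n, m', n' => m' + vec d = m + vec i ∧ n' = n
  | .inr (.inl (s, b, vs)), m, n, m', n' =>
      m' = m ∧ ∃ y ∈ span vs, n' = n + {(s, vec b + y)}
  | .inr (.inr (.inl (s, s', pl, p))), m, n, m', n' =>
      ∃ (k : Vec) (n0 : Multiset Balloon),
        n = n0 + {(s, k)} ∧ m' = m + Finsupp.single p (k pl) ∧
        n' = n0 + {(s', Finsupp.erase pl k)}
  | .inr (.inr (.inr s)), m, n, m', n' =>
      m' = m ∧ ∃ (k : Vec) (n0 : Multiset Balloon), n = n0 + {(s, k)} ∧ n' = n0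

/-- The step relation of a raw edge. -/
def RRel (e : REdge) (c c' : VConfig) : Prop :=
  c.q = e.1 ∧ c'.q = e.2.2 ∧ ROpRel e.2.1 c.m c.bag c'.m c'.bag

/-- The tokens removed by a raw operation. -/
def dec : ROp → Vec
  | .inl (d, _) => vec d
  | .inr _ => 0

/-- The operation deflates or bursts the balloon `b`. -/
def RTouch : ROp → VConfig → VConfig → Balloon → Prop
  | .inl _, _, _, _ => False
  | .inr (.inl _), _, _, _ => False
  | .inr (.inr (.inl (s, s', pl, p))), c, c', b =>
      b.1 = s ∧ ∃ n0, c.bag = n0 + {b} ∧ c'.m = c.m + Finsupp.single p (b.2 pl) ∧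
        c'.bag = n0 + {(s', Finsupp.erase pl b.2)}
  | .inr (.inr (.inr s)), c, c', b =>
      b.1 = s ∧ c'.m = c.m ∧ ∃ n0, c.bag = n0 + {b} ∧ c'.bag = n0

/-- A progressive run of a raw machine. -/
def RProg (E : List REdge) (c0 : VConfig) : Prop :=
  ∃ (rho : ℕ → VConfig) (es : ℕ → REdge), rho 0 = c0 ∧
    (∀ i, es i ∈ E ∧ RRel (es i) (rho i) (rho (i + 1))) ∧
    (∀ k, ∀ b ∈ (rho k).bag, ∃ j ≥ k, RTouch (es j).2.1 (rho j) (rho (j + 1)) b) ∧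
    (∀ k p, (rho k).m p ≠ 0 → ∃ j ≥ k, dec (es j).2.1 p ≠ 0)

/-- One step of a raw machine. -/
def RStep (E : List REdge) (c c' : VConfig) : Prop := ∃ e ∈ E, RRel e c c'

/-- Reachability in a raw machine. -/
abbrev RReach (E : List REdge) : VConfig → VConfig → Prop := Relation.ReflTransGen (RStep E)

/-! ### Raw vectors -/

@[simp] theorem vec_nil : vec [] = 0 := rfl

@[simp] theorem vec_cons (x : ℕ × ℕ) (l : Raw) :
    vec (x :: l) = Finsupp.single x.1 x.2 + vec l := by simp [vec]

@[simp] theorem vec_append (l l' : Raw) : vec (l ++ l') = vec l + vec l' := by simp [vec]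

/-- The amount of `p` in a raw list. -/
def rval (l : Raw) (p : ℕ) : ℕ := ((l.filter fun x => x.1 = p).map Prod.snd).sum

theorem vec_apply (l : Raw) (p : ℕ) : vec l p = rval l p := by
  induction l with
  | nil => simp [rval]
  | cons x l ih =>
    rw [vec_cons, Finsupp.add_apply, ih, Finsupp.single_apply]
    by_cases h : x.1 = p <;> simp [rval, h]

theorem mem_keys_of_vec_ne {l : Raw} {p : ℕ} (h : vec l p ≠ 0) : p ∈ l.map Prod.fst := by
  induction l with
  | nil => simp at h
  | cons x l ih =>
    by_cases hx : x.1 = p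
    · simp [hx]
    · simp only [List.map_cons, List.mem_cons]
      right
      apply ih
      simpa [Finsupp.single_apply, hx] using h

/-- Remove a place from a raw vector. -/
def er (pl : ℕ) (r : Raw) : Raw := r.filter fun x => x.1 ≠ pl

theorem vec_er (pl : ℕ) (r : Raw) : vec (er pl r) = Finsupp.erase pl (vec r) := by
  ext p
  rw [vec_apply, Finsupp.erase_apply]
  by_cases h : p = pl
  · subst h
    simp [er, rval, List.filter_filter]
  · simp only [h, if_false, vec_apply, er, rval, List.filter_filter]
    congr 3
    ext x
    have : x.1 = p → x.1 ≠ pl := fun h1 h2 => h (h1.symm.trans h2)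
    by_cases hx : x.1 = p <;> simp_all

/-! ### Linear sets -/

theorem mem_span_iff (vs : List Raw) (y : Vec) : y ∈ span vs ↔
    ∃ cs : List ℕ, cs.length = vs.length ∧
      y = (List.zipWith (fun (c : ℕ) (v : Vec) => c • v) cs (vs.map vec)).sum := by
  constructor
  · intro h
    induction h using AddSubmonoid.closure_induction with
    | mem x hx =>
      obtain ⟨w, hw, rfl⟩ := hx
      obtain ⟨l1, l2, rfl⟩ := List.append_of_mem hw
      have key : ∀ l : List Raw, (List.zipWith (fun (c : ℕ) (v : Vec) => c • v)
          (List.replicate l.length 0) (l.map vec)).sum = 0 := by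
        intro l
        induction l with
        | nil => rfl
        | cons a l ih => simpa [List.replicate_succ] using ih
      refine ⟨List.replicate l1.length 0 ++ 1 :: List.replicate l2.length 0, by simp, ?_⟩
      rw [List.map_append, List.zipWith_append (by simp)]
      simp [key]
    | zero =>
      refine ⟨List.replicate vs.length 0, by simp, ?_⟩
      induction vs with
      | nil => rfl
      | cons a l ih => simpa [List.replicate_succ] using ih
    | add x y hx' hy' hx hy =>
      clear hx' hy'
      obtain ⟨c1, h1, rfl⟩ := hx
      obtain ⟨c2, h2, rfl⟩ := hy
      refine ⟨List.zipWith (· + ·) c1 c2, by simp [h1, h2], ?_⟩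
      induction vs generalizing c1 c2 with
      | nil => simp
      | cons a l ih =>
        cases c1 with
        | nil => simp at h1
        | cons x c1 =>
          cases c2 with
          | nil => simp at h2
          | cons y c2 =>
            simp only [List.length_cons, add_left_inj] at h1 h2
            simp only [List.map_cons, List.zipWith_cons_cons, List.sum_cons]
            rw [← ih c1 h1 c2 h2, add_smul]
            abel
  · rintro ⟨cs, hlen, rfl⟩
    have hmem : ∀ l : List Raw, (∀ x ∈ l, x ∈ vs) → ∀ cs : List ℕ,
        (List.zipWith (fun (c : ℕ) (v : Vec) => c • v) cs (l.map vec)).sum ∈ span vs := by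
      intro l
      induction l with
      | nil => intro _ cs; simp
      | cons a l ih =>
        intro h cs
        cases cs with
        | nil => simp
        | cons c cs =>
          simp only [List.map_cons, List.zipWith_cons_cons, List.sum_cons]
          have ha : vec a ∈ span vs :=
            AddSubmonoid.subset_closure (show ∃ x ∈ vs, vec x = vec a from ⟨a, h a (by simp), rfl⟩)
          refine add_mem (AddSubmonoid.nsmul_mem _ ha _) ?_
          exact ih (fun x hx => h x (by simp [hx])) cs
    exact hmem vs (fun _ h => h) cs

theorem memSL_singleton (k : Vec) (b : Raw) (vs : List Raw) :
    memSL k [(vec b, vs.map vec)] ↔ ∃ y ∈ span vs, k = vec b + y := by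
  simp only [memSL, List.mem_singleton, exists_eq_left, List.length_map, mem_span_iff]
  constructor
  · rintro ⟨cs, h, rfl⟩
    exact ⟨_, ⟨cs, h, rfl⟩, rfl⟩
  · rintro ⟨y, ⟨cs, h, rfl⟩, rfl⟩
    exact ⟨cs, h, rfl⟩

/-! ### Paths and lasso witnesses -/

/-- A path of a raw machine following a list of edges. -/
def RPath (E : List REdge) : VConfig → List REdge → VConfig → Prop
  | c, [], c' => c = c'
  | c, e :: es, c' => ∃ c1, e ∈ E ∧ RRel e c c1 ∧ RPath E c1 es c'

/-- The total number of tokens removed by a list of edges. -/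
def dsum (es : List REdge) : Vec := (es.map fun e => dec e.2.1).sum

@[simp] theorem dsum_nil : dsum [] = 0 := rfl

@[simp] theorem dsum_cons (e : REdge) (es : List REdge) :
    dsum (e :: es) = dec e.2.1 + dsum es := by simp [dsum]

@[simp] theorem dsum_append (es es' : List REdge) :
    dsum (es ++ es') = dsum es + dsum es' := by simp [dsum]

theorem RPath.append {E : List REdge} {c c' c'' : VConfig} {es es' : List REdge}
    (h : RPath E c es c') (h' : RPath E c' es' c'') : RPath E c (es ++ es') c'' := by
  induction es generalizing c with
  | nil => cases h; exact h'
  | cons e es ih =>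
    obtain ⟨c1, he, hr, h⟩ := h
    exact ⟨c1, he, hr, ih h⟩

theorem RPath.single {E : List REdge} {c c' : VConfig} {e : REdge} (he : e ∈ E)
    (h : RRel e c c') : RPath E c [e] c' := ⟨c', he, h, rfl⟩

theorem RPath.reach {E : List REdge} {c c' : VConfig} {es : List REdge}
    (h : RPath E c es c') : RReach E c c' := by
  induction es generalizing c with
  | nil => cases h; exact .refl
  | cons e es ih =>
    obtain ⟨c1, he, hr, h⟩ := h
    exact .head ⟨e, he, hr⟩ (ih h)

theorem RReach.path {E : List REdge} {c c' : VConfig} (h : RReach E c c') :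
    ∃ es, RPath E c es c' := by
  induction h using Relation.ReflTransGen.head_induction_on with
  | refl => exact ⟨[], rfl⟩
  | head h _ ih =>
    obtain ⟨es, hes⟩ := ih
    obtain ⟨e, he, hr⟩ := h
    exact ⟨e :: es, _, he, hr, hes⟩

/-- A lasso: a path of `Ea` to a balloon-free configuration at a state of `Q`, followed by
a nonempty cycle of `Eb` which does not decrease the marking, and which removes a token
from every place that is marked at its ends. -/
def Wit (Ea Eb : List REdge) (Q : List ℕ) (s : VConfig) : Prop :=
  ∃ q ∈ Q, ∃ (m1 m2 : Vec) (es : List REdge), RReach Ea s ⟨q, m1, 0⟩ ∧ es ≠ [] ∧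
    RPath Eb ⟨q, m1, 0⟩ es ⟨q, m2, 0⟩ ∧
    ∀ x, (m1 x = 0 ∧ m2 x = 0) ∨ (dsum es x ≠ 0 ∧ m1 x ≤ m2 x)

/-! ### The machine with counters for balloons -/

/-- Split a linear set according to which periods are used. -/
def births (b : Raw) : List Raw → List (Raw × List Raw)
  | [] => [(b, [])]
  | v :: vs => births b vs ++ (births b vs).map fun x => (v ++ x.1, v :: x.2)

/-- The closure of a list of raw vectors under removal of the given places. -/
def clos (ps : List ℕ) (l : List Raw) : List Raw :=
  ps.foldr (fun p acc => acc ++ acc.map (er p)) l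

/-- Control states: a pending increment together with a state. -/
def st (l : Raw) (q : ℕ) : ℕ := Encodable.encode (l, q)

/-- The place counting the balloons with state `σ` and raw content `r`. -/
def pT (σ : ℕ) (r : Raw) : ℕ := 2 * Encodable.encode (σ, r) + 1

/-- The balloon state `σ` annotated with the raw content `r`. -/
def bs (σ : ℕ) (r : Raw) : ℕ := Encodable.encode (σ, r)

/-- Rename the places of the original machine. -/
def renP (l : Raw) : Raw := l.map fun x => (2 * x.1, x.2)

def births0 (e : REdge) : List Raw :=
  match e.2.1 with
  | .inr (.inl (_, b, vs)) => (births b vs).map Prod.fst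
  | _ => []

def deflPl (e : REdge) : List ℕ :=
  match e.2.1 with
  | .inr (.inr (.inl (_, _, pl, _))) => [pl]
  | _ => []

def bstOf (e : REdge) : List ℕ :=
  match e.2.1 with
  | .inr (.inl (s, _, _)) => [s]
  | .inr (.inr (.inl (_, s', _, _))) => [s']
  | _ => []

/-- All raw contents of balloons. -/
def rawsOf (E : List REdge) : List Raw := clos (E.flatMap deflPl) (E.flatMap births0)

/-- The pending increment when a counted balloon is deflated. -/
def pendD (σ' pl p : ℕ) (r : Raw) : Raw :=
  (pT σ' (er pl r), 1) :: (r.filter fun x => x.1 = pl).map fun x => (2 * p, x.2)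

/-- The edges simulating an edge on explicitly represented balloons. -/
def honestE (R : List Raw) (e : REdge) : List REdge :=
  match e.2.1 with
  | .inl (d, i) => [(st [] e.1, .upd (renP d) (renP i), st [] e.2.2)]
  | .inr (.inl (s, b, vs)) =>
      (births b vs).map fun x => (st [] e.1, .infl (bs s x.1) x.1 x.2, st [] e.2.2)
  | .inr (.inr (.inl (s, s', pl, p))) =>
      R.map fun r => (st [] e.1, .defl (bs s r) (bs s' (er pl r)) pl (2 * p), st [] e.2.2)
  | .inr (.inr (.inr s)) => R.map fun r => (st [] e.1, .upd [(pT s r, 1)] [], st [] e.2.2)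

/-- The edges simulating a deflation of a counted balloon. -/
def counterE (R : List Raw) (e : REdge) : List REdge :=
  match e.2.1 with
  | .inr (.inr (.inl (s, s', pl, p))) =>
      R.flatMap fun r =>
        [(st [] e.1, .upd [(pT s r, 1)] [], st (pendD s' pl p r) e.2.2),
         (st (pendD s' pl p r) e.2.2, .upd [] (pendD s' pl p r), st [] e.2.2)]
  | _ => []

/-- The edges converting an explicit balloon into a counted one at the state `q`. -/
def convE (S : List ℕ) (R : List Raw) (q : ℕ) : List REdge :=
  S.flatMap fun s => R.flatMap fun r =>
    [(st [] q, .brst (bs s r), st [(pT s r, 1)] q),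
     (st [(pT s r, 1)] q, .upd [] [(pT s r, 1)], st [] q)]

def edgesA (E : List REdge) : List REdge :=
  E.flatMap fun e => honestE (rawsOf E) e ++ convE (E.flatMap bstOf) (rawsOf E) e.1

def edgesB (E : List REdge) : List REdge :=
  edgesA E ++ E.flatMap (counterE (rawsOf E))

def statesG (E : List REdge) : List ℕ := E.map fun e => st [] e.1

/-- The renamed marking. -/
def renV (v : Vec) : Vec := v.mapDomain fun p => 2 * p

/-! ### Properties of the splitting of linear sets -/

theorem span_nil : span [] = ⊥ := by simp [span]

theorem mem_span_cons {v : Raw} {vs : List Raw} {y : Vec} :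
    y ∈ span (v :: vs) ↔ ∃ (c : ℕ) (y' : Vec), y' ∈ span vs ∧ y = c • vec v + y' := by
  have : {w | ∃ x ∈ v :: vs, vec x = w} = {vec v} ∪ {w | ∃ x ∈ vs, vec x = w} := by
    ext w
    simp [eq_comm]
  simp only [span, this, AddSubmonoid.closure_union, AddSubmonoid.mem_sup,
    AddSubmonoid.mem_closure_singleton]
  constructor
  · rintro ⟨_, ⟨c, rfl⟩, z, hz, rfl⟩
    exact ⟨c, z, hz, rfl⟩
  · rintro ⟨c, z, hz, rfl⟩
    exact ⟨_, ⟨c, rfl⟩, z, hz, rfl⟩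

theorem births_sound {b : Raw} {vs : List Raw} {x : Raw × List Raw} (hx : x ∈ births b vs)
    {y : Vec} (hy : y ∈ span x.2) : ∃ z ∈ span vs, vec x.1 + y = vec b + z := by
  induction vs generalizing x y with
  | nil =>
    simp only [births, List.mem_singleton] at hx
    subst hx
    exact ⟨y, hy, rfl⟩
  | cons v vs ih =>
    simp only [births, List.mem_append, List.mem_map] at hx
    rcases hx with hx | ⟨w, hw, rfl⟩
    · obtain ⟨z, hz, h⟩ := ih hx hy
      exact ⟨z, mem_span_cons.2 ⟨0, z, hz, by simp⟩, h⟩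
    · obtain ⟨c, y', hy', rfl⟩ := mem_span_cons.1 hy
      obtain ⟨z, hz, h⟩ := ih hw hy'
      refine ⟨(c + 1) • vec v + z, mem_span_cons.2 ⟨c + 1, z, hz, rfl⟩, ?_⟩
      have : vec (v ++ w.1) + (c • vec v + y') = (c + 1) • vec v + (vec w.1 + y') := by
        rw [vec_append, succ_nsmul]
        abel
      rw [this, h]
      abel

theorem births_complete (b : Raw) {vs : List Raw} {z : Vec} (hz : z ∈ span vs) :
    ∃ x ∈ births b vs, ∃ y ∈ span x.2, vec b + z = vec x.1 + y := by
  induction vs generalizing z with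
  | nil => exact ⟨(b, []), by simp [births], z, hz, rfl⟩
  | cons v vs ih =>
    obtain ⟨c, z', hz', rfl⟩ := mem_span_cons.1 hz
    obtain ⟨x, hx, y, hy, h⟩ := ih hz'
    cases c with
    | zero => exact ⟨x, by simp [births, hx], y, hy, by simpa using h⟩
    | succ c =>
      refine ⟨(v ++ x.1, v :: x.2), ?_, c • vec v + y, mem_span_cons.2 ⟨c, y, hy, rfl⟩, ?_⟩
      · simp only [births, List.mem_append, List.mem_map]
        exact Or.inr ⟨x, hx, rfl⟩
      · have : vec b + ((c + 1) • vec v + z') = (c + 1) • vec v + (vec b + z') := by abel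
        rw [this, h, vec_append, succ_nsmul]
        abel

theorem births_supp {b : Raw} {vs : List Raw} {x : Raw × List Raw} (hx : x ∈ births b vs)
    {y : Vec} (hy : y ∈ span x.2) {p : ℕ} (hp : vec x.1 p = 0) : y p = 0 := by
  induction vs generalizing x y with
  | nil =>
    simp only [births, List.mem_singleton] at hx
    subst hx
    rw [span_nil, AddSubmonoid.mem_bot] at hy
    simp [hy]
  | cons v vs ih =>
    simp only [births, List.mem_append, List.mem_map] at hx
    rcases hx with hx | ⟨w, hw, rfl⟩
    · exact ih hx hy hp
    · obtain ⟨c, y', hy', rfl⟩ := mem_span_cons.1 hy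
      simp only [vec_append, Finsupp.add_apply, add_eq_zero] at hp
      simp [hp.1, ih hw hy' hp.2]

/-! ### Properties of the closure under removal -/

theorem er_comm (p q : ℕ) (r : Raw) : er p (er q r) = er q (er p r) := by
  simp [er, List.filter_filter, Bool.and_comm]

theorem er_idem (p : ℕ) (r : Raw) : er p (er p r) = er p r := by
  simp [er, List.filter_filter]

theorem subset_clos (ps : List ℕ) (l : List Raw) : l ⊆ clos ps l := by
  induction ps with
  | nil => exact fun _ h => h
  | cons p ps ih => exact fun r hr => by simpa [clos] using Or.inl (ih hr)

theorem er_mem_clos {ps : List ℕ} {l : List Raw} {p : ℕ} (hp : p ∈ ps) {r : Raw}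
    (hr : r ∈ clos ps l) : er p r ∈ clos ps l := by
  induction ps generalizing r with
  | nil => simp at hp
  | cons a ps ih =>
    have hc : clos (a :: ps) l = clos ps l ++ (clos ps l).map (er a) := rfl
    rw [hc, List.mem_append, List.mem_map] at hr ⊢
    rw [List.mem_cons] at hp
    rcases hp with rfl | hp
    · rcases hr with hr | ⟨s, hs, rfl⟩
      · exact Or.inr ⟨r, hr, rfl⟩
      · exact Or.inr ⟨s, hs, (er_idem p s).symm⟩
    · rcases hr with hr | ⟨s, hs, rfl⟩
      · exact Or.inl (ih hp hr)
      · exact Or.inr ⟨er p s, ih hp hs, er_comm a p s⟩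

theorem er_mem_rawsOf {E : List REdge} {q q' s s' pl p : ℕ}
    (he : (q, ROp.defl s s' pl p, q') ∈ E) {r : Raw} (hr : r ∈ rawsOf E) :
    er pl r ∈ rawsOf E :=
  er_mem_clos (List.mem_flatMap.2 ⟨_, he, by simp [deflPl]⟩) hr

theorem births_mem_rawsOf {E : List REdge} {q q' s : ℕ} {b : Raw} {vs : List Raw}
    (he : (q, ROp.infl s b vs, q') ∈ E) {x : Raw × List Raw} (hx : x ∈ births b vs) :
    x.1 ∈ rawsOf E :=
  subset_clos _ _ (List.mem_flatMap.2 ⟨_, he, by simpa [births0] using ⟨x.2, hx⟩⟩)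

/-! ### Codes -/

theorem st_inj {l l' : Raw} {q q' : ℕ} : st l q = st l' q' ↔ l = l' ∧ q = q' := by
  simp [st]

theorem bs_inj {s s' : ℕ} {r r' : Raw} : bs s r = bs s' r' ↔ s = s' ∧ r = r' := by
  simp [bs]

theorem pT_inj {s s' : ℕ} {r r' : Raw} : pT s r = pT s' r' ↔ s = s' ∧ r = r' := by
  simp [pT]

theorem renV_even (v : Vec) (p : ℕ) : renV v (2 * p) = v p :=
  Finsupp.mapDomain_apply (fun a b h => by simpa using h) v p

theorem renV_odd (v : Vec) (n : ℕ) : renV v (2 * n + 1) = 0 :=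
  Finsupp.mapDomain_of_notMem_range _ _ (by rintro ⟨a, h⟩; simp at h; omega)

theorem renV_add (v w : Vec) : renV (v + w) = renV v + renV w := Finsupp.mapDomain_add

theorem renV_single (p n : ℕ) : renV (Finsupp.single p n) = Finsupp.single (2 * p) n :=
  Finsupp.mapDomain_single

theorem vec_renP (l : Raw) : vec (renP l) = renV (vec l) := by
  induction l with
  | nil => simp [renP, renV]
  | cons x l ih =>
    have : renP (x :: l) = (2 * x.1, x.2) :: renP l := rfl
    rw [this, vec_cons, vec_cons, renV_add, renV_single, ih]

theorem vec_pendD (s' pl p : ℕ) (r : Raw) : vec (pendD s' pl p r) =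
    Finsupp.single (pT s' (er pl r)) 1 + Finsupp.single (2 * p) (vec r pl) := by
  rw [pendD, vec_cons, vec_apply, rval]
  congr 1
  induction r.filter (fun x => x.1 = pl) with
  | nil => simp
  | cons x l ih => simp [ih, Finsupp.single_add]

/-! ### Infinite runs from finite segments -/

/-- A finite run of length `L`. -/
def Seg (E : List REdge) (c c' : VConfig) (L : ℕ) (rho : ℕ → VConfig) (es : ℕ → REdge) : Prop :=
  rho 0 = c ∧ rho L = c' ∧ ∀ i < L, es i ∈ E ∧ RRel (es i) (rho i) (rho (i + 1))

theorem mem_bag_step {e : REdge} {c c' : VConfig} (h : RRel e c c') {b : Balloon}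
    (hb : b ∈ c.bag) : b ∈ c'.bag ∨ RTouch e.2.1 c c' b := by
  obtain ⟨q, op, q'⟩ := e
  obtain ⟨-, -, h⟩ := h
  rcases op with ⟨d, i⟩ | ⟨s, b0, vs⟩ | ⟨s, s', pl, p⟩ | s
  · left; rw [h.2]; exact hb
  · obtain ⟨-, y, -, h⟩ := h
    left; rw [h]; simp [hb]
  · obtain ⟨k, n0, h1, h2, h3⟩ := h
    rw [h1] at hb
    rcases Multiset.mem_add.1 hb with hb | hb
    · left; rw [h3]; simp [hb]
    · rw [Multiset.mem_singleton] at hb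
      subst hb
      exact Or.inr ⟨rfl, n0, h1, h2, h3⟩
  · obtain ⟨h0, k, n0, h1, h2⟩ := h
    rw [h1] at hb
    rcases Multiset.mem_add.1 hb with hb | hb
    · left; rw [h2]; exact hb
    · rw [Multiset.mem_singleton] at hb
      subst hb
      exact Or.inr ⟨rfl, h0, n0, h1, h2⟩

theorem mark_step {e : REdge} {c c' : VConfig} (h : RRel e c c') {p : ℕ}
    (hp : c.m p ≠ 0) : c'.m p ≠ 0 ∨ dec e.2.1 p ≠ 0 := by
  obtain ⟨q, op, q'⟩ := e
  obtain ⟨-, -, h⟩ := h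
  rcases op with ⟨d, i⟩ | ⟨s, b0, vs⟩ | ⟨s, s', pl, p'⟩ | s
  · have := DFunLike.congr_fun h.1 p
    simp only [Finsupp.add_apply] at this
    simp only [dec]
    omega
  · left; rw [h.1]; exact hp
  · obtain ⟨k, n0, h1, h2, h3⟩ := h
    left; rw [h2, Finsupp.add_apply]; omega
  · left; rw [h.1]; exact hp

theorem mem_bag_run {rho : ℕ → VConfig} {es : ℕ → REdge}
    (h : ∀ i, RRel (es i) (rho i) (rho (i + 1))) {b : Balloon} {k : ℕ} (hb : b ∈ (rho k).bag)
    (n : ℕ) : b ∈ (rho (k + n)).bag ∨ ∃ j ≥ k, RTouch (es j).2.1 (rho j) (rho (j + 1)) b := by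
  induction n with
  | zero => exact Or.inl hb
  | succ n ih =>
    rcases ih with ih | ih
    · rcases mem_bag_step (h (k + n)) ih with h1 | h1
      · exact Or.inl h1
      · exact Or.inr ⟨k + n, by omega, h1⟩
    · exact Or.inr ih

theorem mark_run {rho : ℕ → VConfig} {es : ℕ → REdge}
    (h : ∀ i, RRel (es i) (rho i) (rho (i + 1))) {p k : ℕ} (hb : (rho k).m p ≠ 0)
    (n : ℕ) : (rho (k + n)).m p ≠ 0 ∨ ∃ j ≥ k, dec (es j).2.1 p ≠ 0 := by
  induction n with
  | zero => exact Or.inl hb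
  | succ n ih =>
    rcases ih with ih | ih
    · rcases mark_step (h (k + n)) ih with h1 | h1
      · exact Or.inl h1
      · exact Or.inr ⟨k + n, by omega, h1⟩
    · exact Or.inr ih

theorem RProg.head {E : List REdge} {c c' : VConfig} (h : RStep E c c') (h' : RProg E c') :
    RProg E c := by
  obtain ⟨e, he, hr⟩ := h
  obtain ⟨rho, es, h0, h1, h2, h3⟩ := h'
  have hrun : ∀ i, (fun n => Nat.casesOn n e es : ℕ → REdge) i ∈ E ∧
      RRel ((fun n => Nat.casesOn n e es : ℕ → REdge) i)
        ((fun n => Nat.casesOn n c rho : ℕ → VConfig) i)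
        ((fun n => Nat.casesOn n c rho : ℕ → VConfig) (i + 1)) := by
    intro i
    cases i with
    | zero => exact ⟨he, by simpa [h0] using hr⟩
    | succ i => exact h1 i
  have hb : ∀ k, ∀ b ∈ ((fun n => Nat.casesOn n c rho : ℕ → VConfig) (k + 1)).bag, ∃ j ≥ k + 1,
      RTouch ((fun n => Nat.casesOn n e es : ℕ → REdge) j).2.1
        ((fun n => Nat.casesOn n c rho : ℕ → VConfig) j)
        ((fun n => Nat.casesOn n c rho : ℕ → VConfig) (j + 1)) b := by
    intro k b hb
    obtain ⟨j, hj, ht⟩ := h2 k b hb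
    exact ⟨j + 1, by omega, ht⟩
  have hm : ∀ k p, ((fun n => Nat.casesOn n c rho : ℕ → VConfig) (k + 1)).m p ≠ 0 → ∃ j ≥ k + 1,
      dec ((fun n => Nat.casesOn n e es : ℕ → REdge) j).2.1 p ≠ 0 := by
    intro k p hp
    obtain ⟨j, hj, ht⟩ := h3 k p hp
    exact ⟨j + 1, by omega, ht⟩
  refine ⟨fun n => Nat.casesOn n c rho, fun n => Nat.casesOn n e es, rfl, hrun, ?_, ?_⟩
  · intro k b hbk
    cases k with
    | zero =>
      rcases mem_bag_run (rho := (fun n => Nat.casesOn n c rho : ℕ → VConfig))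
          (es := (fun n => Nat.casesOn n e es : ℕ → REdge)) (fun i => (hrun i).2)
          (k := 0) hbk 1 with h | h
      · obtain ⟨j, -, h⟩ := hb 0 b h
        exact ⟨j, by omega, h⟩
      · exact h
    | succ k => exact hb k b hbk
  · intro k p hpk
    cases k with
    | zero =>
      rcases mark_run (rho := (fun n => Nat.casesOn n c rho : ℕ → VConfig))
          (es := (fun n => Nat.casesOn n e es : ℕ → REdge)) (fun i => (hrun i).2)
          (k := 0) hpk 1 with h | h
      · obtain ⟨j, -, h⟩ := hm 0 p h
        exact ⟨j, by omega, h⟩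
      · exact h
    | succ k => exact hm k p hpk

theorem RProg.of_reach {E : List REdge} {c c' : VConfig} (h : RReach E c c')
    (h' : RProg E c') : RProg E c := by
  induction h using Relation.ReflTransGen.head_induction_on with
  | refl => exact h'
  | head h _ ih => exact ih.head h

/-- A progressive run is obtained by concatenating segments serving one balloon each. -/
theorem RProg.of_stages {E : List REdge} (Good : VConfig → Prop)
    (hstage : ∀ c, Good c → ∀ b : Balloon, ∃ c' L rho es, Good c' ∧ 0 < L ∧ Seg E c c' L rho es ∧
      (b ∈ c.bag → ∃ i < L, RTouch (es i).2.1 (rho i) (rho (i + 1)) b) ∧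
      ∀ p, c.m p ≠ 0 → ∃ i < L, dec (es i).2.1 p ≠ 0)
    {c : VConfig} (hc : Good c) : RProg E c := by
  have hst : ∀ (x : {c // Good c}) (b : Balloon), ∃ (y : {c // Good c}) (L : ℕ)
      (rho : ℕ → VConfig) (es : ℕ → REdge), 0 < L ∧ Seg E x.1 y.1 L rho es ∧
      (b ∈ x.1.bag → ∃ i < L, RTouch (es i).2.1 (rho i) (rho (i + 1)) b) ∧
      ∀ p, x.1.m p ≠ 0 → ∃ i < L, dec (es i).2.1 p ≠ 0 := by
    rintro ⟨x, hx⟩ b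
    obtain ⟨c', L, rho, es, h1, h2⟩ := hstage x hx b
    exact ⟨⟨c', h1⟩, L, rho, es, h2⟩
  choose nxt Len Rho Es hL hSeg hT hD using hst
  obtain ⟨β, hβ⟩ := exists_surjective_nat Balloon
  let X : ℕ → {c // Good c} := fun n =>
    Nat.rec ⟨c, hc⟩ (fun n x => nxt x (β n.unpair.1)) n
  have hX : ∀ n, X (n + 1) = nxt (X n) (β n.unpair.1) := fun n => rfl
  let len : ℕ → ℕ := fun n => Len (X n) (β n.unpair.1)
  let rho : ℕ → ℕ → VConfig := fun n => Rho (X n) (β n.unpair.1)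
  let es : ℕ → ℕ → REdge := fun n => Es (X n) (β n.unpair.1)
  have hlen : ∀ n, 0 < len n := fun n => hL _ _
  have hseg : ∀ n, Seg E (X n).1 (X (n + 1)).1 (len n) (rho n) (es n) := fun n => hSeg _ _
  let pos : ℕ → ℕ × ℕ := fun t =>
    Nat.rec (0, 0) (fun _ x => if x.2 + 1 < len x.1 then (x.1, x.2 + 1) else (x.1 + 1, 0)) t
  have hpos : ∀ t, pos (t + 1) = if (pos t).2 + 1 < len (pos t).1 then ((pos t).1, (pos t).2 + 1)
      else ((pos t).1 + 1, 0) := fun t => rfl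
  have hlt : ∀ t, (pos t).2 < len (pos t).1 := by
    intro t
    induction t with
    | zero => exact hlen 0
    | succ t ih =>
      rw [hpos]
      split_ifs with h
      · exact h
      · exact hlen ((pos t).1 + 1)
  have hadv : ∀ n t, pos t = (n, 0) → ∀ j < len n, pos (t + j) = (n, j) := by
    intro n t ht j hj
    induction j with
    | zero => exact ht
    | succ j ih =>
      rw [← add_assoc, hpos, ih (by omega)]
      simp [hj]
  have hstart : ∀ n, ∃ t ≥ n, pos t = (n, 0) := by
    intro n
    induction n with
    | zero => exact ⟨0, le_rfl, rfl⟩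
    | succ n ih =>
      obtain ⟨t, htn, ht⟩ := ih
      have h0 := hlen n
      refine ⟨t + (len n - 1) + 1, by omega, ?_⟩
      rw [hpos, hadv n t ht (len n - 1) (by omega)]
      simp [Nat.sub_add_cancel h0]
  have hcfg : ∀ t, rho (pos (t + 1)).1 (pos (t + 1)).2 = rho (pos t).1 ((pos t).2 + 1) := by
    intro t
    rw [hpos]
    split_ifs with h
    · rfl
    · have h1 : (pos t).2 + 1 = len (pos t).1 := by have := hlt t; omega
      rw [h1, (hseg _).2.1]
      exact (hseg ((pos t).1 + 1)).1
  have hrun : ∀ t, es (pos t).1 (pos t).2 ∈ E ∧ RRel (es (pos t).1 (pos t).2)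
      (rho (pos t).1 (pos t).2) (rho (pos (t + 1)).1 (pos (t + 1)).2) := by
    intro t
    rw [hcfg]
    exact (hseg _).2.2 _ (hlt t)
  refine ⟨fun t => rho (pos t).1 (pos t).2, fun t => es (pos t).1 (pos t).2, (hseg 0).1, hrun,
    ?_, ?_⟩
  · intro k b hb
    obtain ⟨a, rfl⟩ := hβ b
    obtain ⟨t, ht, hpt⟩ := hstart (Nat.pair a k)
    have hk : k ≤ t := (Nat.right_le_pair a k).trans ht
    obtain ⟨n, rfl⟩ := Nat.exists_eq_add_of_le hk
    rcases mem_bag_run (rho := fun t => rho (pos t).1 (pos t).2) (fun i => (hrun i).2) hb n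
      with h | h
    · have h' : β a ∈ (X (Nat.pair a k)).1.bag := by
        simp only [hpt] at h
        rwa [(hseg _).1] at h
      have hT' := hT (X (Nat.pair a k)) (β (Nat.pair a k).unpair.1)
      rw [show (Nat.pair a k).unpair.1 = a by simp] at hT'
      obtain ⟨i, hi, h2⟩ := hT' h'
      refine ⟨k + n + i, by omega, ?_⟩
      have hi' : i < len (Nat.pair a k) := by simpa [len] using hi
      have hp := hadv _ _ hpt i hi'
      show RTouch (es (pos (k + n + i)).1 (pos (k + n + i)).2).2.1
        (rho (pos (k + n + i)).1 (pos (k + n + i)).2)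
        (rho (pos (k + n + i + 1)).1 (pos (k + n + i + 1)).2) (β a)
      rw [hcfg, hp]
      simpa [rho, es] using h2
    · exact h
  · intro k p hp
    obtain ⟨t, ht, hpt⟩ := hstart k
    obtain ⟨n, rfl⟩ := Nat.exists_eq_add_of_le ht
    rcases mark_run (rho := fun t => rho (pos t).1 (pos t).2) (fun i => (hrun i).2) hp n
      with h | h
    · have h' : (X k).1.m p ≠ 0 := by
        simp only [hpt] at h
        rwa [(hseg _).1] at h
      obtain ⟨i, hi, h2⟩ := hD (X k) (β k.unpair.1) p h'
      refine ⟨k + n + i, by omega, ?_⟩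
      have hp := hadv _ _ hpt i hi
      show dec (es (pos (k + n + i)).1 (pos (k + n + i)).2).2.1 p ≠ 0
      rw [hp]
      exact h2
    · exact h

theorem Seg.refl (E : List REdge) (c : VConfig) (es : ℕ → REdge) :
    Seg E c c 0 (fun _ => c) es := ⟨rfl, rfl, by simp⟩

theorem Seg.cons {E : List REdge} {c c1 c' : VConfig} {L : ℕ} {rho : ℕ → VConfig}
    {es : ℕ → REdge} {e : REdge} (he : e ∈ E) (hr : RRel e c c1) (h : Seg E c1 c' L rho es) :
    Seg E c c' (L + 1) (fun n => Nat.casesOn n c rho) (fun n => Nat.casesOn n e es) := by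
  obtain ⟨h0, h1, h2⟩ := h
  refine ⟨rfl, h1, ?_⟩
  intro i hi
  cases i with
  | zero => exact ⟨he, by simpa [h0] using hr⟩
  | succ i => exact h2 i (by omega)

/-! ### Soundness of the counter machine -/

/-- The edges of the machine with counters; those of the second machine carry `true`. -/
inductive GEdge (E : List REdge) : Bool → REdge → Prop
  | upd {t q q' d i} : (q, ROp.upd d i, q') ∈ E →
      GEdge E t (st [] q, .upd (renP d) (renP i), st [] q')
  | infl {t q q' s b vs r I} : (q, ROp.infl s b vs, q') ∈ E → (r, I) ∈ births b vs →
      GEdge E t (st [] q, .infl (bs s r) r I, st [] q')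
  | defl {t q q' s s' pl p r} : (q, ROp.defl s s' pl p, q') ∈ E → r ∈ rawsOf E →
      GEdge E t (st [] q, .defl (bs s r) (bs s' (er pl r)) pl (2 * p), st [] q')
  | brst {t q q' s r} : (q, ROp.brst s, q') ∈ E → r ∈ rawsOf E →
      GEdge E t (st [] q, .upd [(pT s r, 1)] [], st [] q')
  | conv {t q op q' s r} : (q, op, q') ∈ E → s ∈ E.flatMap bstOf → r ∈ rawsOf E →
      GEdge E t (st [] q, .brst (bs s r), st [(pT s r, 1)] q)
  | conv' {t q op q' s r} : (q, op, q') ∈ E → s ∈ E.flatMap bstOf → r ∈ rawsOf E →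
      GEdge E t (st [(pT s r, 1)] q, .upd [] [(pT s r, 1)], st [] q)
  | ctr {q q' s s' pl p r} : (q, ROp.defl s s' pl p, q') ∈ E → r ∈ rawsOf E →
      GEdge E true (st [] q, .upd [(pT s r, 1)] [], st (pendD s' pl p r) q')
  | ctr' {q q' s s' pl p r} : (q, ROp.defl s s' pl p, q') ∈ E → r ∈ rawsOf E →
      GEdge E true (st (pendD s' pl p r) q', .upd [] (pendD s' pl p r), st [] q')

theorem GEdge.of_mem_edgesA {E : List REdge} {t : Bool} {e : REdge} (h : e ∈ edgesA E) :
    GEdge E t e := by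
  simp only [edgesA, List.mem_flatMap, List.mem_append] at h
  obtain ⟨⟨q, op, q'⟩, he, h | h⟩ := h
  · rcases op with ⟨d, i⟩ | ⟨s, b0, vs⟩ | ⟨s, s', pl, p⟩ | s

    · simp only [honestE, List.mem_singleton] at h
      subst h
      exact .upd he
    · simp only [honestE, List.mem_map] at h
      obtain ⟨⟨r, I⟩, hx, rfl⟩ := h
      exact .infl he hx
    · simp only [honestE, List.mem_map] at h
      obtain ⟨r, hx, rfl⟩ := h
      exact .defl he hx
    · simp only [honestE, List.mem_map] at h
      obtain ⟨r, hx, rfl⟩ := h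
      exact .brst he hx
  · simp only [convE, List.mem_flatMap (b := e), List.mem_cons, List.not_mem_nil, or_false] at h
    obtain ⟨s, hs, r, hr, rfl | rfl⟩ := h
    · exact .conv he hs hr
    · exact .conv' he hs hr

theorem GEdge.of_mem_edgesB {E : List REdge} {e : REdge} (h : e ∈ edgesB E) :
    GEdge E true e := by
  rcases List.mem_append.1 h with h | h
  · exact .of_mem_edgesA h
  · simp only [List.mem_flatMap] at h
    obtain ⟨⟨q, op, q'⟩, he, h⟩ := h
    rcases op with ⟨d, i⟩ | ⟨s, b0, vs⟩ | ⟨s, s', pl, p⟩ | s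
    · simp [counterE] at h
    · simp [counterE] at h
    · simp only [counterE, List.mem_flatMap, List.mem_cons, List.not_mem_nil, or_false] at h
      obtain ⟨r, hr, rfl | rfl⟩ := h
      · exact .ctr he hr
      · exact .ctr' he hr
    · simp [counterE] at h

theorem GEdge.mem_edgesA {E : List REdge} {e : REdge} (h : GEdge E false e) : e ∈ edgesA E := by
  simp only [edgesA, List.mem_flatMap, List.mem_append]
  cases h with
  | upd h => exact ⟨_, h, Or.inl (by simp [honestE])⟩
  | infl h hx => exact ⟨_, h, Or.inl (List.mem_map.2 ⟨_, hx, rfl⟩)⟩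
  | defl h hr => exact ⟨_, h, Or.inl (List.mem_map.2 ⟨_, hr, rfl⟩)⟩
  | brst h hr => exact ⟨_, h, Or.inl (List.mem_map.2 ⟨_, hr, rfl⟩)⟩
  | conv h hs hr =>
    exact ⟨_, h, Or.inr (List.mem_flatMap.2 ⟨_, hs, List.mem_flatMap.2 ⟨_, hr, by simp⟩⟩)⟩
  | conv' h hs hr =>
    exact ⟨_, h, Or.inr (List.mem_flatMap.2 ⟨_, hs, List.mem_flatMap.2 ⟨_, hr, by simp⟩⟩)⟩

theorem GEdge.mem_edgesB {E : List REdge} {t : Bool} {e : REdge} (h : GEdge E t e) :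
    e ∈ edgesB E := by
  rw [edgesB, List.mem_append]
  cases h with
  | upd h => exact Or.inl (mem_edgesA (.upd h))
  | infl h hx => exact Or.inl (mem_edgesA (.infl h hx))
  | defl h hr => exact Or.inl (mem_edgesA (.defl h hr))
  | brst h hr => exact Or.inl (mem_edgesA (.brst h hr))
  | conv h hs hr => exact Or.inl (mem_edgesA (.conv h hs hr))
  | conv' h hs hr => exact Or.inl (mem_edgesA (.conv' h hs hr))
  | ctr h hr =>
    exact Or.inr (List.mem_flatMap.2 ⟨_, h, List.mem_flatMap.2 ⟨_, hr, by simp⟩⟩)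
  | ctr' h hr =>
    exact Or.inr (List.mem_flatMap.2 ⟨_, h, List.mem_flatMap.2 ⟨_, hr, by simp⟩⟩)

/-- The pending increment of a control state. -/
def pendOf (q : ℕ) : Raw := ((Encodable.decode (α := Raw × ℕ) q).getD ([], 0)).1

@[simp] theorem pendOf_st (l : Raw) (q : ℕ) : pendOf (st l q) = l := by simp [pendOf, st]

/-- The marking including pending increments. -/
def norm (a : VConfig) : Vec := a.m + vec (pendOf a.q)

/-- An annotated balloon: state, raw content, actual content. -/
abbrev Ann : Type := ℕ × Raw × Vec

def realB (x : Ann) : Balloon := (x.1, x.2.2)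
def machB (x : Ann) : Balloon := (bs x.1 x.2.1, x.2.2)
def OkB (x : Ann) : Prop := vec x.2.1 ≤ x.2.2 ∧ ∀ p, vec x.2.1 p = 0 → x.2.2 p = 0

/-- The counter of an annotated balloon. -/
def cnt (x : Ann) : Vec := Finsupp.single (pT x.1 x.2.1) 1

/-- The marking corresponding to a real marking and a multiset of counted balloons. -/
def target (m : Vec) (W : Multiset Ann) : Vec := renV m + (W.map cnt).sum

theorem target_add (m : Vec) (W : Multiset Ann) (x : Ann) :
    target m (W + {x}) = target m W + cnt x := by
  simp [target, add_assoc]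

/-- The counter machine configuration `a` simulates `c`, where the balloons in `W` are
represented by counters. Exactness may fail at the places in `G`. -/
def Sim (G : ℕ → Prop) (a c : VConfig) (W : Multiset Ann) : Prop :=
  ∃ (l : Raw) (H : Multiset Ann), a.q = st l c.q ∧ c.bag = (H + W).map realB ∧
    a.bag = H.map machB ∧ (∀ x ∈ H + W, OkB x) ∧
    ∀ y, norm a y ≤ target c.m W y ∧ (norm a y = target c.m W y ∨ G y)

theorem exists_of_map_eq_add {α β : Type*} {f : α → β} {H : Multiset α} {n : Multiset β} {b : β}
    (h : H.map f = n + {b}) : ∃ H0 x, H = H0 + {x} ∧ f x = b ∧ n = H0.map f := by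
  have hb : b ∈ H.map f := by rw [h]; simp
  obtain ⟨x, hx, rfl⟩ := Multiset.mem_map.1 hb
  obtain ⟨H0, rfl⟩ := Multiset.exists_cons_of_mem hx
  refine ⟨H0, x, (Multiset.singleton_add x H0 ▸ add_comm {x} H0), rfl, ?_⟩
  rw [Multiset.map_cons, ← Multiset.singleton_add, add_comm] at h
  exact (add_right_cancel h).symm

theorem exists_counted {m : Vec} {W : Multiset Ann} {s : ℕ} {r : Raw}
    (h : target m W (pT s r) ≠ 0) (w : Ann) :
    ∃ W0 x, W = W0 + {x} ∧ x.1 = s ∧ x.2.1 = r ∧ (w ∈ W → w.1 = s → w.2.1 = r → x = w) := by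
  have hex : ∃ x ∈ W, x.1 = s ∧ x.2.1 = r := by
    by_contra hcon
    push Not at hcon
    apply h
    have h1 : renV m (pT s r) = 0 := renV_odd _ _
    rw [target, Finsupp.add_apply, h1, zero_add]
    clear h h1
    induction W using Multiset.induction with
    | empty => simp
    | cons x W ih =>
      rw [Multiset.map_cons, Multiset.sum_cons, Finsupp.add_apply,
        ih (fun y hy => hcon y (Multiset.mem_cons_of_mem hy)), add_zero, cnt,
        Finsupp.single_apply, if_neg]
      rw [pT_inj]
      rintro ⟨h1, h2⟩
      exact hcon x (Multiset.mem_cons_self _ _) h1 h2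
  have main : ∀ x ∈ W, ∃ W0, W = W0 + {x} := by
    intro x hx
    obtain ⟨W0, rfl⟩ := Multiset.exists_cons_of_mem hx
    exact ⟨W0, by rw [add_comm, Multiset.singleton_add]⟩
  by_cases hw : w ∈ W ∧ w.1 = s ∧ w.2.1 = r
  · obtain ⟨W0, hW⟩ := main w hw.1
    exact ⟨W0, w, hW, hw.2.1, hw.2.2, fun _ _ _ => rfl⟩
  · obtain ⟨x, hx, h1, h2⟩ := hex
    obtain ⟨W0, hW⟩ := main x hx
    exact ⟨W0, x, hW, h1, h2, fun a b c => absurd ⟨a, b, c⟩ hw⟩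

theorem norm_mono_step {E : List REdge} {e : REdge} (he : GEdge E true e) {a a' : VConfig}
    (h : RRel e a a') {y : ℕ} (hy : dec e.2.1 y = 0) : norm a y ≤ norm a' y := by
  obtain ⟨h1, h2, h3⟩ := h
  simp only [norm, Finsupp.add_apply]
  cases he with
  | upd _ | brst _ _ | conv' _ _ _ | ctr _ _ | ctr' _ _ =>
    have := DFunLike.congr_fun h3.1 y
    simp only [Finsupp.add_apply] at this
    simp only [dec] at hy
    simp only [h1, h2, pendOf_st, vec_nil, Finsupp.coe_zero, Pi.zero_apply] at *
    omega
  | infl _ _ =>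
    simp only [h1, h2, pendOf_st, h3.1]
    exact le_rfl
  | defl _ _ =>
    obtain ⟨k, n0, -, h4, -⟩ := h3
    simp only [h1, h2, pendOf_st, h4, Finsupp.add_apply]
    omega
  | conv _ _ _ =>
    simp only [h1, h2, pendOf_st, h3.1, vec_nil, Finsupp.coe_zero, Pi.zero_apply]
    omega

theorem norm_mono_path {E : List REdge} {es : List REdge} {a a' : VConfig}
    (h : RPath (edgesB E) a es a') {y : ℕ} (hy : dsum es y = 0) : norm a y ≤ norm a' y := by
  induction es generalizing a with
  | nil => cases h; exact le_rfl
  | cons e es ih =>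
    obtain ⟨c1, he, hr, h⟩ := h
    simp only [dsum_cons, Finsupp.add_apply, add_eq_zero] at hy
    exact (norm_mono_step (.of_mem_edgesB he) hr hy.1).trans (ih h hy.2)

theorem dec_pT {s : ℕ} {r : Raw} (p : ℕ) : vec [(pT s r, 1)] (2 * p) = 0 := by
  simp only [vec_cons, vec_nil, add_zero, pT]
  rw [Finsupp.single_apply, if_neg (by omega)]

theorem dec_renP (d : Raw) (s : ℕ) (r : Raw) : vec (renP d) (pT s r) = 0 := by
  rw [vec_renP]
  exact renV_odd _ _

/-- Removing a counted balloon: either the given balloon `w` is the one removed, or it stays. -/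
theorem counted_cases {W W0 : Multiset Ann} {x w : Ann} (hW : W = W0 + {x})
    (hw : w ∈ W → w.1 = x.1 → w.2.1 = x.2.1 → x = w) (hm : w ∈ W) :
    (w ∈ W0 ∧ vec [(pT x.1 x.2.1, 1)] (pT w.1 w.2.1) = 0) ∨ x = w := by
  by_cases h : w.1 = x.1 ∧ w.2.1 = x.2.1
  · exact Or.inr (hw hm h.1 h.2)
  · left
    constructor
    · have hm' := hm
      rw [hW, Multiset.mem_add, Multiset.mem_singleton] at hm'
      rcases hm' with h1 | rfl
      · exact h1
      · exact absurd ⟨rfl, rfl⟩ h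
    · rw [vec_cons, vec_nil, add_zero, Finsupp.single_apply, if_neg]
      rw [pT_inj]
      rintro ⟨h1, h2⟩
      exact h ⟨h1.symm, h2.symm⟩

theorem target_even (m : Vec) (W : Multiset Ann) (p : ℕ) : target m W (2 * p) = m p := by
  have h : (W.map cnt).sum (2 * p) = 0 := by
    induction W using Multiset.induction with
    | empty => simp
    | cons x W ih =>
      rw [Multiset.map_cons, Multiset.sum_cons, Finsupp.add_apply, ih, cnt,
        Finsupp.single_apply, if_neg (by simp only [pT]; omega)]
  rw [target, Finsupp.add_apply, renV_even, h, add_zero]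

theorem sim_step {E : List REdge} {t : Bool} {e : REdge} (he : GEdge E t e) {G : ℕ → Prop}
    {a a' c : VConfig} {W : Multiset Ann} (hr : RRel e a a') (hs : Sim G a c W)
    (ht : t = true → ∀ y, ¬ G y → norm a' y = norm a y) (w : Ann) :
    ∃ c' W', Sim G a' c' W' ∧
      ((c' = c ∧ (∀ p, dec e.2.1 (2 * p) = 0) ∧
          (w ∈ W → w ∈ W' ∧ dec e.2.1 (pT w.1 w.2.1) = 0) ∧
          (a.bag = 0 → ∀ q, a.q ≠ st [] q)) ∨
        ∃ e0 ∈ E, RRel e0 c c' ∧ (∀ p, dec e.2.1 (2 * p) ≠ 0 → dec e0.2.1 p ≠ 0) ∧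
          (w ∈ W → (w ∈ W' ∧ dec e.2.1 (pT w.1 w.2.1) = 0) ∨
            RTouch e0.2.1 c c' (realB w))) := by
  obtain ⟨l, H, hq, hbag, habag, hok, hle⟩ := hs
  obtain ⟨h1, h2, h3⟩ := hr
  cases he with
  | @upd _ q q' d i he =>
    rw [h1, st_inj] at hq
    obtain ⟨rfl, hq⟩ := hq
    obtain ⟨h3, h4⟩ := h3
    have hn : norm a = a.m := by simp [norm, h1]
    have hn' : norm a' = a'.m := by simp [norm, h2]
    rw [vec_renP, vec_renP] at h3
    have hd : vec d ≤ c.m + vec i := by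
      intro p
      have e1 := (hle (2 * p)).1
      have e2 := DFunLike.congr_fun h3 (2 * p)
      simp only [Finsupp.add_apply, renV_even, target_even, hn] at e1 e2 ⊢
      omega
    have hm : c.m + vec i - vec d + vec d = c.m + vec i := tsub_add_cancel_of_le hd
    refine ⟨⟨q', c.m + vec i - vec d, c.bag⟩, W, ⟨[], H, h2, hbag, by rw [h4, habag], hok, ?_⟩,
      Or.inr ⟨_, he, ⟨hq.symm, rfl, hm, rfl⟩, ?_, ?_⟩⟩
    · intro y
      have e1 := hle y
      have e2 := DFunLike.congr_fun h3 y
      have e3 : renV (c.m + vec i - vec d) + renV (vec d) = renV c.m + renV (vec i) := by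
        rw [← renV_add, hm, renV_add]
      have e4 := DFunLike.congr_fun e3 y
      simp only [Finsupp.add_apply, target, hn, hn'] at e1 e2 e4 ⊢
      refine ⟨by omega, e1.2.imp (fun h => by omega) id⟩
    · intro p hp
      simpa only [dec, vec_renP, renV_even] using hp
    · intro hw
      exact Or.inl ⟨hw, dec_renP _ _ _⟩
  | @infl _ q q' s b vs r I he hb =>
    rw [h1, st_inj] at hq
    obtain ⟨rfl, hq⟩ := hq
    obtain ⟨h3, y, hy, h4⟩ := h3
    have hn : norm a = a.m := by simp [norm, h1]
    have hn' : norm a' = a.m := by simp [norm, h2, h3]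
    obtain ⟨z, hz, hyz⟩ := births_sound hb hy
    refine ⟨⟨q', c.m, c.bag + {(s, vec r + y)}⟩, W,
      ⟨[], H + {(s, r, vec r + y)}, h2, ?_, ?_, ?_, ?_⟩,
      Or.inr ⟨_, he, ⟨hq.symm, rfl, rfl, z, hz, by rw [hyz]⟩, ?_, ?_⟩⟩
    · simp only [hbag, Multiset.map_add, Multiset.map_singleton, realB]
      abel
    · rw [h4, habag]
      simp [machB]
    · intro x hx
      have : x ∈ (H + W) ∨ x = (s, r, vec r + y) := by
        simp only [Multiset.mem_add, Multiset.mem_singleton] at hx ⊢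
        tauto
      rcases this with hx | rfl
      · exact hok x hx
      · refine ⟨le_self_add, fun p hp => ?_⟩
        have := births_supp hb hy hp
        simp [hp, this]
    · rw [hn'] ; rw [hn] at hle; exact hle
    · intro p hp
      exact absurd rfl hp
    · intro hw
      exact Or.inl ⟨hw, rfl⟩
  | @defl _ q q' s s' pl p r he hrr =>
    rw [h1, st_inj] at hq
    obtain ⟨rfl, hq⟩ := hq
    obtain ⟨k, n0, h4, h3, h5⟩ := h3
    have hn : norm a = a.m := by simp [norm, h1]
    have hn' : norm a' = a.m + Finsupp.single (2 * p) (k pl) := by simp [norm, h2, h3]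
    rw [habag] at h4
    obtain ⟨H0, x, rfl, hx, rfl⟩ := exists_of_map_eq_add h4
    obtain ⟨s1, r1, k1⟩ := x
    simp only [machB, Prod.mk.injEq, bs_inj] at hx
    obtain ⟨⟨rfl, rfl⟩, rfl⟩ := hx
    refine ⟨⟨q', c.m + Finsupp.single p (k1 pl), (H0 + W).map realB + {(s', Finsupp.erase pl k1)}⟩,
      W, ⟨[], H0 + {(s', er pl r1, Finsupp.erase pl k1)}, h2, ?_, ?_, ?_, ?_⟩,
      Or.inr ⟨_, he, ⟨hq.symm, rfl, k1, (H0 + W).map realB, ?_, rfl, rfl⟩, ?_, ?_⟩⟩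
    · simp only [Multiset.map_add, Multiset.map_singleton, realB]
      abel
    · rw [h5]
      simp [machB]
    · intro x hx
      have : x ∈ (H0 + {(s1, r1, k1)} + W) ∨ x = (s', er pl r1, Finsupp.erase pl k1) := by
        simp only [Multiset.mem_add, Multiset.mem_singleton] at hx ⊢
        tauto
      rcases this with hx | rfl
      · exact hok x hx
      · obtain ⟨o1, o2⟩ := hok (s1, r1, k1) (by simp)
        constructor
        · intro z
          simp only [vec_er, Finsupp.erase_apply]
          split_ifs
          · exact le_rfl
          · exact o1 z
        · intro z hz
          simp only [vec_er, Finsupp.erase_apply] at hz ⊢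
          split_ifs at hz ⊢ with hzp
          · rfl
          · exact o2 z hz
    · intro y
      have e1 := hle y
      rw [hn'] 
      rw [hn] at e1
      simp only [target, renV_add, renV_single, Finsupp.add_apply] at e1 ⊢
      refine ⟨by omega, e1.2.imp (fun h => by omega) id⟩
    · rw [hbag]
      simp only [Multiset.map_add, Multiset.map_singleton, realB]
      abel
    · intro p hp
      exact absurd rfl hp
    · intro hw
      exact Or.inl ⟨hw, rfl⟩
  | @brst _ q q' s r he hrr =>
    rw [h1, st_inj] at hq
    obtain ⟨rfl, hq⟩ := hq
    obtain ⟨h3, h4⟩ := h3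
    have hn : norm a = a.m := by simp [norm, h1]
    have hn' : norm a' = a'.m := by simp [norm, h2]
    have hne : target c.m W (pT s r) ≠ 0 := by
      have e1 := (hle (pT s r)).1
      have e2 := DFunLike.congr_fun h3 (pT s r)
      simp only [Finsupp.add_apply, vec_cons, vec_nil, add_zero, Finsupp.single_eq_same] at e2
      rw [hn] at e1
      omega
    obtain ⟨W0, x, hW, rfl, rfl, hxw⟩ := exists_counted hne w
    refine ⟨⟨q', c.m, (H + W0).map realB⟩, W0, ⟨[], H, h2, rfl, by rw [h4, habag], ?_, ?_⟩,
      Or.inr ⟨_, he, ⟨hq.symm, rfl, rfl, x.2.2, (H + W0).map realB, ?_, rfl⟩, ?_, ?_⟩⟩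
    · intro z hz
      apply hok
      rw [hW, Multiset.mem_add, Multiset.mem_add]
      rw [Multiset.mem_add] at hz
      tauto
    · intro y
      have e1 := hle y
      have e2 := DFunLike.congr_fun h3 y
      rw [hW, target_add, Finsupp.add_apply] at e1
      simp only [Finsupp.add_apply, vec_cons, vec_nil, add_zero, hn, hn', cnt] at e1 e2 ⊢
      refine ⟨by omega, e1.2.imp (fun h => by omega) id⟩
    · rw [hbag, hW]
      simp only [Multiset.map_add, Multiset.map_singleton, realB]
      abel
    · intro p hp
      exact absurd (dec_pT p) hp
    · intro hw
      rcases counted_cases hW hxw hw with h | h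
      · exact Or.inl h
      · subst h
        right
        refine ⟨rfl, rfl, (H + W0).map realB, ?_, rfl⟩
        rw [hbag, hW]
        simp only [Multiset.map_add, Multiset.map_singleton, realB]
        abel
  | @conv _ q op q' s r he hs hrr =>
    rw [h1, st_inj] at hq
    obtain ⟨rfl, hq⟩ := hq
    obtain ⟨h3, k, n0, h4, h5⟩ := h3
    have hn : norm a = a.m := by simp [norm, h1]
    have hn' : norm a' = a.m + Finsupp.single (pT s r) 1 := by simp [norm, h2, h3]
    have hab := habag
    rw [habag] at h4
    obtain ⟨H0, x, rfl, hx, rfl⟩ := exists_of_map_eq_add h4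
    obtain ⟨s1, r1, k1⟩ := x
    simp only [machB, Prod.mk.injEq, bs_inj] at hx
    obtain ⟨⟨rfl, rfl⟩, rfl⟩ := hx
    have hassoc : H0 + (W + {(s1, r1, k1)}) = H0 + {(s1, r1, k1)} + W := by abel
    refine ⟨c, W + {(s1, r1, k1)}, ⟨_, H0, by rw [h2, ← hq], ?_, h5, ?_, ?_⟩,
      Or.inl ⟨rfl, fun _ => rfl, fun hw => ⟨by simp [hw], rfl⟩, ?_⟩⟩
    · rw [hassoc, hbag]
    · rw [hassoc]
      exact hok
    · intro y
      have e1 := hle y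
      rw [hn', target_add]
      rw [hn] at e1
      simp only [Finsupp.add_apply, cnt] at e1 ⊢
      refine ⟨by omega, e1.2.imp (fun h => by omega) id⟩
    · intro h0
      have := congrArg Multiset.card (hab.symm.trans h0)
      simp at this
  | @conv' _ q op q' s r he hs hrr =>
    rw [h1, st_inj] at hq
    obtain ⟨rfl, hq⟩ := hq
    obtain ⟨h3, h4⟩ := h3
    have hnn : norm a' = norm a := by
      simpa only [norm, h1, h2, pendOf_st, vec_nil, add_zero] using h3
    refine ⟨c, W, ⟨[], H, by rw [h2, ← hq], hbag, by rw [h4, habag], hok, by rwa [hnn]⟩,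
      Or.inl ⟨rfl, fun _ => rfl, fun hw => ⟨hw, rfl⟩, ?_⟩⟩
    rintro - q1 h
    rw [h1, st_inj] at h
    simp at h
  | @ctr q q' s s' pl p r he hrr =>
    rw [h1, st_inj] at hq
    obtain ⟨rfl, hq⟩ := hq
    obtain ⟨h3, h4⟩ := h3
    have hn : norm a = a.m := by simp [norm, h1]
    have hn' : norm a' = a'.m + (Finsupp.single (pT s' (er pl r)) 1 +
        Finsupp.single (2 * p) (vec r pl)) := by
      simp only [norm, h2, pendOf_st, vec_pendD]
    have hne : target c.m W (pT s r) ≠ 0 := by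
      have e1 := (hle (pT s r)).1
      have e2 := DFunLike.congr_fun h3 (pT s r)
      simp only [Finsupp.add_apply, vec_cons, vec_nil, add_zero, Finsupp.single_eq_same] at e2
      rw [hn] at e1
      omega
    obtain ⟨W0, x, hW, rfl, rfl, hxw⟩ := exists_counted hne w
    have hxok : OkB x := hok x (by rw [hW]; simp)
    refine ⟨⟨q', c.m + Finsupp.single p (x.2.2 pl),
        (H + W0).map realB + {(s', Finsupp.erase pl x.2.2)}⟩,
      W0 + {(s', er pl x.2.1, Finsupp.erase pl x.2.2)},
      ⟨_, H, h2, ?_, by rw [h4, habag], ?_, ?_⟩,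
      Or.inr ⟨_, he, ⟨hq.symm, rfl, x.2.2, (H + W0).map realB, ?_, rfl, rfl⟩, ?_, ?_⟩⟩
    · simp only [Multiset.map_add, Multiset.map_singleton, realB]
      abel
    · intro z hz
      have : z ∈ H + W ∨ z = (s', er pl x.2.1, Finsupp.erase pl x.2.2) := by
        rw [hW]
        simp only [Multiset.mem_add, Multiset.mem_singleton] at hz ⊢
        tauto
      rcases this with hz | rfl
      · exact hok z hz
      · obtain ⟨o1, o2⟩ := hxok
        constructor
        · intro z
          simp only [vec_er, Finsupp.erase_apply]
          split_ifs
          · exact le_rfl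
          · exact o1 z
        · intro z hz
          simp only [vec_er, Finsupp.erase_apply] at hz ⊢
          split_ifs at hz ⊢ with hzp
          · rfl
          · exact o2 z hz
    · intro y
      have e1 := hle y
      have e2 := DFunLike.congr_fun h3 y
      have e3 := ht rfl y
      have e5 := hxok.1 pl
      have e6 := hxok.2 pl
      rw [hW, target_add, Finsupp.add_apply] at e1
      rw [target_add, Finsupp.add_apply]
      simp only [Finsupp.add_apply, vec_cons, vec_nil, add_zero, hn, hn', cnt,
        target, renV_add, renV_single] at e1 e2 e3 ⊢
      by_cases hy : 2 * p = y
      · subst hy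
        have f1 : ∀ (s : ℕ) (r : Raw), Finsupp.single (pT s r) 1 (2 * p) = 0 := fun s r => by
          rw [Finsupp.single_apply, if_neg (by simp only [pT]; omega)]
        simp only [f1, Finsupp.single_eq_same] at e1 e2 e3 ⊢
        refine ⟨by omega, ?_⟩
        by_cases hG : G (2 * p)
        · exact Or.inr hG
        · left
          have := e3 hG
          have := e1.2.resolve_right hG
          have : x.2.2 pl = 0 := e6 (by omega)
          omega
      · have f2 : ∀ n : ℕ, Finsupp.single (2 * p) n y = 0 := fun n => by
          rw [Finsupp.single_apply, if_neg hy]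
        simp only [f2] at e1 e2 e3 ⊢
        refine ⟨by omega, e1.2.imp (fun h => by omega) id⟩
    · rw [hbag, hW]
      simp only [Multiset.map_add, Multiset.map_singleton, realB]
      abel
    · intro p hp
      exact absurd (dec_pT p) hp
    · intro hw
      rcases counted_cases hW hxw hw with h | h
      · exact Or.inl ⟨by simp [h.1], h.2⟩
      · subst h
        right
        refine ⟨rfl, (H + W0).map realB, ?_, rfl, rfl⟩
        rw [hbag, hW]
        simp only [Multiset.map_add, Multiset.map_singleton, realB]
        abel
  | @ctr' q q' s s' pl p r he hrr =>
    rw [h1, st_inj] at hq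
    obtain ⟨rfl, hq⟩ := hq
    obtain ⟨h3, h4⟩ := h3
    have hnn : norm a' = norm a := by
      simpa only [norm, h1, h2, pendOf_st, vec_nil, add_zero] using h3
    refine ⟨c, W, ⟨[], H, by rw [h2, ← hq], hbag, by rw [h4, habag], hok, by rwa [hnn]⟩,
      Or.inl ⟨rfl, fun _ => rfl, fun hw => ⟨hw, rfl⟩, ?_⟩⟩
    rintro - q1 h
    rw [h1, st_inj] at h
    simp [pendD] at h

theorem sim_reach {E : List REdge} {a a' : VConfig} (h : RReach (edgesA E) a a') {c : VConfig}
    {W : Multiset Ann} (hs : Sim (fun _ => False) a c W) :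
    ∃ c' W', Sim (fun _ => False) a' c' W' ∧ RReach E c c' := by
  induction h with
  | refl => exact ⟨c, W, hs, .refl⟩
  | tail _ h ih =>
    obtain ⟨c1, W1, hs1, hr1⟩ := ih
    obtain ⟨e, he, hr⟩ := h
    obtain ⟨c2, W2, hs2, h | ⟨e0, he0, hr0, -⟩⟩ := sim_step (GEdge.of_mem_edgesA (t := false) he) hr
      hs1 (by simp) (0, [], 0)
    · exact ⟨c2, W2, hs2, by rw [h.1]; exact hr1⟩
    · exact ⟨c2, W2, hs2, hr1.tail ⟨e0, he0, hr0⟩⟩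

theorem sim_path {E : List REdge} {G : ℕ → Prop} {es : List REdge} {a a' c : VConfig}
    {W : Multiset Ann} (h : RPath (edgesB E) a es a') (hs : Sim G a c W)
    (hG : ∀ y, ¬ G y → norm a' y = 0 ∧ dsum es y = 0) (w : Ann) :
    ∃ c' W' L rho es0, Sim G a' c' W' ∧ Seg E c c' L rho es0 ∧
      (∀ p, dsum es (2 * p) ≠ 0 → ∃ i < L, dec (es0 i).2.1 p ≠ 0) ∧
      (w ∈ W → (w ∈ W' ∧ dsum es (pT w.1 w.2.1) = 0) ∨
        ∃ i < L, RTouch (es0 i).2.1 (rho i) (rho (i + 1)) (realB w)) ∧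
      (es ≠ [] → a.bag = 0 → (∃ q, a.q = st [] q) → 0 < L) := by
  induction es generalizing a c W with
  | nil =>
    cases h
    exact ⟨c, W, 0, _, fun _ => (0, ROp.upd [] [], 0), hs, Seg.refl _ _ _, by simp, by simp,
      by simp⟩
  | cons e es ih =>
    obtain ⟨a1, he, hr, h⟩ := h
    have hG1 : ∀ y, ¬ G y → norm a' y = 0 ∧ dsum es y = 0 := by
      intro y hy
      have := hG y hy
      simp only [dsum_cons, Finsupp.add_apply, add_eq_zero] at this
      exact ⟨this.1, this.2.2⟩
    have ht : ∀ y, ¬ G y → norm a1 y = norm a y := by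
      intro y hy
      have e1 := hG1 y hy
      have e2 := hG y hy
      have e3 := norm_mono_path h e1.2
      have e4 := norm_mono_path (es := e :: es) ⟨a1, he, hr, h⟩ e2.2
      omega
    obtain ⟨c1, W1, hs1, hcase⟩ := sim_step (GEdge.of_mem_edgesB he) hr hs (fun _ => ht) w
    obtain ⟨c2, W2, L, rho, es0, hs2, hseg, hd, hw, -⟩ := ih h hs1 hG1
    rcases hcase with ⟨rfl, hd1, hw1, hz⟩ | ⟨e0, he0, hr0, hd1, hw1⟩
    · refine ⟨c2, W2, L, rho, es0, hs2, hseg, ?_, ?_, ?_⟩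
      · intro p hp
        apply hd
        simpa [hd1 p] using hp
      · intro hm
        obtain ⟨hm1, hz1⟩ := hw1 hm
        simpa [hz1] using hw hm1
      · rintro - hb ⟨q, hq⟩
        exact absurd hq (hz hb q)
    · refine ⟨c2, W2, L + 1, _, _, hs2, hseg.cons he0 hr0, ?_, ?_, by simp⟩
      · intro p hp
        by_cases h0 : dec e.2.1 (2 * p) = 0
        · obtain ⟨i, hi, h1⟩ := hd p (by simpa [h0] using hp)
          exact ⟨i + 1, by omega, h1⟩
        · exact ⟨0, by omega, hd1 p h0⟩
      · intro hm
        rcases hw1 hm with ⟨hm1, hz1⟩ | ht1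
        · rcases hw hm1 with h2 | ⟨i, hi, h2⟩
          · left
            simpa [hz1] using h2
          · exact Or.inr ⟨i + 1, by omega, h2⟩
        · right
          refine ⟨0, by omega, ?_⟩
          simpa [hseg.1] using ht1

theorem cnt_le_target {m : Vec} {W : Multiset Ann} {w : Ann} (hw : w ∈ W) :
    target m W (pT w.1 w.2.1) ≠ 0 := by
  obtain ⟨W0, rfl⟩ := Multiset.exists_cons_of_mem hw
  rw [← Multiset.singleton_add, add_comm, target_add]
  simp [cnt]

theorem RProg.of_wit {E : List REdge} {s : VConfig} (hs : s.bag = 0)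
    (h : Wit (edgesA E) (edgesB E) (statesG E) ⟨st [] s.q, renV s.m, 0⟩) : RProg E s := by
  obtain ⟨q, hq, m1, m2, es, hreach, hne, hpath, hcond⟩ := h
  obtain ⟨e, he, rfl⟩ := List.mem_map.1 hq
  have h0 : Sim (fun _ => False) ⟨st [] s.q, renV s.m, 0⟩ s 0 := by
    refine ⟨[], 0, rfl, by simp [hs], by simp, by simp, ?_⟩
    intro y
    simp [norm, target]
  obtain ⟨c, W, hsim, hr⟩ := sim_reach hreach h0
  apply RProg.of_reach hr
  set G : ℕ → Prop := fun y => dsum es y ≠ 0 with hGdef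
  have hz : ∀ y, ¬ G y → m1 y = 0 ∧ m2 y = 0 := by
    intro y hy
    rcases hcond y with h | h
    · exact h
    · exact absurd h.1 hy
  have hnorm : ∀ m : Vec, norm ⟨st [] e.1, m, 0⟩ = m := by simp [norm]
  apply RProg.of_stages (fun c => ∃ W, Sim G ⟨st [] e.1, m1, 0⟩ c W)
  · rintro c ⟨W, hsim⟩ b
    have hsim' := hsim
    obtain ⟨l, H, hq', hbag, hH, hok, hle⟩ := hsim'
    have hH0 : H = 0 := by simpa using hH.symm
    subst hH0
    rw [zero_add] at hbag
    have hG : ∀ y, target c.m W y ≠ 0 → G y := by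
      intro y hy
      rcases (hle y).2 with h | h
      · rw [hnorm] at h
        rcases hcond y with h1 | h1
        · exact absurd (h.symm.trans h1.1) hy
        · exact h1.1
      · exact h
    have hw : ∃ w : Ann, b ∈ c.bag → w ∈ W ∧ realB w = b := by
      by_cases hb : b ∈ c.bag
      · rw [hbag] at hb
        obtain ⟨w, hw⟩ := Multiset.mem_map.1 hb
        exact ⟨w, fun _ => hw⟩
      · exact ⟨(0, [], 0), fun h => absurd h hb⟩
    obtain ⟨w, hw⟩ := hw
    obtain ⟨c', W', L, rho, es0, hs2, hseg, hd, htouch, hL⟩ := sim_path hpath hsim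
      (fun y hy => ⟨by rw [hnorm]; exact (hz y hy).2, not_not.1 hy⟩) w
    refine ⟨c', L, rho, es0, ⟨W', ?_⟩, hL hne rfl ⟨_, rfl⟩, hseg, ?_, ?_⟩
    · obtain ⟨l', H', g1, g2, g3, g4, g5⟩ := hs2
      refine ⟨l', H', g1, g2, g3, g4, fun y => ?_⟩
      have := g5 y
      rw [hnorm] at this ⊢
      by_cases hy : G y
      · rcases hcond y with h1 | h1
        · exact ⟨by omega, Or.inr hy⟩
        · exact ⟨by omega, Or.inr hy⟩
      · have h1 := hz y hy
        have h2 := this.2.resolve_right hy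
        exact ⟨by omega, Or.inl (by omega)⟩
    · intro hb
      obtain ⟨hw1, rfl⟩ := hw hb
      rcases htouch hw1 with h | h
      · exact absurd h.2 (hG _ (cnt_le_target hw1))
      · exact h
    · intro p hp
      exact hd p (hG _ (by rwa [target_even]))
  · obtain ⟨l, H, g1, g2, g3, g4, g5⟩ := hsim
    exact ⟨W, l, H, g1, g2, g3, g4, fun y => ⟨(g5 y).1, Or.inl ((g5 y).2.resolve_right id)⟩⟩

/-! ### Tracking balloons along a run -/

/-- A record of a balloon: creation time of the present version, creation time of the first
version, state and raw content. -/
abbrev Rec : Type := ℕ × ℕ × ℕ × Raw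

/-- The restriction of `v` to the places of `r`. -/
def res (r : Raw) (v : Vec) : Vec := v.filter fun p => vec r p ≠ 0

theorem res_apply (r : Raw) (v : Vec) (p : ℕ) : res r v p = if vec r p ≠ 0 then v p else 0 := by
  rw [res, Finsupp.filter_apply]

/-- The content of a recorded balloon, given the excess `y` of the first versions. -/
def content (y : ℕ → Vec) (x : Rec) : Balloon := (x.2.2.1, vec x.2.2.2 + res x.2.2.2 (y x.2.1))

theorem erase_content (pl : ℕ) (r : Raw) (v : Vec) :
    Finsupp.erase pl (vec r + res r v) = vec (er pl r) + res (er pl r) v := by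
  ext p
  rw [Finsupp.erase_apply, Finsupp.add_apply, Finsupp.add_apply, res_apply, res_apply, vec_er,
    Finsupp.erase_apply]
  split_ifs <;> simp_all

/-- A run of `E` together with records of its balloons. -/
structure Track (E : List REdge) (rho : ℕ → VConfig) (es : ℕ → REdge)
    (lab : ℕ → Raw × List Raw) (y : ℕ → Vec) (A : ℕ → Finset Rec) (pick : ℕ → Rec) : Prop where
  run : ∀ t, es t ∈ E ∧ RRel (es t) (rho t) (rho (t + 1))
  span_lab : ∀ t, y t ∈ span (lab t).2
  lab_mem : ∀ t, lab t = ([], []) ∨ ∃ e ∈ E, ∃ s b vs, e.2.1 = ROp.infl s b vs ∧ lab t ∈ births b vs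
  zero : A 0 = ∅
  upd : ∀ t d i, (es t).2.1 = ROp.upd d i → A (t + 1) = A t
  infl : ∀ t s b vs, (es t).2.1 = ROp.infl s b vs → lab t ∈ births b vs ∧
    A (t + 1) = insert (t, t, s, (lab t).1) (A t)
  defl : ∀ t s s' pl p, (es t).2.1 = ROp.defl s s' pl p → pick t ∈ A t ∧ (pick t).2.2.1 = s ∧
    (rho (t + 1)).m = (rho t).m + Finsupp.single p ((content y (pick t)).2 pl) ∧
    A (t + 1) = insert (t, (pick t).2.1, s', er pl (pick t).2.2.2) ((A t).erase (pick t))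
  brst : ∀ t s, (es t).2.1 = ROp.brst s → pick t ∈ A t ∧ (pick t).2.2.1 = s ∧
    A (t + 1) = (A t).erase (pick t)
  bag : ∀ t, (rho t).bag = (A t).val.map (content y)
  id_lt : ∀ t, ∀ z ∈ A t, z.1 < t
  oldest : ∀ t, ∀ z ∈ A t, RTouch (es t).2.1 (rho t) (rho (t + 1)) (content y z) →
    (pick t).1 ≤ z.1

theorem val_erase_map {A : Finset Rec} {x : Rec} (hx : x ∈ A) (y : ℕ → Vec) :
    A.val.map (content y) = (A.erase x).val.map (content y) + {content y x} := by
  rw [← Finset.insert_erase hx, Finset.insert_val_of_notMem (by simp), Multiset.map_cons,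
    ← Multiset.singleton_add, add_comm, Finset.erase_insert (by simp)]

theorem exists_labels {E : List REdge} {rho : ℕ → VConfig} {es : ℕ → REdge}
    (h : ∀ t, es t ∈ E ∧ RRel (es t) (rho t) (rho (t + 1))) :
    ∃ (lab : ℕ → Raw × List Raw) (y : ℕ → Vec), ∀ t, y t ∈ span (lab t).2 ∧
      (lab t = ([], []) ∨ ∃ e ∈ E, ∃ s b vs, e.2.1 = ROp.infl s b vs ∧ lab t ∈ births b vs) ∧
      ∀ s b vs, (es t).2.1 = ROp.infl s b vs → lab t ∈ births b vs ∧
        (rho (t + 1)).bag = (rho t).bag + {(s, vec (lab t).1 + y t)} := by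
  have key : ∀ t, ∃ (l : Raw × List Raw) (v : Vec), v ∈ span l.2 ∧
      (l = ([], []) ∨ ∃ e ∈ E, ∃ s b vs, e.2.1 = ROp.infl s b vs ∧ l ∈ births b vs) ∧
      ∀ s b vs, (es t).2.1 = ROp.infl s b vs → l ∈ births b vs ∧
        (rho (t + 1)).bag = (rho t).bag + {(s, vec l.1 + v)} := by
    intro t
    obtain ⟨he, -, -, hr⟩ := h t
    by_cases hex : ∃ s b vs, (es t).2.1 = ROp.infl s b vs
    · obtain ⟨s, b, vs, hop⟩ := hex
      rw [hop] at hr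
      obtain ⟨hm, z, hz, hb⟩ := hr
      obtain ⟨x, hx, v, hv, hxv⟩ := births_complete b hz
      refine ⟨x, v, hv, Or.inr ⟨_, he, s, b, vs, hop, hx⟩, ?_⟩
      intro s' b' vs' hop'
      rw [hop] at hop'
      simp only [Sum.inr.injEq, Sum.inl.injEq, Prod.mk.injEq] at hop'
      obtain ⟨rfl, rfl, rfl⟩ := hop'
      exact ⟨hx, by rw [hb, hxv]⟩
    · exact ⟨([], []), 0, zero_mem _, Or.inl rfl, fun s b vs hop => absurd ⟨s, b, vs, hop⟩ hex⟩
  choose lab y hly using key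
  exact ⟨lab, y, hly⟩

theorem exists_dependent_seq {α β : Type*} [Nonempty α] [Nonempty β]
    (P : ℕ → α → Prop) (R : ℕ → α → α → β → Prop) (a : α)
    (h0 : P 0 a) (h : ∀ t x, P t x → ∃ x' b, P (t + 1) x' ∧ R t x x' b) :
    ∃ (f : ℕ → α) (g : ℕ → β), f 0 = a ∧ ∀ t, P t (f t) ∧ R t (f t) (f (t + 1)) (g t) := by
  choose! nx b hnx using h
  let f : ℕ → α := fun t => Nat.rec a (fun t x => nx t x) t
  have hf : ∀ t, P t (f t) := by
    intro t
    induction t with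
    | zero => exact h0
    | succ t ih => exact (hnx t _ ih).1
  exact ⟨f, fun t => b t (f t), rfl, fun t => ⟨hf t, (hnx t _ (hf t)).2⟩⟩

theorem exists_track {E : List REdge} {rho : ℕ → VConfig} {es : ℕ → REdge}
    (h : ∀ t, es t ∈ E ∧ RRel (es t) (rho t) (rho (t + 1))) (h0 : (rho 0).bag = 0) :
    ∃ lab y A pick, Track E rho es lab y A pick := by
  obtain ⟨lab, y, hly⟩ := exists_labels h
  obtain ⟨A, pick, hA0, hA⟩ := exists_dependent_seq (α := Finset Rec) (β := Rec)
    (fun t A => (rho t).bag = A.val.map (content y) ∧ ∀ z ∈ A, z.1 < t)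
    (fun t A A' x =>
      (∀ d i, (es t).2.1 = ROp.upd d i → A' = A) ∧
      (∀ s b vs, (es t).2.1 = ROp.infl s b vs → A' = insert (t, t, s, (lab t).1) A) ∧
      (∀ s s' pl p, (es t).2.1 = ROp.defl s s' pl p → x ∈ A ∧ x.2.2.1 = s ∧
        (rho (t + 1)).m = (rho t).m + Finsupp.single p ((content y x).2 pl) ∧
        A' = insert (t, x.2.1, s', er pl x.2.2.2) (A.erase x)) ∧
      (∀ s, (es t).2.1 = ROp.brst s → x ∈ A ∧ x.2.2.1 = s ∧ A' = A.erase x) ∧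
      ∀ z ∈ A, RTouch (es t).2.1 (rho t) (rho (t + 1)) (content y z) → x.1 ≤ z.1)
    ∅ ⟨by simp [h0], by simp⟩ (by
      rintro t A ⟨hbag, hid⟩
      have hfresh : ∀ x, (t, x) ∉ A := fun x hx => absurd (hid _ hx) (lt_irrefl t)
      have hr := (h t).2.2.2
      have hmin : (∃ z ∈ A, RTouch (es t).2.1 (rho t) (rho (t + 1)) (content y z)) →
          ∃ x ∈ A, RTouch (es t).2.1 (rho t) (rho (t + 1)) (content y x) ∧
            ∀ z ∈ A, RTouch (es t).2.1 (rho t) (rho (t + 1)) (content y z) → x.1 ≤ z.1 := by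
        classical
        rintro ⟨z, hz, hzt⟩
        obtain ⟨x, hx, hmin⟩ := Finset.exists_min_image
          (A.filter fun z => RTouch (es t).2.1 (rho t) (rho (t + 1)) (content y z))
          (fun z => z.1) ⟨z, Finset.mem_filter.2 ⟨hz, hzt⟩⟩
        rw [Finset.mem_filter] at hx
        exact ⟨x, hx.1, hx.2, fun z hz hzt => hmin z (Finset.mem_filter.2 ⟨hz, hzt⟩)⟩
      rcases hop : (es t).2.1 with ⟨d, i⟩ | ⟨s, b, vs⟩ | ⟨s, s', pl, p⟩ | s
      · rw [hop] at hr
        refine ⟨A, (0, 0, 0, []), ⟨by rw [hr.2, hbag], fun z hz => (hid z hz).trans (by omega)⟩, ?_⟩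
        simp [RTouch]
      · have hb := ((hly t).2.2 s b vs hop).2
        have hsupp : res (lab t).1 (y t) = y t := by
          ext p
          rw [res_apply]
          split_ifs with hp
          · rfl
          · exact (births_supp ((hly t).2.2 s b vs hop).1 (hly t).1 (not_not.1 hp)).symm
        refine ⟨insert (t, t, s, (lab t).1) A, (0, 0, 0, []), ⟨?_, ?_⟩, ?_⟩
        · rw [hb, hbag, Finset.insert_val_of_notMem (hfresh _), Multiset.map_cons,
            ← Multiset.singleton_add, add_comm]
          simp [content, hsupp]
        · intro z hz
          rcases Finset.mem_insert.1 hz with rfl | hz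
          · exact Nat.lt_succ_self t
          · exact (hid z hz).trans (by omega)
        · refine ⟨by simp, ?_, by simp, by simp, by simp [RTouch]⟩
          intro s1 b1 vs1 h1
          simp only [Sum.inr.injEq, Sum.inl.injEq, Prod.mk.injEq] at h1
          rw [h1.1]
      · have hex : ∃ z ∈ A, RTouch (es t).2.1 (rho t) (rho (t + 1)) (content y z) := by
          rw [hop] at hr ⊢
          obtain ⟨k, n0, g1, g2, g3⟩ := hr
          rw [hbag] at g1
          have : (s, k) ∈ A.val.map (content y) := by rw [g1]; simp
          obtain ⟨z, hz, hzk⟩ := Multiset.mem_map.1 this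
          rw [← hbag] at g1
          exact ⟨z, hz, by rw [hzk]; exact ⟨rfl, n0, g1, g2, g3⟩⟩
        obtain ⟨x, hx, hxt, hxm⟩ := hmin hex
        rw [hop] at hxt
        obtain ⟨g0, n0, g1, g2, g3⟩ := hxt
        have hn0 : n0 = (A.erase x).val.map (content y) := by
          rw [hbag, val_erase_map hx] at g1
          exact (add_right_cancel g1).symm
        refine ⟨insert (t, x.2.1, s', er pl x.2.2.2) (A.erase x), x, ⟨?_, ?_⟩,
          by simp, by simp, ?_, by simp, by rw [← hop]; exact hxm⟩
        · rw [g3, hn0, Finset.insert_val_of_notMem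
            (fun hh => hfresh _ (Finset.mem_of_mem_erase hh)), Multiset.map_cons,
            ← Multiset.singleton_add, add_comm]
          have he := erase_content pl x.2.2.2 (y x.2.1)
          simp only [content]
          rw [he]
        · intro z hz
          rcases Finset.mem_insert.1 hz with rfl | hz
          · exact Nat.lt_succ_self t
          · exact (hid z (Finset.mem_of_mem_erase hz)).trans (by omega)
        · intro s1 s1' pl1 p1 h1
          simp only [Sum.inr.injEq, Sum.inl.injEq, Prod.mk.injEq] at h1
          obtain ⟨rfl, rfl, rfl, rfl⟩ := h1
          exact ⟨hx, g0, g2, rfl⟩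
      · have hex : ∃ z ∈ A, RTouch (es t).2.1 (rho t) (rho (t + 1)) (content y z) := by
          rw [hop] at hr ⊢
          obtain ⟨g0, k, n0, g1, g2⟩ := hr
          rw [hbag] at g1
          have : (s, k) ∈ A.val.map (content y) := by rw [g1]; simp
          obtain ⟨z, hz, hzk⟩ := Multiset.mem_map.1 this
          rw [← hbag] at g1
          exact ⟨z, hz, by rw [hzk]; exact ⟨rfl, g0, n0, g1, g2⟩⟩
        obtain ⟨x, hx, hxt, hxm⟩ := hmin hex
        rw [hop] at hxt
        obtain ⟨g0, -, n0, g1, g2⟩ := hxt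
        have hn0 : n0 = (A.erase x).val.map (content y) := by
          rw [hbag, val_erase_map hx] at g1
          exact (add_right_cancel g1).symm
        refine ⟨A.erase x, x, ⟨by rw [g2, hn0], ?_⟩, by simp, by simp, by simp, ?_,
          by rw [← hop]; exact hxm⟩
        · intro z hz
          exact (hid z (Finset.mem_of_mem_erase hz)).trans (by omega)
        · intro s1 h1
          simp only [Sum.inr.injEq] at h1
          subst h1
          exact ⟨hx, g0, rfl⟩)
  exact ⟨lab, y, A, pick, ⟨h, fun t => (hly t).1, fun t => (hly t).2.1, hA0,
    fun t => (hA t).2.1, fun t s b vs hop => ⟨((hly t).2.2 s b vs hop).1, (hA t).2.2.1 s b vs hop⟩,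
    fun t => (hA t).2.2.2.1, fun t => (hA t).2.2.2.2.1, fun t => (hA t).1.1, fun t => (hA t).1.2,
    fun t => (hA t).2.2.2.2.2⟩⟩

/-! ### Invariants and fairness -/

/-- The operation is a deflation or a burst. -/
def IsTouch : ROp → Prop
  | .inl _ => False
  | .inr (.inl _) => False
  | .inr (.inr _) => True

theorem RTouch.isTouch {op : ROp} {c c' : VConfig} {b : Balloon} (h : RTouch op c c' b) :
    IsTouch op := by
  rcases op with ⟨d, i⟩ | ⟨s, b, vs⟩ | ⟨s, s', pl, p⟩ | s
  · exact h.elim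
  · exact h.elim
  · trivial
  · trivial

namespace Track

variable {E : List REdge} {rho : ℕ → VConfig} {es : ℕ → REdge} {lab : ℕ → Raw × List Raw}
  {y : ℕ → Vec} {A : ℕ → Finset Rec} {pick : ℕ → Rec}

theorem mem_succ (T : Track E rho es lab y A pick) {t : ℕ} {z : Rec} (hz : z ∈ A (t + 1)) :
    z ∈ A t ∨ z.1 = t := by
  rcases hop : (es t).2.1 with ⟨d, i⟩ | ⟨s, b, vs⟩ | ⟨s, s', pl, p⟩ | s
  · rw [T.upd t d i hop] at hz
    exact Or.inl hz
  · rw [(T.infl t s b vs hop).2, Finset.mem_insert] at hz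
    rcases hz with rfl | hz
    · exact Or.inr rfl
    · exact Or.inl hz
  · rw [(T.defl t s s' pl p hop).2.2.2, Finset.mem_insert] at hz
    rcases hz with rfl | hz
    · exact Or.inr rfl
    · exact Or.inl (Finset.mem_of_mem_erase hz)
  · rw [(T.brst t s hop).2.2] at hz
    exact Or.inl (Finset.mem_of_mem_erase hz)

theorem mem_of_mem (T : Track E rho es lab y A pick) {t : ℕ} {z : Rec} (hz : z ∈ A t) :
    z ∈ A (t + 1) ∨ (IsTouch (es t).2.1 ∧ pick t = z) := by
  rcases hop : (es t).2.1 with ⟨d, i⟩ | ⟨s, b, vs⟩ | ⟨s, s', pl, p⟩ | s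
  · rw [T.upd t d i hop]
    exact Or.inl hz
  · rw [(T.infl t s b vs hop).2, Finset.mem_insert]
    exact Or.inl (Or.inr hz)
  · rw [(T.defl t s s' pl p hop).2.2.2, Finset.mem_insert, Finset.mem_erase]
    by_cases h : z = pick t
    · exact Or.inr ⟨trivial, h.symm⟩
    · exact Or.inl (Or.inr ⟨h, hz⟩)
  · rw [(T.brst t s hop).2.2, Finset.mem_erase]
    by_cases h : z = pick t
    · exact Or.inr ⟨trivial, h.symm⟩
    · exact Or.inl ⟨h, hz⟩

theorem pick_mem (T : Track E rho es lab y A pick) {t : ℕ} (h : IsTouch (es t).2.1) :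
    pick t ∈ A t ∧ pick t ∉ A (t + 1) := by
  rcases hop : (es t).2.1 with ⟨d, i⟩ | ⟨s, b, vs⟩ | ⟨s, s', pl, p⟩ | s
  · rw [hop] at h
    exact h.elim
  · rw [hop] at h
    exact h.elim
  · have h1 := T.defl t s s' pl p hop
    refine ⟨h1.1, ?_⟩
    rw [h1.2.2.2, Finset.mem_insert]
    rintro (h2 | h2)
    · have h3 := T.id_lt t _ h1.1
      rw [h2] at h3
      exact lt_irrefl _ h3
    · simp at h2
  · have h1 := T.brst t s hop
    refine ⟨h1.1, ?_⟩
    rw [h1.2.2]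
    simp

/-- Every recorded balloon is eventually deflated or burst. -/
theorem fair (T : Track E rho es lab y A pick)
    (hp : ∀ k, ∀ b ∈ (rho k).bag, ∃ j ≥ k, RTouch (es j).2.1 (rho j) (rho (j + 1)) b)
    {t : ℕ} {z : Rec} (hz : z ∈ A t) :
    ∃ j ≥ t, z ∈ A j ∧ pick j = z ∧ IsTouch (es j).2.1 := by
  by_contra hcon
  push Not at hcon
  have hmem : ∀ j ≥ t, z ∈ A j := by
    intro j hj
    induction j, hj using Nat.le_induction with
    | base => exact hz
    | succ j hj ih =>
      rcases T.mem_of_mem ih with h | ⟨h1, h2⟩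
      · exact h
      · exact absurd h1 (hcon j hj ih h2)
  have hsub : ∀ j ≥ t, (A (j + 1)).filter (fun x => x.1 ≤ z.1) ⊆
      (A j).filter (fun x => x.1 ≤ z.1) := by
    intro j hj x hx
    rw [Finset.mem_filter] at hx ⊢
    refine ⟨?_, hx.2⟩
    rcases T.mem_succ hx.1 with h | h
    · exact h
    · have := T.id_lt j z (hmem j hj)
      omega
  have hanti : ∀ i ≥ t, ∀ j ≥ i, ((A j).filter (fun x => x.1 ≤ z.1)).card ≤
      ((A i).filter (fun x => x.1 ≤ z.1)).card := by
    intro i hi j hj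
    induction j, hj using Nat.le_induction with
    | base => exact le_rfl
    | succ j hj ih => exact (Finset.card_le_card (hsub j (hi.trans hj))).trans ih
  have main : ∀ n, ∀ i ≥ t, ((A i).filter (fun x => x.1 ≤ z.1)).card ≤ n → False := by
    intro n
    induction n with
    | zero =>
      intro i hi hn
      have h0 : z ∈ (A i).filter (fun x => x.1 ≤ z.1) :=
        Finset.mem_filter.2 ⟨hmem i hi, le_rfl⟩
      have := Finset.card_pos.2 ⟨z, h0⟩
      omega
    | succ n ih =>
      intro i hi hn
      have hb : content y z ∈ (rho i).bag := by
        rw [T.bag i]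
        exact Multiset.mem_map_of_mem _ (hmem i hi)
      obtain ⟨j, hj, hjt⟩ := hp i _ hb
      have hle := T.oldest j z (hmem j (hi.trans hj)) hjt
      obtain ⟨h1, h2⟩ := T.pick_mem hjt.isTouch
      refine ih (j + 1) (by omega) (Nat.lt_succ_iff.1 (lt_of_lt_of_le ?_
        ((hanti i hi j hj).trans hn)))
      refine Finset.card_lt_card ((Finset.ssubset_iff_of_subset (hsub j (hi.trans hj))).2
        ⟨pick j, Finset.mem_filter.2 ⟨h1, hle⟩, fun hh => h2 (Finset.mem_filter.1 hh).1⟩)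
  exact main _ t le_rfl le_rfl

theorem mem_edge (T : Track E rho es lab y A pick) {t : ℕ} {op : ROp} (h : (es t).2.1 = op) :
    ((rho t).q, op, (rho (t + 1)).q) ∈ E := by
  obtain ⟨h1, h2, h3, -⟩ := T.run t
  rw [h2, h3, ← h]
  exact h1

theorem invariant (T : Track E rho es lab y A pick) (t : ℕ) :
    (∀ z ∈ A t, z.2.1 < t ∧ z.2.2.1 ∈ E.flatMap bstOf ∧ z.2.2.2 ∈ rawsOf E) ∧
    ∀ z ∈ A t, ∀ w ∈ A t, z.2.1 = w.2.1 → z = w := by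
  induction t with
  | zero => simp [T.zero]
  | succ t ih =>
    obtain ⟨ih1, ih2⟩ := ih
    have ih1' : ∀ z ∈ A t, z.2.1 < t + 1 ∧ z.2.2.1 ∈ E.flatMap bstOf ∧ z.2.2.2 ∈ rawsOf E :=
      fun z hz => ⟨(ih1 z hz).1.trans (Nat.lt_succ_self t), (ih1 z hz).2⟩
    rcases hop : (es t).2.1 with ⟨d, i⟩ | ⟨s, b, vs⟩ | ⟨s, s', pl, p⟩ | s
    · rw [T.upd t d i hop]
      exact ⟨ih1', ih2⟩
    · obtain ⟨h1, h2⟩ := T.infl t s b vs hop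
      rw [h2]
      refine ⟨?_, ?_⟩
      · intro z hz
        rcases Finset.mem_insert.1 hz with rfl | hz
        · refine ⟨Nat.lt_succ_self t, List.mem_flatMap.2 ⟨_, T.mem_edge hop, ?_⟩,
            births_mem_rawsOf (T.mem_edge hop) h1⟩
          simp [bstOf]
        · exact ih1' z hz
      · intro z hz w hw hzw
        rcases Finset.mem_insert.1 hz with rfl | hz <;> rcases Finset.mem_insert.1 hw with rfl | hw
        · rfl
        · exact absurd (ih1 w hw).1 (by rw [← hzw]; exact lt_irrefl t)
        · exact absurd (ih1 z hz).1 (by rw [hzw]; exact lt_irrefl t)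
        · exact ih2 z hz w hw hzw
    · obtain ⟨h1, -, -, h2⟩ := T.defl t s s' pl p hop
      rw [h2]
      refine ⟨?_, ?_⟩
      · intro z hz
        rcases Finset.mem_insert.1 hz with rfl | hz
        · refine ⟨(ih1' _ h1).1, List.mem_flatMap.2 ⟨_, T.mem_edge hop, by simp [bstOf]⟩,
            er_mem_rawsOf (T.mem_edge hop) (ih1 _ h1).2.2⟩
        · exact ih1' z (Finset.mem_of_mem_erase hz)
      · intro z hz w hw hzw
        rcases Finset.mem_insert.1 hz with rfl | hz <;> rcases Finset.mem_insert.1 hw with rfl | hw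
        · rfl
        · rw [Finset.mem_erase] at hw
          exact absurd (ih2 _ h1 w hw.2 hzw).symm hw.1
        · rw [Finset.mem_erase] at hz
          exact absurd (ih2 z hz.2 _ h1 hzw) hz.1
        · exact ih2 z (Finset.mem_of_mem_erase hz) w (Finset.mem_of_mem_erase hw) hzw
    · obtain ⟨-, -, h2⟩ := T.brst t s hop
      rw [h2]
      exact ⟨fun z hz => ih1' z (Finset.mem_of_mem_erase hz), fun z hz w hw =>
        ih2 z (Finset.mem_of_mem_erase hz) w (Finset.mem_of_mem_erase hw)⟩

end Track

/-! ### Deliveries -/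

/-- At time `t`, the balloon with root `δ` is deflated from its nonempty place `x.1` to `x.2`. -/
def Del (es : ℕ → REdge) (pick : ℕ → Rec) (δ : ℕ) (x : ℕ × ℕ) (t : ℕ) : Prop :=
  ∃ s s', (es t).2.1 = ROp.defl s s' x.1 x.2 ∧ (pick t).2.1 = δ ∧ vec (pick t).2.2.2 x.1 ≠ 0

def dpl (e : REdge) : List (ℕ × ℕ) :=
  match e.2.1 with
  | .inr (.inr (.inl (_, _, pl, p))) => [(pl, p)]
  | _ => []

/-- The places of all deflations of a machine. -/
def allD (E : List REdge) : Finset (ℕ × ℕ) := (E.flatMap dpl).toFinset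

open Classical in
/-- The deliveries of the balloon with root `δ` before time `t`. -/
def pat (E : List REdge) (es : ℕ → REdge) (pick : ℕ → Rec) (t δ : ℕ) : Finset (ℕ × ℕ) :=
  (allD E).filter fun x => ∃ s < t, Del es pick δ x s

open Classical in
/-- All deliveries of the balloon with root `δ`. -/
def patInf (E : List REdge) (es : ℕ → REdge) (pick : ℕ → Rec) (δ : ℕ) : Finset (ℕ × ℕ) :=
  (allD E).filter fun x => ∃ s, Del es pick δ x s

/-- The tokens delivered by a balloon with content `v`. -/
def dl (S : Finset (ℕ × ℕ)) (v : Vec) : Vec := ∑ x ∈ S, Finsupp.single x.2 (v x.1)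

theorem dl_mono {S S' : Finset (ℕ × ℕ)} (h : S ⊆ S') (v : Vec) : dl S v ≤ dl S' v :=
  Finset.sum_le_sum_of_subset h

theorem dl_sum {ι : Type*} (S : Finset (ℕ × ℕ)) (I : Finset ι) (v : ι → Vec) :
    dl S (∑ i ∈ I, v i) = ∑ i ∈ I, dl S (v i) := by
  simp only [dl]
  rw [Finset.sum_comm]
  refine Finset.sum_congr rfl fun x _ => ?_
  rw [Finsupp.finsetSum_apply, Finsupp.single_finsetSum]

namespace Track

variable {E : List REdge} {rho : ℕ → VConfig} {es : ℕ → REdge} {lab : ℕ → Raw × List Raw}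
  {y : ℕ → Vec} {A : ℕ → Finset Rec} {pick : ℕ → Rec}

theorem mem_allD (T : Track E rho es lab y A pick) {δ t : ℕ} {x : ℕ × ℕ}
    (h : Del es pick δ x t) : x ∈ allD E := by
  obtain ⟨s, s', hop, -⟩ := h
  exact List.mem_toFinset.2 (List.mem_flatMap.2 ⟨_, T.mem_edge hop, by simp [dpl]⟩)

theorem mem_pat (T : Track E rho es lab y A pick) {δ t : ℕ} {x : ℕ × ℕ} :
    x ∈ pat E es pick t δ ↔ ∃ s < t, Del es pick δ x s := by
  simp only [pat, Finset.mem_filter]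
  exact ⟨fun h => h.2, fun h => ⟨T.mem_allD h.choose_spec.2, h⟩⟩

theorem mem_patInf (T : Track E rho es lab y A pick) {δ : ℕ} {x : ℕ × ℕ} :
    x ∈ patInf E es pick δ ↔ ∃ s, Del es pick δ x s := by
  simp only [patInf, Finset.mem_filter]
  exact ⟨fun h => h.2, fun h => ⟨T.mem_allD h.choose_spec, h⟩⟩

theorem pat_mono (T : Track E rho es lab y A pick) {δ t t' : ℕ} (h : t ≤ t') :
    pat E es pick t δ ⊆ pat E es pick t' δ := by
  intro x hx
  rw [T.mem_pat] at hx ⊢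
  obtain ⟨s, hs, hd⟩ := hx
  exact ⟨s, by omega, hd⟩

theorem pat_subset_patInf (T : Track E rho es lab y A pick) {δ t : ℕ} :
    pat E es pick t δ ⊆ patInf E es pick δ := by
  intro x hx
  rw [T.mem_pat] at hx
  rw [T.mem_patInf]
  obtain ⟨s, hs, hd⟩ := hx
  exact ⟨s, hd⟩

theorem lt_of_del (T : Track E rho es lab y A pick) {δ t : ℕ} {x : ℕ × ℕ}
    (h : Del es pick δ x t) : δ < t := by
  obtain ⟨s, s', hop, rfl, -⟩ := h
  exact ((T.invariant t).1 _ (T.defl t _ _ _ _ hop).1).1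

theorem pat_eq_empty (T : Track E rho es lab y A pick) {δ t : ℕ} (h : t ≤ δ) :
    pat E es pick t δ = ∅ := by
  rw [Finset.eq_empty_iff_forall_notMem]
  intro x hx
  obtain ⟨s, hs, hd⟩ := T.mem_pat.1 hx
  have := T.lt_of_del hd
  omega

theorem pat_eventually (T : Track E rho es lab y A pick) (δ : ℕ) :
    ∃ t0, ∀ t ≥ t0, pat E es pick t δ = patInf E es pick δ := by
  have h : ∀ x, ∃ s, x ∈ patInf E es pick δ → Del es pick δ x s := by
    intro x
    by_cases hx : x ∈ patInf E es pick δ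
    · obtain ⟨s, hs⟩ := T.mem_patInf.1 hx
      exact ⟨s, fun _ => hs⟩
    · exact ⟨0, fun h => absurd h hx⟩
  choose f hf using h
  refine ⟨(patInf E es pick δ).sup f + 1, fun t ht => ?_⟩
  refine T.pat_subset_patInf.antisymm fun x hx => T.mem_pat.2 ⟨f x, ?_, hf x hx⟩
  have := Finset.le_sup (f := f) hx
  omega

/-- After a deflation, the place stays empty in all later versions of the balloon. -/
theorem emptied (T : Track E rho es lab y A pick) {δ t t' : ℕ} {x : ℕ × ℕ}
    (h : Del es pick δ x t) (ht : t < t') :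
    ∀ z ∈ A t', z.2.1 = δ → vec z.2.2.2 x.1 = 0 := by
  induction t', Nat.succ_le_of_lt ht using Nat.le_induction with
  | base =>
    obtain ⟨s, s', hop, rfl, -⟩ := h
    obtain ⟨h1, -, -, h2⟩ := T.defl t _ _ _ _ hop
    intro z hz hzr
    rw [Nat.succ_eq_add_one, h2, Finset.mem_insert] at hz
    rcases hz with rfl | hz
    · rw [vec_er]
      simp
    · rw [Finset.mem_erase] at hz
      exact absurd ((T.invariant t).2 z hz.2 _ h1 hzr) hz.1
  | succ t' ht' ih =>
    have ih := ih (by omega)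
    intro z hz hzr
    rcases hop : (es t').2.1 with ⟨d, i⟩ | ⟨s, b, vs⟩ | ⟨s, s', pl, p⟩ | s
    · rw [T.upd t' d i hop] at hz
      exact ih z hz hzr
    · rw [(T.infl t' s b vs hop).2, Finset.mem_insert] at hz
      rcases hz with rfl | hz
      · have := T.lt_of_del h
        simp only at hzr
        omega
      · exact ih z hz hzr
    · obtain ⟨h1, -, -, h2⟩ := T.defl t' _ _ _ _ hop
      rw [h2, Finset.mem_insert] at hz
      rcases hz with rfl | hz
      · rw [vec_er, Finsupp.erase_apply]
        split_ifs
        · rfl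
        · exact ih _ h1 hzr
      · exact ih z (Finset.mem_of_mem_erase hz) hzr
    · rw [(T.brst t' s hop).2.2] at hz
      exact ih z (Finset.mem_of_mem_erase hz) hzr

theorem del_unique (T : Track E rho es lab y A pick) {δ t t' p p' pl : ℕ}
    (h : Del es pick δ (pl, p) t) (h' : Del es pick δ (pl, p') t') : t = t' := by
  have key : ∀ {t t' p p'}, Del es pick δ (pl, p) t → Del es pick δ (pl, p') t' → ¬ t < t' := by
    intro t t' p p' h h' hlt
    obtain ⟨s, s', hop, hr, hv⟩ := h'
    exact hv (T.emptied h hlt _ (T.defl t' _ _ _ _ hop).1 hr)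
  exact le_antisymm (not_lt.1 (key h' h)) (not_lt.1 (key h h'))

theorem pat_succ (T : Track E rho es lab y A pick) {δ t : ℕ}
    (h : ∀ x, ¬ Del es pick δ x t) : pat E es pick (t + 1) δ = pat E es pick t δ := by
  refine (T.pat_mono (Nat.le_succ t)).antisymm' fun x hx => ?_
  rw [T.mem_pat] at hx ⊢
  obtain ⟨s, hs, hd⟩ := hx
  rcases Nat.lt_succ_iff_lt_or_eq.1 hs with hs | rfl
  · exact ⟨s, hs, hd⟩
  · exact absurd hd (h x)

theorem dl_pat_succ (T : Track E rho es lab y A pick) {t s s' pl p : ℕ}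
    (hop : (es t).2.1 = ROp.defl s s' pl p) (v : Vec) :
    dl (pat E es pick (t + 1) (pick t).2.1) v = dl (pat E es pick t (pick t).2.1) v +
      Finsupp.single p (res (pick t).2.2.2 v pl) := by
  have hdel : ∀ x, Del es pick (pick t).2.1 x t → x = (pl, p) := by
    rintro ⟨pl', p'⟩ ⟨s1, s1', hop1, -⟩
    rw [hop] at hop1
    simp only [Sum.inr.injEq, Sum.inl.injEq, Prod.mk.injEq] at hop1
    rw [hop1.2.2.1, hop1.2.2.2]
  by_cases hv : vec (pick t).2.2.2 pl = 0
  · rw [T.pat_succ, res_apply, if_neg (by simp [hv])]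
    · simp
    · intro x hx
      have hx' := hdel x hx
      obtain ⟨-, -, -, -, h⟩ := hx
      rw [hx'] at h
      exact h hv
  · have hd : Del es pick (pick t).2.1 (pl, p) t := ⟨s, s', hop, rfl, hv⟩
    have hnot : (pl, p) ∉ pat E es pick t (pick t).2.1 := by
      intro h
      obtain ⟨s, hs, h⟩ := T.mem_pat.1 h
      exact hs.ne (T.del_unique h hd)
    have : pat E es pick (t + 1) (pick t).2.1 =
        insert (pl, p) (pat E es pick t (pick t).2.1) := by
      ext x
      rw [Finset.mem_insert, T.mem_pat, T.mem_pat]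
      constructor
      · rintro ⟨s, hs, h⟩
        rcases Nat.lt_succ_iff_lt_or_eq.1 hs with hs | rfl
        · exact Or.inr ⟨s, hs, h⟩
        · exact Or.inl (hdel x h)
      · rintro (rfl | ⟨s, hs, h⟩)
        · exact ⟨t, Nat.lt_succ_self t, hd⟩
        · exact ⟨s, by omega, h⟩
    rw [this, dl, Finset.sum_insert hnot, res_apply, if_pos hv, add_comm]
    rfl

end Track

/-! ### Simulating a tracked run with recharged balloons -/

/-- The edges of the first or the second machine with counters. -/
def edgesG (E : List REdge) : Bool → List REdge
  | false => edgesA E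
  | true => edgesB E

theorem GEdge.mem_edgesG {E : List REdge} {tb : Bool} {e : REdge} (h : GEdge E tb e) :
    e ∈ edgesG E tb := by
  cases tb
  · exact h.mem_edgesA
  · exact h.mem_edgesB

/-- All tokens delivered before time `t` by the balloons with root below `B`. -/
def given (E : List REdge) (es : ℕ → REdge) (pick : ℕ → Rec) (B : ℕ) (Y : ℕ → Vec) (t : ℕ) :
    Vec :=
  ∑ δ ∈ Finset.range B, dl (pat E es pick t δ) (Y δ)

/-- The contribution of a record to the marking, when roots below `A0` are counted. -/
def cz (A0 : ℕ) (z : Rec) : Vec :=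
  if z.2.1 < A0 then Finsupp.single (pT z.2.2.1 z.2.2.2) 1 else 0

/-- The contribution of a record to the balloons, when roots below `A0` are counted. -/
def bz (Y : ℕ → Vec) (A0 : ℕ) (z : Rec) : Multiset Balloon :=
  if z.2.1 < A0 then 0 else
    {(bs z.2.2.1 z.2.2.2, vec z.2.2.2 + res z.2.2.2 (Y z.2.1))}

/-- The configuration with recharged balloons, where roots below `A0` are counted. -/
def conf (q : ℕ) (m : Vec) (S : Finset Rec) (Y : ℕ → Vec) (A0 : ℕ) : VConfig :=
  ⟨st [] q, renV m + ∑ z ∈ S, cz A0 z, ∑ z ∈ S, bz Y A0 z⟩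

/-- Admissible recharged contents, with their markings `mk`. -/
structure Recharge (E : List REdge) (rho : ℕ → VConfig) (es : ℕ → REdge)
    (lab : ℕ → Raw × List Raw) (y : ℕ → Vec) (pick : ℕ → Rec) (B : ℕ) (Y : ℕ → Vec)
    (mk : ℕ → Vec) : Prop where
  span_lab : ∀ t, Y t ∈ span (lab t).2
  mk_eq : ∀ t, mk t + given E es pick B y t = (rho t).m + given E es pick B Y t

section

variable {E : List REdge} {rho : ℕ → VConfig} {es : ℕ → REdge} {lab : ℕ → Raw × List Raw}
  {y : ℕ → Vec} {A : ℕ → Finset Rec} {pick : ℕ → Rec} {B : ℕ} {Y : ℕ → Vec} {mk : ℕ → Vec}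

theorem Track.given_succ (T : Track E rho es lab y A pick) {t : ℕ}
    (h : ∀ s s' pl p, (es t).2.1 ≠ ROp.defl s s' pl p) (Y : ℕ → Vec) :
    given E es pick B Y (t + 1) = given E es pick B Y t := by
  refine Finset.sum_congr rfl fun δ _ => ?_
  rw [T.pat_succ]
  rintro x ⟨s, s', hop, -⟩
  exact h _ _ _ _ hop

theorem Track.given_succ_defl (T : Track E rho es lab y A pick) {t s s' pl p : ℕ}
    (hop : (es t).2.1 = ROp.defl s s' pl p) (hB : (pick t).2.1 < B) (Y : ℕ → Vec) :
    given E es pick B Y (t + 1) = given E es pick B Y t +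
      Finsupp.single p (res (pick t).2.2.2 (Y (pick t).2.1) pl) := by
  have hmem := Finset.mem_range.2 hB
  rw [given, given, ← Finset.add_sum_erase _ _ hmem, ← Finset.add_sum_erase _ _ hmem,
    T.dl_pat_succ hop, add_right_comm]
  congr 2
  refine Finset.sum_congr rfl fun δ hδ => ?_
  rw [T.pat_succ]
  rintro x ⟨_, _, _, h, _⟩
  exact (Finset.mem_erase.1 hδ).1 h.symm

theorem Recharge.mk_succ (R : Recharge E rho es lab y pick B Y mk)
    (T : Track E rho es lab y A pick) {t : ℕ}
    (h : ∀ s s' pl p, (es t).2.1 ≠ ROp.defl s s' pl p) :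
    mk (t + 1) + (rho t).m = (rho (t + 1)).m + mk t := by
  have h1 := R.mk_eq t
  have h2 := R.mk_eq (t + 1)
  rw [T.given_succ h, T.given_succ h] at h2
  ext p
  have h1 := DFunLike.congr_fun h1 p
  have h2 := DFunLike.congr_fun h2 p
  simp only [Finsupp.add_apply] at *
  omega

theorem Recharge.mk_succ_defl (R : Recharge E rho es lab y pick B Y mk)
    (T : Track E rho es lab y A pick) {t s s' pl p : ℕ}
    (hop : (es t).2.1 = ROp.defl s s' pl p) (hB : (pick t).2.1 < B) :
    mk (t + 1) = mk t + Finsupp.single p (vec (pick t).2.2.2 pl +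
      res (pick t).2.2.2 (Y (pick t).2.1) pl) := by
  have h1 := R.mk_eq t
  have h2 := R.mk_eq (t + 1)
  rw [T.given_succ_defl hop hB, T.given_succ_defl hop hB, (T.defl t _ _ _ _ hop).2.2.1] at h2
  ext x
  have h1 := DFunLike.congr_fun h1 x
  have h2 := DFunLike.congr_fun h2 x
  simp only [content, Finsupp.add_apply, Finsupp.single_add] at *
  omega

theorem Recharge.machine_step (R : Recharge E rho es lab y pick B Y mk)
    (T : Track E rho es lab y A pick) {A0 t : ℕ} {tb : Bool} (hA : A0 ≤ t) (hB : t < B)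
    (htb : A0 = 0 ∨ tb = true)
    (hdel : ∀ δ < A0, ∀ x, Del es pick δ x t → Y δ = 0) :
    ∃ l : List REdge, l ≠ [] ∧ RPath (edgesG E tb) (conf (rho t).q (mk t) (A t) Y A0) l
        (conf (rho (t + 1)).q (mk (t + 1)) (A (t + 1)) Y A0) ∧
      (∀ p, dec (es t).2.1 p ≠ 0 → dsum l (2 * p) ≠ 0) ∧
      (IsTouch (es t).2.1 → (pick t).2.1 < A0 →
        dsum l (pT (pick t).2.2.1 (pick t).2.2.2) ≠ 0) := by
  have hr := (T.run t).2.2.2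
  have hfresh : ∀ (S : Finset Rec), S ⊆ A t → ∀ x, (t, x) ∉ S :=
    fun S hS x hx => lt_irrefl t (T.id_lt t _ (hS hx))
  rcases hop : (es t).2.1 with ⟨d, i⟩ | ⟨s, b, vs⟩ | ⟨s, s', pl, p⟩ | s
  · rw [hop] at hr
    have hm := R.mk_succ T (t := t) (by simp [hop])
    refine ⟨_, by simp, RPath.single (GEdge.upd (T.mem_edge hop)).mem_edgesG
      ⟨rfl, rfl, ?_, ?_⟩, ?_, fun h => h.elim⟩
    · have h1 : mk (t + 1) + vec d = mk t + vec i := by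
        have h2 := hr.1
        ext p
        have hm := DFunLike.congr_fun hm p
        have h2 := DFunLike.congr_fun h2 p
        simp only [Finsupp.add_apply] at *
        omega
      simp only [conf, vec_renP, T.upd t d i hop]
      rw [add_right_comm, ← renV_add, h1, renV_add, add_right_comm]
    · simp only [conf, T.upd t d i hop]
    · intro p hp
      simpa [dec, vec_renP, renV_even] using hp
  · rw [hop] at hr
    have hm := R.mk_succ T (t := t) (by simp [hop])
    rw [hr.1, add_comm _ (mk t)] at hm
    have hm := add_right_cancel hm
    obtain ⟨hlab, hA'⟩ := T.infl t s b vs hop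
    have hsupp : res (lab t).1 (Y t) = Y t := by
      ext p
      rw [res_apply]
      split_ifs with hp
      · rfl
      · exact (births_supp hlab (R.span_lab t) (not_not.1 hp)).symm
    refine ⟨_, by simp, RPath.single (GEdge.infl (T.mem_edge hop) hlab).mem_edgesG
      ⟨rfl, rfl, ?_, Y t, R.span_lab t, ?_⟩, fun p hp => absurd rfl hp, fun h => h.elim⟩
    · simp only [conf]
      rw [hA', hm, Finset.sum_insert (hfresh _ subset_rfl _), cz, if_neg (not_lt.2 hA), zero_add]
    · simp only [conf]
      rw [hA', Finset.sum_insert (hfresh _ subset_rfl _), bz, if_neg (not_lt.2 hA), add_comm]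
      simp only [hsupp]
  · obtain ⟨h1, h2, -, h3⟩ := T.defl t s s' pl p hop
    obtain ⟨⟨hrt, hσ, hraw⟩, -⟩ := And.intro ((T.invariant t).1 _ h1) trivial
    have hm := R.mk_succ_defl T hop (hrt.trans hB)
    have hfr : ∀ x, (t, x) ∉ (A t).erase (pick t) := hfresh _ (Finset.erase_subset _ _)
    by_cases hc : (pick t).2.1 < A0
    · have htb : tb = true := htb.resolve_left (by omega)
      subst htb
      have hzero : res (pick t).2.2.2 (Y (pick t).2.1) pl = 0 := by
        rw [res_apply]
        split_ifs with hv
        · rw [hdel _ hc (pl, p) ⟨s, s', hop, rfl, hv⟩]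
          rfl
        · rfl
      rw [hzero, add_zero] at hm
      have e1 := (GEdge.ctr (T.mem_edge hop) hraw).mem_edgesG
      have e2 := (GEdge.ctr' (T.mem_edge hop) hraw).mem_edgesG
      refine ⟨[_, _], by simp, ⟨⟨st (pendD s' pl p (pick t).2.2.2) (rho (t + 1)).q,
        renV (mk t) + ∑ z ∈ (A t).erase (pick t), cz A0 z, ∑ z ∈ A t, bz Y A0 z⟩, e1,
        ⟨rfl, rfl, ?_, rfl⟩, ⟨_, e2, ⟨rfl, rfl, ?_, ?_⟩, rfl⟩⟩, fun p hp => absurd rfl hp, ?_⟩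
      · simp only [conf]
        rw [← Finset.add_sum_erase _ _ h1, cz, if_pos hc, h2]
        simp only [vec_cons, vec_nil, add_zero]
        abel
      · simp only [conf]
        rw [h3, Finset.sum_insert (hfr _), hm, cz, if_pos hc, vec_pendD, renV_add, renV_single]
        simp only [vec_nil, add_zero]
        abel
      · simp only [conf]
        rw [h3, Finset.sum_insert (hfr _), ← Finset.add_sum_erase _ _ h1, bz, bz, if_pos hc,
          if_pos hc]
      · intro _ _
        rw [h2]
        simp [dec]
    · refine ⟨_, by simp, RPath.single (GEdge.defl (T.mem_edge hop) hraw).mem_edgesG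
        ⟨rfl, rfl, vec (pick t).2.2.2 + res (pick t).2.2.2 (Y (pick t).2.1),
          ∑ z ∈ (A t).erase (pick t), bz Y A0 z, ?_, ?_, ?_⟩, fun p hp => absurd rfl hp,
          fun _ h => absurd h hc⟩
      · simp only [conf]
        rw [← Finset.add_sum_erase _ _ h1, bz, if_neg hc, h2, add_comm]
      · simp only [conf]
        rw [h3, Finset.sum_insert (hfr _), ← Finset.add_sum_erase _ _ h1, hm, cz, cz, if_neg hc,
          if_neg hc, renV_add, renV_single, Finsupp.add_apply]
        abel
      · simp only [conf]
        rw [h3, Finset.sum_insert (hfr _), bz, if_neg hc, erase_content, add_comm]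
  · rw [hop] at hr
    obtain ⟨h1, h2, h3⟩ := T.brst t s hop
    obtain ⟨⟨hrt, hσ, hraw⟩, -⟩ := And.intro ((T.invariant t).1 _ h1) trivial
    have hm := R.mk_succ T (t := t) (by simp [hop])
    rw [hr.1, add_comm _ (mk t)] at hm
    have hm := add_right_cancel hm
    have e1 := (GEdge.brst (t := tb) (T.mem_edge hop) hraw).mem_edgesG
    by_cases hc : (pick t).2.1 < A0
    · refine ⟨_, by simp, RPath.single e1 ⟨rfl, rfl, ?_, ?_⟩, fun p hp => absurd rfl hp, ?_⟩
      · simp only [conf]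
        rw [h3, ← Finset.add_sum_erase _ _ h1, hm, cz, if_pos hc, h2]
        simp only [vec_cons, vec_nil, add_zero]
        abel
      · simp only [conf]
        rw [h3, ← Finset.add_sum_erase _ _ h1, bz, if_pos hc, zero_add]
      · intro _ _
        rw [h2]
        simp [dec]
    · have e2 := (GEdge.conv (t := tb) (T.mem_edge hop) hσ hraw).mem_edgesG
      have e3 := (GEdge.conv' (t := tb) (T.mem_edge hop) hσ hraw).mem_edgesG
      rw [h2] at e2 e3
      refine ⟨[_, _, _], by simp, ⟨⟨st [(pT s (pick t).2.2.2, 1)] (rho t).q,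
        renV (mk t) + ∑ z ∈ A t, cz A0 z, ∑ z ∈ (A t).erase (pick t), bz Y A0 z⟩, e2,
        ⟨rfl, rfl, rfl, vec (pick t).2.2.2 + res (pick t).2.2.2 (Y (pick t).2.1), _, ?_, rfl⟩,
        ⟨⟨st [] (rho t).q, renV (mk t) + ∑ z ∈ A t, cz A0 z +
          vec [(pT s (pick t).2.2.2, 1)], ∑ z ∈ (A t).erase (pick t), bz Y A0 z⟩, e3,
        ⟨rfl, rfl, by simp, rfl⟩, ⟨_, e1, ⟨rfl, rfl, ?_, ?_⟩, rfl⟩⟩⟩,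
        fun p hp => absurd rfl hp, fun _ h => absurd h hc⟩
      · simp only [conf]
        rw [← Finset.add_sum_erase _ _ h1, bz, if_neg hc, h2, add_comm]
      · simp only [conf]
        rw [h3, ← Finset.add_sum_erase _ _ h1, hm, cz, if_neg hc]
        simp
      · simp only [conf]
        rw [h3]

/-- Replace all balloons by counters. -/
theorem convert_all {tb : Bool} {q q' : ℕ} {op : ROp} (he : (q, op, q') ∈ E) (m : Vec)
    (S : Finset Rec) (hS : ∀ z ∈ S, z.2.2.1 ∈ E.flatMap bstOf ∧ z.2.2.2 ∈ rawsOf E)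
    (Y : ℕ → Vec) (A0 : ℕ) {C : ℕ} (hC : ∀ z ∈ S, z.2.1 < C) :
    ∃ l, RPath (edgesG E tb) (conf q m S Y A0) l
      ⟨st [] q, renV m + ∑ z ∈ S, cz C z, 0⟩ := by
  have main : ∀ S' ⊆ S, ∀ m0 : Vec, ∃ l, RPath (edgesG E tb)
      ⟨st [] q, m0 + ∑ z ∈ S', cz A0 z, ∑ z ∈ S', bz Y A0 z⟩ l
      ⟨st [] q, m0 + ∑ z ∈ S', cz C z, 0⟩ := by
    intro S' hS'
    induction S' using Finset.induction_on with
    | empty => exact fun m0 => ⟨[], rfl⟩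
    | insert x S' hx ih =>
      intro m0
      have hxS := hS' (Finset.mem_insert_self x S')
      have ih := ih ((Finset.subset_insert x S').trans hS')
      rw [Finset.sum_insert hx, Finset.sum_insert hx, Finset.sum_insert hx]
      obtain ⟨l, hl⟩ := ih (m0 + cz C x)
      by_cases hc : x.2.1 < A0
      · refine ⟨l, ?_⟩
        have : bz Y A0 x = 0 := if_pos hc
        have h2 : cz A0 x = cz C x := by rw [cz, cz, if_pos hc, if_pos (hC x hxS)]
        rw [this, zero_add, h2, ← add_assoc, ← add_assoc]
        exact hl
      · have e2 := (GEdge.conv (t := tb) he (hS x hxS).1 (hS x hxS).2).mem_edgesG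
        have e3 := (GEdge.conv' (t := tb) he (hS x hxS).1 (hS x hxS).2).mem_edgesG
        have h1 : cz A0 x = 0 := if_neg hc
        have h2 : cz C x = vec [(pT x.2.2.1 x.2.2.2, 1)] := by
          rw [cz, if_pos (hC x hxS)]
          simp
        refine ⟨_ :: _ :: l, ⟨st [(pT x.2.2.1 x.2.2.2, 1)] q, m0 + ∑ z ∈ S', cz A0 z,
          ∑ z ∈ S', bz Y A0 z⟩, e2, ⟨rfl, rfl, by rw [h1, zero_add],
          vec x.2.2.2 + res x.2.2.2 (Y x.2.1), _, ?_, rfl⟩, ⟨st [] q, m0 + cz C x +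
          ∑ z ∈ S', cz A0 z, ∑ z ∈ S', bz Y A0 z⟩, e3, ⟨rfl, rfl, ?_, rfl⟩, ?_⟩
        pick_goal 3
        · rw [← add_assoc]
          exact hl
        · simp only [bz, if_neg hc]
          rw [add_comm]
        · rw [h2]
          simp only [vec_nil, add_zero]
          abel
  exact main S subset_rfl (renV m)

end

/-! ### Completeness of the counter machine -/

theorem exists_dickson (X : ℕ → Vec) (q : ℕ → ℕ) (K : Finset ℕ) (hK : ∀ t x, X t x ≠ 0 → x ∈ K)
    (bd : ℕ) (hq : ∀ t, q t ≤ bd) :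
    ∃ f : ℕ → ℕ, StrictMono f ∧ ∀ i j, i ≤ j → q (f i) = q (f j) ∧ X (f i) ≤ X (f j) ∧
      ∀ x, X (f i) x = 0 → X (f j) x = 0 := by
  obtain ⟨g, hg⟩ := (wellQuasiOrdered_le (α := ℕ × ℕ × (K → ℕ) × (K → ℕ))).exists_monotone_subseq
    fun t => (q t, bd - q t, fun x => X t x, fun x => 1 - X t x)
  refine ⟨g, g.strictMono, fun i j hij => ?_⟩
  obtain ⟨h1, h2, h3, h4⟩ := hg i j hij
  have hi := hq (g i)
  have hj := hq (g j)
  simp only at h1 h2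
  refine ⟨by omega, fun x => ?_, fun x hx => ?_⟩
  · by_cases hx : x ∈ K
    · exact h3 ⟨x, hx⟩
    · have : X (g i) x = 0 := by
        by_contra h
        exact hx (hK _ _ h)
      rw [this]
      exact Nat.zero_le _
  · by_contra h
    have := h4 ⟨x, hK _ _ h⟩
    simp only at this
    omega

section

variable {E : List REdge} {rho : ℕ → VConfig} {es : ℕ → REdge} {lab : ℕ → Raw × List Raw}
  {y : ℕ → Vec} {A : ℕ → Finset Rec} {pick : ℕ → Rec} {B : ℕ} {Y : ℕ → Vec} {mk : ℕ → Vec}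

theorem Recharge.machine_run (R : Recharge E rho es lab y pick B Y mk)
    (T : Track E rho es lab y A pick) {A0 t0 t : ℕ} {tb : Bool} (hA : A0 ≤ t0) (ht : t0 ≤ t)
    (hB : t ≤ B) (htb : A0 = 0 ∨ tb = true)
    (hdel : ∀ j, t0 ≤ j → j < t → ∀ δ < A0, ∀ x, Del es pick δ x j → Y δ = 0) :
    ∃ l : List REdge, (t0 < t → l ≠ []) ∧
      RPath (edgesG E tb) (conf (rho t0).q (mk t0) (A t0) Y A0) l
        (conf (rho t).q (mk t) (A t) Y A0) ∧
      ∀ j, t0 ≤ j → j < t → (∀ p, dec (es j).2.1 p ≠ 0 → dsum l (2 * p) ≠ 0) ∧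
        (IsTouch (es j).2.1 → (pick j).2.1 < A0 →
          dsum l (pT (pick j).2.2.1 (pick j).2.2.2) ≠ 0) := by
  induction t, ht using Nat.le_induction with
  | base => exact ⟨[], fun h => absurd h (lt_irrefl _), rfl, fun j h h' => by omega⟩
  | succ t ht ih =>
    obtain ⟨l, -, hl, hd⟩ := ih (by omega) fun j h h' => hdel j h (by omega)
    obtain ⟨l', hne, hl', h1, h2⟩ := R.machine_step T (A0 := A0) (t := t) (tb := tb) (by omega)
      (by omega) htb (hdel t ht (by omega))
    refine ⟨l ++ l', fun _ => by simp [hne], hl.append hl', fun j hj hj' => ?_⟩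
    simp only [dsum_append, Finsupp.add_apply]
    rcases Nat.lt_succ_iff_lt_or_eq.1 hj' with hj' | rfl
    · obtain ⟨g1, g2⟩ := hd j hj hj'
      exact ⟨fun p hp => fun h => g1 p hp (by omega), fun ha hb h => g2 ha hb (by omega)⟩
    · exact ⟨fun p hp => fun h => h1 p hp (by omega), fun ha hb h => h2 ha hb (by omega)⟩

/-- Every root in `[a, b)` has a similar root whose deliveries are completed before time `b`,
and before the given root delivers anything. -/
def Cut (E : List REdge) (es : ℕ → REdge) (lab : ℕ → Raw × List Raw) (pick : ℕ → Rec)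
    (a b : ℕ) : Prop :=
  ∀ δ, a ≤ δ → δ < b → ∃ β, a ≤ β ∧ β < b ∧ lab β = lab δ ∧
    patInf E es pick β = patInf E es pick δ ∧ pat E es pick b β = patInf E es pick β ∧
    (β = δ ∨ pat E es pick δ β = patInf E es pick β)

def birthsOf (e : REdge) : List (Raw × List Raw) :=
  match e.2.1 with
  | .inr (.inl (_, b, vs)) => births b vs
  | _ => []

theorem Track.exists_cut (T : Track E rho es lab y A pick) (a : ℕ) :
    ∃ N, ∀ b ≥ N, Cut E es lab pick a b := by
  let κ : ℕ → (Raw × List Raw) × Finset (ℕ × ℕ) := fun δ => (lab δ, patInf E es pick δ)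
  choose c hc using fun δ => T.pat_eventually δ
  have hfin : (Set.range κ).Finite := by
    refine Set.Finite.subset (Set.Finite.prod
      (List.finite_toSet (([], []) :: E.flatMap birthsOf))
      (Finset.finite_toSet (allD E).powerset)) ?_
    rintro _ ⟨δ, rfl⟩
    refine ⟨?_, ?_⟩
    · rcases T.lab_mem δ with h | ⟨e, he, s, b, vs, hop, h⟩
      · simp [κ, h]
      · refine List.mem_cons_of_mem _ (List.mem_flatMap.2 ⟨e, he, ?_⟩)
        simpa [birthsOf, hop] using h
    · simp only [κ, Finset.mem_coe, Finset.mem_powerset]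
      exact fun x hx => T.mem_allD (T.mem_patInf.1 hx).choose_spec
  have hv : ∀ v, ∃ M, ∀ δ, a ≤ δ → κ δ = v → ∃ β, a ≤ β ∧ κ β = v ∧ β < M ∧ c β ≤ M := by
    intro v
    by_cases h : ∃ δ, a ≤ δ ∧ κ δ = v
    · obtain ⟨β, h1, h2⟩ := h
      exact ⟨max (β + 1) (c β), fun _ _ _ => ⟨β, h1, h2, by simp, le_max_right _ _⟩⟩
    · exact ⟨0, fun δ h1 h2 => absurd ⟨δ, h1, h2⟩ h⟩
  choose M hM using hv
  set M0 := hfin.toFinset.sup M with hM0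
  refine ⟨max M0 ((Finset.range M0).sup c), fun b hb δ hδ hδb => ?_⟩
  have hb1 : M0 ≤ b := (le_max_left _ _).trans hb
  by_cases h : δ < M0
  · have h1 : c δ ≤ b := (Finset.le_sup (f := c) (Finset.mem_range.2 h)).trans
      ((le_max_right _ _).trans hb)
    exact ⟨δ, hδ, hδb, rfl, rfl, hc δ b h1, Or.inl rfl⟩
  · obtain ⟨β, h1, h2, h3, h4⟩ := hM (κ δ) δ hδ rfl
    have h5 : M (κ δ) ≤ M0 :=
      Finset.le_sup (f := M) (hfin.mem_toFinset.2 ⟨δ, rfl⟩)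
    simp only [κ, Prod.mk.injEq] at h2
    exact ⟨β, h1, by omega, h2.1, h2.2, hc β b (by omega), Or.inr (hc β δ (by omega))⟩

/-- The marking after all pending deliveries of old balloons, apart from the raw contents. -/
def mark (E : List REdge) (rho : ℕ → VConfig) (es : ℕ → REdge) (y : ℕ → Vec) (pick : ℕ → Rec)
    (C : ℕ) : Vec :=
  (rho C).m + ∑ δ ∈ Finset.range C, dl (patInf E es pick δ \ pat E es pick C δ) (y δ)

theorem Track.exists_recharge (T : Track E rho es lab y A pick) {a b : ℕ} (hab : a ≤ b)
    (h1 : Cut E es lab pick 0 a) (h2 : Cut E es lab pick a b) :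
    ∃ Y mk, Recharge E rho es lab y pick b Y mk ∧ mk 0 = (rho 0).m ∧
      mk a = mark E rho es y pick a ∧ mk b = mark E rho es y pick b ∧
      ∀ j, a ≤ j → ∀ δ < a, ∀ x, Del es pick δ x j → Y δ = 0 := by
  have hrec : ∀ δ, ∃ β, δ < b → β < b ∧ lab β = lab δ ∧
      patInf E es pick β = patInf E es pick δ ∧
      (β = δ ∨ pat E es pick δ β = patInf E es pick β) ∧
      (δ < a → pat E es pick a β = patInf E es pick β) ∧ (a ≤ δ → a ≤ β) ∧
      pat E es pick b β = patInf E es pick β := by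
    intro δ
    by_cases hδ : δ < a
    · obtain ⟨β, -, g2, g3, g4, g5, g6⟩ := h1 δ (Nat.zero_le _) hδ
      exact ⟨β, fun _ => ⟨by omega, g3, g4, g6, fun _ => g5, by omega,
        T.pat_subset_patInf.antisymm (g5 ▸ T.pat_mono hab)⟩⟩
    · by_cases hδb : δ < b
      · obtain ⟨β, g1, g2, g3, g4, g5, g6⟩ := h2 δ (by omega) hδb
        exact ⟨β, fun _ => ⟨g2, g3, g4, g6, by omega, fun _ => g1, g5⟩⟩
      · exact ⟨0, fun h => absurd h hδb⟩
  choose r hr using hrec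
  let Y : ℕ → Vec := fun β => ∑ δ ∈ (Finset.range b).filter (fun δ => r δ = β), y δ
  have hgiven : ∀ t, given E es pick b Y t =
      ∑ δ ∈ Finset.range b, dl (pat E es pick t (r δ)) (y δ) := by
    intro t
    have hmaps : ∀ δ ∈ Finset.range b, r δ ∈ Finset.range b := by
      intro δ hδ
      rw [Finset.mem_range] at hδ ⊢
      exact (hr δ hδ).1
    rw [given]
    refine Eq.trans ?_ (Finset.sum_fiberwise_of_maps_to hmaps _)
    refine Finset.sum_congr rfl fun β _ => ?_
    rw [dl_sum]
    refine Finset.sum_congr rfl fun δ hδ => ?_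
    rw [(Finset.mem_filter.1 hδ).2]
  have hdom : ∀ t, given E es pick b y t ≤ given E es pick b Y t := by
    intro t
    rw [hgiven, given]
    refine Finset.sum_le_sum fun δ hδ => dl_mono ?_ _
    obtain ⟨-, -, g3, g4, -⟩ := hr δ (Finset.mem_range.1 hδ)
    by_cases ht : t ≤ δ
    · rw [T.pat_eq_empty ht]
      exact Finset.empty_subset _
    · rcases g4 with g4 | g4
      · rw [g4]
      · refine T.pat_subset_patInf.trans ?_
        rw [← g3, ← g4]
        exact T.pat_mono (by omega)
  have hmk : ∀ t, (rho t).m + (given E es pick b Y t - given E es pick b y t) +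
      given E es pick b y t = (rho t).m + given E es pick b Y t := by
    intro t
    ext x
    have := hdom t x
    simp only [Finsupp.add_apply, Finsupp.tsub_apply]
    omega
  have hmark : ∀ C ≤ b, (∀ δ < b, (δ < C → pat E es pick C (r δ) = patInf E es pick δ) ∧
      (C ≤ δ → C ≤ r δ)) →
      (rho C).m + (given E es pick b Y C - given E es pick b y C) = mark E rho es y pick C := by
    intro C hC hh
    have hsub : Finset.range C ⊆ Finset.range b := Finset.range_subset_range.2 hC
    have e1 : given E es pick b Y C =
        ∑ δ ∈ Finset.range C, dl (patInf E es pick δ) (y δ) := by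
      rw [hgiven, ← Finset.sum_subset hsub]
      · refine Finset.sum_congr rfl fun δ hδ => ?_
        have := Finset.mem_range.1 hδ
        rw [(hh δ (by omega)).1 this]
      · intro δ hδ hδC
        rw [Finset.mem_range] at hδ hδC
        rw [T.pat_eq_empty ((hh δ hδ).2 (by omega))]
        rfl
    have e2 : given E es pick b y C = ∑ δ ∈ Finset.range C, dl (pat E es pick C δ) (y δ) := by
      rw [given, ← Finset.sum_subset hsub]
      intro δ hδ hδC
      rw [Finset.mem_range] at hδ hδC
      rw [T.pat_eq_empty (by omega)]
      rfl
    have e3 : given E es pick b Y C =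
        ∑ δ ∈ Finset.range C, dl (patInf E es pick δ \ pat E es pick C δ) (y δ) +
        given E es pick b y C := by
      rw [e1, e2, ← Finset.sum_add_distrib]
      refine Finset.sum_congr rfl fun δ _ => ?_
      exact (Finset.sum_sdiff T.pat_subset_patInf).symm
    rw [mark, e3]
    ext x
    simp only [Finsupp.add_apply, Finsupp.tsub_apply]
    omega
  refine ⟨Y, fun t => (rho t).m + (given E es pick b Y t - given E es pick b y t),
    ⟨fun β => ?_, hmk⟩, ?_, hmark a hab ?_, hmark b le_rfl ?_, ?_⟩
  · refine sum_mem fun δ hδ => ?_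
    rw [Finset.mem_filter, Finset.mem_range] at hδ
    rw [← hδ.2, (hr δ hδ.1).2.1]
    exact T.span_lab δ
  · have e : ∀ Z, given E es pick b Z 0 = 0 := by
      intro Z
      refine Finset.sum_eq_zero fun δ _ => ?_
      rw [T.pat_eq_empty (Nat.zero_le _)]
      rfl
    simp [e]
  · intro δ hδ
    obtain ⟨-, -, g3, -, g5, g6, -⟩ := hr δ hδ
    exact ⟨fun h => (g5 h).trans g3, g6⟩
  · intro δ hδ
    obtain ⟨-, -, g3, -, -, -, g7⟩ := hr δ hδ
    exact ⟨fun _ => g7.trans g3, by omega⟩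
  · intro j hj δ hδ x hx
    refine Finset.sum_eq_zero fun δ' hδ' => ?_
    rw [Finset.mem_filter, Finset.mem_range] at hδ'
    obtain ⟨-, -, -, -, g5, g6, -⟩ := hr δ' hδ'.1
    rw [hδ'.2] at g5 g6
    have hlt : δ' < a := by
      by_contra h
      have := g6 (by omega)
      omega
    have hmem : x ∈ pat E es pick a δ := by
      rw [g5 hlt]
      exact T.mem_patInf.2 ⟨j, hx⟩
    obtain ⟨s, hs, hd⟩ := T.mem_pat.1 hmem
    have := T.del_unique (pl := x.1) (p := x.2) (p' := x.2) hd hx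
    omega

theorem Track.mark_ne (T : Track E rho es lab y A pick)
    (hp : ∀ k p, (rho k).m p ≠ 0 → ∃ j ≥ k, dec (es j).2.1 p ≠ 0) {C p : ℕ}
    (h : mark E rho es y pick C p ≠ 0) : ∃ j ≥ C, dec (es j).2.1 p ≠ 0 := by
  rw [mark, Finsupp.add_apply] at h
  by_cases h0 : (rho C).m p = 0
  · rw [h0, zero_add, Finsupp.finsetSum_apply] at h
    obtain ⟨δ, -, h⟩ := Finset.exists_ne_zero_of_sum_ne_zero h
    rw [dl, Finsupp.finsetSum_apply] at h
    obtain ⟨⟨pl, p'⟩, hx, h⟩ := Finset.exists_ne_zero_of_sum_ne_zero h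
    rw [Finset.mem_sdiff, T.mem_patInf, T.mem_pat] at hx
    obtain ⟨⟨s, hs⟩, hn⟩ := hx
    have hsC : C ≤ s := by
      by_contra hcon
      exact hn ⟨s, by omega, hs⟩
    simp only [Finsupp.single_apply] at h
    obtain ⟨rfl, hy⟩ : p' = p ∧ y δ pl ≠ 0 := by
      split_ifs at h with h1
      · exact ⟨h1, h⟩
      · exact absurd rfl h
    obtain ⟨s1, s1', hop, hroot, hv⟩ := hs
    have hm := (T.defl s _ _ _ _ hop).2.2.1
    have : (rho (s + 1)).m p' ≠ 0 := by
      rw [hm]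
      simp only [content, Finsupp.add_apply, Finsupp.single_eq_same]
      have : vec (pick s).2.2.2 pl ≠ 0 := hv
      omega
    obtain ⟨j, hj, hd⟩ := hp _ _ this
    exact ⟨j, by omega, hd⟩
  · exact hp C p h0

/-- The marking of the machine with counters at a cut. -/
def cutMark (E : List REdge) (rho : ℕ → VConfig) (es : ℕ → REdge) (y : ℕ → Vec)
    (A : ℕ → Finset Rec) (pick : ℕ → Rec) (C : ℕ) : Vec :=
  renV (mark E rho es y pick C) + ∑ z ∈ A C, cz C z

theorem Track.cutMark_ne (T : Track E rho es lab y A pick)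
    (hp : ∀ k p, (rho k).m p ≠ 0 → ∃ j ≥ k, dec (es j).2.1 p ≠ 0) {C x : ℕ}
    (h : cutMark E rho es y A pick C x ≠ 0) :
    (∃ p, x = 2 * p ∧ ∃ j ≥ C, dec (es j).2.1 p ≠ 0) ∨
    ∃ z ∈ A C, x = pT z.2.2.1 z.2.2.2 := by
  rw [cutMark, Finsupp.add_apply] at h
  by_cases h0 : renV (mark E rho es y pick C) x = 0
  · rw [h0, zero_add, Finsupp.finsetSum_apply] at h
    obtain ⟨z, hz, h⟩ := Finset.exists_ne_zero_of_sum_ne_zero h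
    rw [cz, if_pos ((T.invariant C).1 z hz).1, Finsupp.single_apply] at h
    refine Or.inr ⟨z, hz, ?_⟩
    by_contra hne
    exact h (if_neg (Ne.symm hne))
  · left
    rcases Nat.even_or_odd' x with ⟨p, rfl | rfl⟩
    · rw [renV_even] at h0
      exact ⟨p, rfl, T.mark_ne hp h0⟩
    · exact absurd (renV_odd _ _) h0

end

theorem Wit.of_rProg {E : List REdge} {s : VConfig} (hs : s.bag = 0) (h : RProg E s) :
    Wit (edgesA E) (edgesB E) (statesG E) ⟨st [] s.q, renV s.m, 0⟩ := by
  classical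
  obtain ⟨rho, es, rfl, hrun, hbal, hpl⟩ := h
  obtain ⟨lab, y, A, pick, T⟩ := exists_track hrun hs
  let K : Finset ℕ := (E.toFinset.biUnion fun e => (dec e.2.1).support.image fun p => 2 * p) ∪
    ((E.flatMap bstOf).toFinset ×ˢ (rawsOf E).toFinset).image fun z => pT z.1 z.2
  have hK : ∀ t x, cutMark E rho es y A pick t x ≠ 0 → x ∈ K := by
    intro t x hx
    rw [Finset.mem_union]
    rcases T.cutMark_ne hpl hx with ⟨p, rfl, j, -, hj⟩ | ⟨z, hz, rfl⟩
    · refine Or.inl (Finset.mem_biUnion.2 ⟨es j, List.mem_toFinset.2 (hrun j).1, ?_⟩)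
      exact Finset.mem_image_of_mem _ (Finsupp.mem_support_iff.2 hj)
    · have := (T.invariant t).1 z hz
      exact Or.inr (Finset.mem_image.2 ⟨(z.2.2.1, z.2.2.2), Finset.mem_product.2
        ⟨List.mem_toFinset.2 this.2.1, List.mem_toFinset.2 this.2.2⟩, rfl⟩)
  obtain ⟨f, hf, hfm⟩ := exists_dickson (cutMark E rho es y A pick) (fun t => (rho t).q) K hK
    ((E.map fun e => e.1).toFinset.sup id) (fun t => by
      rw [(hrun t).2.1]
      exact Finset.le_sup (f := id) (List.mem_toFinset.2 (List.mem_map.2 ⟨_, (hrun t).1, rfl⟩)))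
  obtain ⟨N0, hN0⟩ := T.exists_cut 0
  have hcutA := hN0 (f N0) (hf.id_le N0)
  obtain ⟨a, ha⟩ : ∃ a, a = f N0 := ⟨_, rfl⟩
  rw [← ha] at hcutA
  have hwit : ∀ x, ∃ n, cutMark E rho es y A pick a x ≠ 0 →
      (∃ p j, x = 2 * p ∧ a ≤ j ∧ j < n ∧ dec (es j).2.1 p ≠ 0) ∨
      (∃ j, a ≤ j ∧ j < n ∧ IsTouch (es j).2.1 ∧ (pick j).2.1 < a ∧
        x = pT (pick j).2.2.1 (pick j).2.2.2) := by
    intro x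
    by_cases hx : cutMark E rho es y A pick a x = 0
    · exact ⟨0, fun h => absurd hx h⟩
    · rcases T.cutMark_ne hpl hx with ⟨p, hp, j, hj, hd⟩ | ⟨z, hz, hxz⟩
      · exact ⟨j + 1, fun _ => Or.inl ⟨p, j, hp, hj, Nat.lt_succ_self j, hd⟩⟩
      · obtain ⟨j, hj, -, hpick, ht⟩ := T.fair hbal hz
        refine ⟨j + 1, fun _ => Or.inr ⟨j, hj, Nat.lt_succ_self j, ht, ?_, ?_⟩⟩
        · rw [hpick]
          exact ((T.invariant a).1 z hz).1
        · rw [hpick, hxz]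
  choose n hn using hwit
  obtain ⟨N1, hN1⟩ := T.exists_cut a
  obtain ⟨j0, hj0⟩ : ∃ j0, j0 = max (N0 + 1) (max N1 (K.sup n)) := ⟨_, rfl⟩
  have hjN0 : N0 < j0 := by
    have := le_max_left (N0 + 1) (max N1 (K.sup n))
    omega
  have hjN1 : N1 ≤ j0 := by
    have := (le_max_left N1 (K.sup n)).trans (le_max_right (N0 + 1) _)
    omega
  have hjn : K.sup n ≤ j0 := by
    have := (le_max_right N1 (K.sup n)).trans (le_max_right (N0 + 1) _)
    omega
  obtain ⟨b, hb⟩ : ∃ b, b = f j0 := ⟨_, rfl⟩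
  have hj0b : j0 ≤ b := by
    rw [hb]
    exact hf.id_le j0
  have hab : a < b := by
    rw [ha, hb]
    exact hf hjN0
  have hcutB := hN1 b (hjN1.trans hj0b)
  obtain ⟨hqq, hle, hzero⟩ := hfm N0 j0 hjN0.le
  rw [← ha, ← hb] at hqq hle hzero
  obtain ⟨Y, mk, R, hmk0, hmka, hmkb, hdel⟩ := T.exists_recharge hab.le hcutA hcutB
  have hinv : ∀ t, ∀ z ∈ A t, z.2.2.1 ∈ E.flatMap bstOf ∧ z.2.2.2 ∈ rawsOf E :=
    fun t z hz => ((T.invariant t).1 z hz).2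
  have hroot : ∀ t, ∀ z ∈ A t, z.2.1 < t := fun t z hz => ((T.invariant t).1 z hz).1
  obtain ⟨l1, -, hl1, -⟩ := R.machine_run T (A0 := 0) (tb := false) (Nat.zero_le 0) (Nat.zero_le a)
    hab.le (Or.inl rfl) (fun j _ _ δ hδ => by omega)
  obtain ⟨l2, hl2⟩ := convert_all (tb := false) (T.mem_edge (t := a) rfl) (mk a) (A a) (hinv a) Y
    0 (hroot a)
  obtain ⟨l3, hl3ne, hl3, hl3d⟩ := R.machine_run T (A0 := a) (tb := true) le_rfl hab.le le_rfl
    (Or.inr rfl) (fun j hj _ => hdel j hj)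
  obtain ⟨l4, hl4⟩ := convert_all (tb := true) (T.mem_edge (t := b) rfl) (mk b) (A b) (hinv b) Y
    a (hroot b)
  have hstart : conf (rho 0).q (mk 0) (A 0) Y 0 = ⟨st [] (rho 0).q, renV (rho 0).m, 0⟩ := by
    simp [conf, T.zero, hmk0]
  have hmid : conf (rho a).q (mk a) (A a) Y a =
      ⟨st [] (rho a).q, cutMark E rho es y A pick a, 0⟩ := by
    simp only [conf, cutMark, hmka]
    congr 1
    exact Finset.sum_eq_zero fun z hz => if_pos (hroot a z hz)
  rw [hstart] at hl1
  rw [hmka] at hl2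
  rw [hmid] at hl3
  rw [hmkb, ← hqq] at hl4
  rw [hmkb, ← hqq] at hl3
  rw [hmka] at hl1
  refine ⟨st [] (rho a).q, List.mem_map.2 ⟨_, T.mem_edge (t := a) rfl, rfl⟩,
    cutMark E rho es y A pick a, cutMark E rho es y A pick b, l3 ++ l4, (hl1.append hl2).reach,
    by simp [hl3ne hab], hl3.append hl4, fun x => ?_⟩
  by_cases hx : cutMark E rho es y A pick a x = 0
  · exact Or.inl ⟨hx, hzero x hx⟩
  · refine Or.inr ⟨?_, hle x⟩
    have hnb : n x ≤ b := (Finset.le_sup (f := n) (hK _ _ hx)).trans (hjn.trans hj0b)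
    rw [dsum_append, Finsupp.add_apply]
    rcases hn x hx with ⟨p, j, rfl, h1, h2, h3⟩ | ⟨j, h1, h2, h3, h4, h5⟩
    · have := (hl3d j h1 (by omega)).1 p h3
      omega
    · have := (hl3d j h1 (by omega)).2 h3 h4
      rw [h5]
      omega

/-- A progressive run exists if and only if the machine with counters has a lasso. -/
theorem rProg_iff_wit {E : List REdge} {s : VConfig} (hs : s.bag = 0) :
    RProg E s ↔ Wit (edgesA E) (edgesB E) (statesG E) ⟨st [] s.q, renV s.m, 0⟩ :=
  ⟨Wit.of_rProg hs, RProg.of_wit hs⟩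

/-! ### From lassos to reachability -/

/-- Tagged places, balloon states and control states. -/
def pc (t p : ℕ) : ℕ := Nat.pair t p

theorem pc_inj {t t' p p' : ℕ} : pc t p = pc t' p' ↔ t = t' ∧ p = p' := Nat.pair_eq_pair

/-- Tag a raw vector. -/
def tagR (t : ℕ) (l : Raw) : Raw := l.map fun x => (pc t x.1, x.2)

/-- Tag a vector. -/
def tagV (t : ℕ) (v : Vec) : Vec := v.mapDomain (pc t)

/-- Tag a balloon. -/
def tagB (t : ℕ) (b : Balloon) : Balloon := (pc t b.1, b.2)

/-- Tag an operation; optionally, record the decrements at the places with tag `3`. -/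
def tagOp (t : ℕ) (flag : Bool) : ROp → ROp
  | .inl (d, i) => .upd (tagR t d) (tagR t i ++ bif flag then tagR 3 d else [])
  | .inr (.inl (s, b, vs)) => .infl (pc t s) b vs
  | .inr (.inr (.inl (s, s', pl, p))) => .defl (pc t s) (pc t s') pl (pc t p)
  | .inr (.inr (.inr s)) => .brst (pc t s)

/-- The machine which guesses a lasso and verifies it. -/
def lassoE (Ea Eb : List REdge) (Qs Ps : List ℕ) : List REdge :=
  Ea.map (fun e => (pc 1 e.1, tagOp 0 false e.2.1, pc 1 e.2.2)) ++
  (Eb.flatMap fun e => [(pc 3 e.1, tagOp 1 true e.2.1, pc 2 e.2.2),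
    (pc 2 e.1, tagOp 1 true e.2.1, pc 2 e.2.2)]) ++
  (Qs.flatMap fun q => [(pc 1 q, .upd [] [(pc 4 q, 2)], pc 4 0),
    (pc 4 0, .upd [(pc 4 q, 1)] [], pc 3 q), (pc 2 q, .upd [(pc 4 q, 1)] [], pc 5 0)]) ++
  (Ps.flatMap fun p => [(pc 4 0, .upd [(pc 0 p, 1)] [(pc 1 p, 1), (pc 2 p, 1)], pc 4 0),
    (pc 5 0, .upd [(pc 3 p, 1)] [], pc 6 p),
    (pc 6 p, .upd [(pc 1 p, 1), (pc 2 p, 1)] [], pc 6 p),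
    (pc 6 p, .upd [(pc 1 p, 1)] [], pc 6 p),
    (pc 6 p, .upd [(pc 3 p, 1)] [], pc 6 p),
    (pc 6 p, .upd [] [], pc 5 0)])

/-- The edges of `lassoE`. -/
inductive LEdge (Ea Eb : List REdge) (Qs Ps : List ℕ) : REdge → Prop
  | first {e} : e ∈ Ea → LEdge Ea Eb Qs Ps (pc 1 e.1, tagOp 0 false e.2.1, pc 1 e.2.2)
  | start {e} : e ∈ Eb → LEdge Ea Eb Qs Ps (pc 3 e.1, tagOp 1 true e.2.1, pc 2 e.2.2)
  | cycle {e} : e ∈ Eb → LEdge Ea Eb Qs Ps (pc 2 e.1, tagOp 1 true e.2.1, pc 2 e.2.2)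
  | guess {q} : q ∈ Qs → LEdge Ea Eb Qs Ps (pc 1 q, .upd [] [(pc 4 q, 2)], pc 4 0)
  | enter {q} : q ∈ Qs → LEdge Ea Eb Qs Ps (pc 4 0, .upd [(pc 4 q, 1)] [], pc 3 q)
  | quit {q} : q ∈ Qs → LEdge Ea Eb Qs Ps (pc 2 q, .upd [(pc 4 q, 1)] [], pc 5 0)
  | move {p} : p ∈ Ps →
      LEdge Ea Eb Qs Ps (pc 4 0, .upd [(pc 0 p, 1)] [(pc 1 p, 1), (pc 2 p, 1)], pc 4 0)
  | visit {p} : p ∈ Ps → LEdge Ea Eb Qs Ps (pc 5 0, .upd [(pc 3 p, 1)] [], pc 6 p)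
  | both {p} : p ∈ Ps →
      LEdge Ea Eb Qs Ps (pc 6 p, .upd [(pc 1 p, 1), (pc 2 p, 1)] [], pc 6 p)
  | drop {p} : p ∈ Ps → LEdge Ea Eb Qs Ps (pc 6 p, .upd [(pc 1 p, 1)] [], pc 6 p)
  | unflag {p} : p ∈ Ps → LEdge Ea Eb Qs Ps (pc 6 p, .upd [(pc 3 p, 1)] [], pc 6 p)
  | leave {p} : p ∈ Ps → LEdge Ea Eb Qs Ps (pc 6 p, .upd [] [], pc 5 0)

section

variable {Ea Eb : List REdge} {Qs Ps : List ℕ}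

theorem mem_lassoE {e : REdge} : e ∈ lassoE Ea Eb Qs Ps ↔ LEdge Ea Eb Qs Ps e := by
  constructor
  · intro h
    simp only [lassoE, List.mem_append, List.mem_map, List.mem_flatMap, List.mem_cons,
      List.not_mem_nil, or_false] at h
    rcases h with ((⟨a, ha, rfl⟩ | ⟨a, ha, rfl | rfl⟩) | ⟨q, hq, rfl | rfl | rfl⟩) |
      ⟨p, hp, rfl | rfl | rfl | rfl | rfl | rfl⟩
    · exact .first ha
    · exact .start ha
    · exact .cycle ha
    · exact .guess hq
    · exact .enter hq
    · exact .quit hq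
    · exact .move hp
    · exact .visit hp
    · exact .both hp
    · exact .drop hp
    · exact .unflag hp
    · exact .leave hp
  · intro h
    simp only [lassoE, List.mem_append, List.mem_map, List.mem_flatMap, List.mem_cons,
      List.not_mem_nil, or_false]
    cases h with
    | first h => exact Or.inl (Or.inl (Or.inl ⟨_, h, rfl⟩))
    | start h => exact Or.inl (Or.inl (Or.inr ⟨_, h, Or.inl rfl⟩))
    | cycle h => exact Or.inl (Or.inl (Or.inr ⟨_, h, Or.inr rfl⟩))
    | guess h => exact Or.inl (Or.inr ⟨_, h, Or.inl rfl⟩)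
    | enter h => exact Or.inl (Or.inr ⟨_, h, Or.inr (Or.inl rfl)⟩)
    | quit h => exact Or.inl (Or.inr ⟨_, h, Or.inr (Or.inr rfl)⟩)
    | move h => exact Or.inr ⟨_, h, Or.inl rfl⟩
    | visit h => exact Or.inr ⟨_, h, Or.inr (Or.inl rfl)⟩
    | both h => exact Or.inr ⟨_, h, Or.inr (Or.inr (Or.inl rfl))⟩
    | drop h => exact Or.inr ⟨_, h, Or.inr (Or.inr (Or.inr (Or.inl rfl)))⟩
    | unflag h => exact Or.inr ⟨_, h, Or.inr (Or.inr (Or.inr (Or.inr (Or.inl rfl))))⟩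
    | leave h => exact Or.inr ⟨_, h, Or.inr (Or.inr (Or.inr (Or.inr (Or.inr rfl))))⟩

/-! ### Tagged vectors -/

theorem tagV_apply (t t' p : ℕ) (v : Vec) : tagV t v (pc t' p) = if t = t' then v p else 0 := by
  split_ifs with h
  · subst h
    exact Finsupp.mapDomain_apply (fun a b h => (pc_inj.1 h).2) v p
  · refine Finsupp.mapDomain_of_notMem_range _ _ ?_
    rintro ⟨a, ha⟩
    exact h (pc_inj.1 ha).1

theorem tag_ext {v w : Vec} (h : ∀ t p, v (pc t p) = w (pc t p)) : v = w := by
  ext x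
  have := h x.unpair.1 x.unpair.2
  rwa [pc, Nat.pair_unpair] at this

theorem tagV_add (t : ℕ) (v w : Vec) : tagV t (v + w) = tagV t v + tagV t w :=
  Finsupp.mapDomain_add

theorem tagV_single (t p k : ℕ) :
    tagV t (Finsupp.single p k) = Finsupp.single (pc t p) k := Finsupp.mapDomain_single

theorem tagV_zero (t : ℕ) : tagV t 0 = 0 := Finsupp.mapDomain_zero

theorem vec_tagR (t : ℕ) (l : Raw) : vec (tagR t l) = tagV t (vec l) := by
  induction l with
  | nil => simp [tagR, tagV]
  | cons x l ih =>
    have : tagR t (x :: l) = (pc t x.1, x.2) :: tagR t l := rfl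
    rw [this, vec_cons, vec_cons, tagV_add, tagV_single, ih]

/-- The marking recording the decrements of an operation. -/
def flagV (flag : Bool) (op : ROp) : Vec := bif flag then tagV 3 (dec op) else 0

theorem flagV_apply (flag : Bool) (op : ROp) {t : ℕ} (ht : t ≠ 3) (p : ℕ) :
    flagV flag op (pc t p) = 0 := by
  cases flag
  · rfl
  · simp [flagV, tagV_apply, ht.symm]

theorem flagV_upd (flag : Bool) (d i : Raw) :
    vec (bif flag then tagR 3 d else []) = flagV flag (ROp.upd d i) := by
  cases flag
  · rfl
  · exact vec_tagR 3 d

theorem ROpRel.tag {op : ROp} {m m1 : Vec} {n n1 : Multiset Balloon} (h : ROpRel op m n m1 n1)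
    (t : ℕ) (flag : Bool) (C : Vec) (N : Multiset Balloon) :
    ROpRel (tagOp t flag op) (C + tagV t m) (N + n.map (tagB t)) (C + flagV flag op + tagV t m1)
      (N + n1.map (tagB t)) := by
  rcases op with ⟨d, i⟩ | ⟨s, b, vs⟩ | ⟨s, s', pl, p⟩ | s
  · obtain ⟨h1, rfl⟩ := h
    refine ⟨?_, rfl⟩
    rw [vec_append, vec_tagR, vec_tagR, flagV_upd, add_assoc _ (tagV t m1), ← tagV_add, h1,
      tagV_add]
    abel
  · obtain ⟨rfl, z, hz, rfl⟩ := h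
    refine ⟨?_, z, hz, ?_⟩
    · cases flag <;> simp [flagV, dec, tagV_zero]
    · simp [tagB, add_assoc]
  · obtain ⟨k, n0, rfl, rfl, rfl⟩ := h
    refine ⟨k, N + n0.map (tagB t), ?_, ?_, ?_⟩
    · simp [tagB, add_assoc]
    · rw [tagV_add, tagV_single]
      cases flag <;> simp [flagV, dec, tagV_zero, add_assoc]
    · simp [tagB, add_assoc]
  · obtain ⟨rfl, k, n0, rfl, rfl⟩ := h
    refine ⟨?_, k, N + n1.map (tagB t), ?_, rfl⟩
    · cases flag <;> simp [flagV, dec, tagV_zero]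
    · simp [tagB, add_assoc]

theorem exists_tagged {t s : ℕ} {k : Vec} {N n n0 : Multiset Balloon}
    (hN : ∀ b ∈ N, ∀ s, b.1 ≠ pc t s) (h : N + n.map (tagB t) = n0 + {(pc t s, k)}) :
    ∃ n1, n = n1 + {(s, k)} ∧ n0 = N + n1.map (tagB t) := by
  have hmem : (pc t s, k) ∈ N + n.map (tagB t) := by rw [h]; simp
  rw [Multiset.mem_add] at hmem
  rcases hmem with hmem | hmem
  · exact absurd rfl (hN _ hmem s)
  · obtain ⟨⟨s', k'⟩, hb, hbe⟩ := Multiset.mem_map.1 hmem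
    simp only [tagB, Prod.mk.injEq, pc_inj, true_and] at hbe
    obtain ⟨rfl, rfl⟩ := hbe
    obtain ⟨n1, rfl⟩ := Multiset.exists_cons_of_mem hb
    refine ⟨n1, by rw [add_comm, Multiset.singleton_add], ?_⟩
    rw [Multiset.map_cons, ← Multiset.singleton_add, add_comm {tagB t (s', k')}, ← add_assoc] at h
    exact (add_right_cancel h).symm

theorem ROpRel.untag {op : ROp} {m M' C : Vec} {n N' N : Multiset Balloon} {t : ℕ} {flag : Bool}
    (h : ROpRel (tagOp t flag op) (C + tagV t m) (N + n.map (tagB t)) M' N') (ht : t ≠ 3)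
    (hC : ∀ p, C (pc t p) = 0) (hN : ∀ b ∈ N, ∀ s, b.1 ≠ pc t s) :
    ∃ m1 n1, ROpRel op m n m1 n1 ∧ M' = C + flagV flag op + tagV t m1 ∧
      N' = N + n1.map (tagB t) := by
  rcases op with ⟨d, i⟩ | ⟨s, b, vs⟩ | ⟨s, s', pl, p⟩ | s
  · obtain ⟨h1, rfl⟩ := h
    rw [vec_append, vec_tagR, vec_tagR, flagV_upd flag d i] at h1
    have hle : ∀ p, M' (pc t p) + vec d p = m p + vec i p := by
      intro p
      have := DFunLike.congr_fun h1 (pc t p)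
      simpa [tagV_apply, hC, flagV_apply flag _ ht] using this
    have h2 : m + vec i - vec d + vec d = m + vec i := by
      ext p
      have := hle p
      simp only [Finsupp.add_apply, Finsupp.tsub_apply]
      omega
    refine ⟨m + vec i - vec d, n, ⟨h2, rfl⟩, ?_, rfl⟩
    refine add_right_cancel (b := tagV t (vec d)) ?_
    rw [add_assoc _ (tagV t _), ← tagV_add, h2, tagV_add, h1]
    abel
  · obtain ⟨rfl, z, hz, rfl⟩ := h
    refine ⟨m, n + {(s, vec b + z)}, ⟨rfl, z, hz, rfl⟩, ?_, ?_⟩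
    · cases flag <;> simp [flagV, dec, tagV_zero]
    · simp [tagB, add_assoc]
  · obtain ⟨k, n0, h1, rfl, rfl⟩ := h
    obtain ⟨n1, rfl, rfl⟩ := exists_tagged hN h1
    refine ⟨_, _, ⟨k, n1, rfl, rfl, rfl⟩, ?_, ?_⟩
    · rw [tagV_add, tagV_single]
      cases flag <;> simp [flagV, dec, tagV_zero, add_assoc]
    · simp [tagB, add_assoc]
  · obtain ⟨rfl, k, n0, h1, rfl⟩ := h
    obtain ⟨n1, rfl, rfl⟩ := exists_tagged hN h1
    refine ⟨_, _, ⟨rfl, k, n1, rfl, rfl⟩, ?_, rfl⟩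
    cases flag <;> simp [flagV, dec, tagV_zero]

/-! ### Soundness -/

/-- The invariant of the runs of `lassoE`. -/
inductive LInv (Ea Eb : List REdge) (Qs : List ℕ) (c0 : VConfig) : VConfig → Prop
  | first {c : VConfig} {q : ℕ} {m : Vec} {n : Multiset Balloon} : RReach Ea c0 ⟨q, m, n⟩ →
      c.q = pc 1 q → c.m = tagV 0 m → c.bag = n.map (tagB 0) → LInv Ea Eb Qs c0 c
  | mid {c : VConfig} {q : ℕ} {m m1 : Vec} {n : Multiset Balloon} : q ∈ Qs →
      RReach Ea c0 ⟨q, m + m1, n⟩ → c.q = pc 4 0 →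
      c.m = tagV 0 m + tagV 1 m1 + tagV 2 m1 + Finsupp.single (pc 4 q) 2 →
      c.bag = n.map (tagB 0) → LInv Ea Eb Qs c0 c
  | loop {c : VConfig} {q q' : ℕ} {m m1 m2 : Vec} {n n2 : Multiset Balloon} {es : List REdge} :
      q ∈ Qs → RReach Ea c0 ⟨q, m + m1, n⟩ → RPath Eb ⟨q, m1, 0⟩ es ⟨q', m2, n2⟩ →
      (c.q = pc 3 q' ∨ c.q = pc 2 q' ∧ es ≠ []) →
      c.m = tagV 0 m + tagV 2 m1 + tagV 3 (dsum es) + Finsupp.single (pc 4 q) 1 + tagV 1 m2 →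
      c.bag = n.map (tagB 0) + n2.map (tagB 1) → LInv Ea Eb Qs c0 c
  | final {c : VConfig} {q : ℕ} {m m1 m2 u v w : Vec} {n n2 : Multiset Balloon}
      {es : List REdge} :
      q ∈ Qs → RReach Ea c0 ⟨q, m + m1, n⟩ → RPath Eb ⟨q, m1, 0⟩ es ⟨q, m2, n2⟩ → es ≠ [] →
      (c.q = pc 5 0 ∨ ∃ p, c.q = pc 6 p ∧ dsum es p ≠ 0 ∧ v p + m1 p ≤ m2 p + u p) →
      (∀ p, (u p = m1 p ∧ v p = m2 p) ∨ (dsum es p ≠ 0 ∧ v p + m1 p ≤ m2 p + u p)) →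
      (∀ p, w p ≤ dsum es p) →
      c.m = tagV 0 m + tagV 2 u + tagV 3 w + tagV 1 v →
      c.bag = n.map (tagB 0) + n2.map (tagB 1) → LInv Ea Eb Qs c0 c

theorem tagB_ne {t t' : ℕ} (h : t ≠ t') (n : Multiset Balloon) :
    ∀ b ∈ n.map (tagB t), ∀ s, b.1 ≠ pc t' s := by
  intro b hb s hs
  obtain ⟨b', -, rfl⟩ := Multiset.mem_map.1 hb
  exact h (pc_inj.1 hs).1

theorem LInv.final_step {c0 c c' : VConfig} {p q : ℕ} {m m1 m2 u v w u' v' w' : Vec}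
    {n n2 : Multiset Balloon} {es : List REdge} (hq : q ∈ Qs)
    (ha : RReach Ea c0 ⟨q, m + m1, n⟩) (hb : RPath Eb ⟨q, m1, 0⟩ es ⟨q, m2, n2⟩) (hne : es ≠ [])
    (hc' : c'.q = pc 5 0 ∨ c'.q = pc 6 p) (hp : dsum es p ≠ 0 ∧ v p + m1 p ≤ m2 p + u p)
    (hall : ∀ p, (u p = m1 p ∧ v p = m2 p) ∨ (dsum es p ≠ 0 ∧ v p + m1 p ≤ m2 p + u p))
    (hw : ∀ p, w p ≤ dsum es p)
    (hm : c.m = tagV 0 m + tagV 2 u + tagV 3 w + tagV 1 v)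
    (hn : c.bag = n.map (tagB 0) + n2.map (tagB 1)) (hbag : c'.bag = c.bag)
    (hm' : c'.m + (tagV 2 u' + tagV 3 w' + tagV 1 v') = c.m)
    (hu' : ∀ x ≠ p, u' x = 0) (hv' : ∀ x ≠ p, v' x = 0) (huv : u' p ≤ v' p) :
    LInv Ea Eb Qs c0 c' := by
  have hcoord : ∀ x, u' x ≤ u x ∧ w' x ≤ w x ∧ v' x ≤ v x := by
    intro x
    have h2 := DFunLike.congr_fun hm' (pc 2 x)
    have h3 := DFunLike.congr_fun hm' (pc 3 x)
    have h1 := DFunLike.congr_fun hm' (pc 1 x)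
    rw [hm] at h1 h2 h3
    simp [tagV_apply] at h1 h2 h3
    omega
  have key : (v - v') p + m1 p ≤ m2 p + (u - u') p := by
    have := hcoord p
    simp only [Finsupp.tsub_apply]
    omega
  refine .final (u := u - u') (v := v - v') (w := w - w') hq ha hb hne ?_ ?_ ?_ ?_
    (hbag.trans hn)
  · rcases hc' with h | h
    · exact Or.inl h
    · exact Or.inr ⟨p, h, hp.1, key⟩
  · intro x
    by_cases hx : x = p
    · subst hx
      exact Or.inr ⟨hp.1, key⟩
    · simpa [hu' x hx, hv' x hx] using hall x
  · intro x
    have := hw x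
    simp only [Finsupp.tsub_apply]
    omega
  · rw [hm] at hm'
    refine tag_ext fun t x => ?_
    have h := DFunLike.congr_fun hm' (pc t x)
    have := hcoord x
    simp only [tagV_apply, Finsupp.add_apply, Finsupp.tsub_apply] at h ⊢
    split_ifs at h ⊢ <;> omega

theorem LInv.step {c0 c c' : VConfig} (h : LInv Ea Eb Qs c0 c) {e : REdge}
    (he : LEdge Ea Eb Qs Ps e) (hr : RRel e c c') : LInv Ea Eb Qs c0 c' := by
  obtain ⟨r1, r2, r3⟩ := hr
  cases h with
  | @first q m n ha hq hm hn =>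
    rw [hq] at r1
    rw [hm, hn] at r3
    cases he with
    | @first e he =>
      simp only [pc_inj, true_and] at r1
      rw [← zero_add (tagV 0 m), ← zero_add (n.map (tagB 0))] at r3
      obtain ⟨m1, n1, h1, h2, h3⟩ := r3.untag (by simp) (by simp) (by simp)
      refine .first (ha.tail ⟨e, he, ?_, rfl, h1⟩) r2 ?_ ?_
      · exact r1
      · simpa [flagV] using h2
      · simpa using h3
    | @guess q' hq' =>
      simp only [pc_inj, true_and] at r1
      subst r1
      refine .mid (m := m) (m1 := 0) hq' (by simpa using ha) r2 ?_ r3.2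
      simpa [tagV_zero] using r3.1
    | _ => simp [pc_inj] at r1
  | @mid q m m1 n hqs ha hq hm hn =>
    rw [hq] at r1
    rw [hm, hn] at r3
    cases he with
    | @enter q' hq' =>
      have hqq : q = q' := by
        by_contra hne
        have := DFunLike.congr_fun r3.1 (pc 4 q')
        simp [tagV_apply, pc_inj, hne] at this
      subst hqq
      refine .loop (es := []) (n2 := 0) hqs ha rfl (Or.inl r2) ?_ (by simpa using r3.2)
      refine add_right_cancel (b := Finsupp.single (pc 4 q) 1) ?_
      have h1 := r3.1
      simp only [vec_cons, vec_nil, add_zero] at h1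
      rw [h1, dsum_nil, tagV_zero, ← one_add_one_eq_two, Finsupp.single_add]
      abel
    | @move p hp =>
      have h0 : m p ≠ 0 := by
        intro h0
        have := DFunLike.congr_fun r3.1 (pc 0 p)
        simp [tagV_apply, pc_inj, h0] at this
      have hsplit : m = (m - Finsupp.single p 1) + Finsupp.single p 1 := by
        ext x
        simp only [Finsupp.add_apply, Finsupp.tsub_apply, Finsupp.single_apply]
        split_ifs with hx
        · subst hx
          omega
        · omega
      refine .mid (m := m - Finsupp.single p 1) (m1 := m1 + Finsupp.single p 1) hqs ?_ r2 ?_ r3.2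
      · have h1 : m - Finsupp.single p 1 + (m1 + Finsupp.single p 1) = m + m1 := by
          conv_rhs => rw [hsplit]
          rw [add_right_comm, add_assoc]
        rw [h1]
        exact ha
      · refine add_right_cancel (b := Finsupp.single (pc 0 p) 1) ?_
        have h1 := r3.1
        simp only [vec_cons, vec_nil, add_zero] at h1
        rw [h1]
        conv_lhs => rw [hsplit]
        simp only [tagV_add, tagV_single]
        abel
    | _ => simp [pc_inj] at r1
  | @loop q q' m m1 m2 n n2 es hqs ha hb hq hm hn =>
    have hstep : ∀ e ∈ Eb, q' = e.1 → c'.q = pc 2 e.2.2 →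
        ROpRel (tagOp 1 true e.2.1) c.m c.bag c'.m c'.bag → LInv Ea Eb Qs c0 c' := by
      intro e he hq1 hq2 ho
      rw [hm, hn] at ho
      obtain ⟨m3, n3, h1, h2, h3⟩ := ho.untag (by simp)
        (by simp [tagV_apply, pc_inj]) (tagB_ne (by simp) n)
      refine .loop (es := es ++ [e]) (q' := e.2.2) hqs ha
        (hb.append (RPath.single he ⟨hq1, rfl, h1⟩)) (Or.inr ⟨hq2, by simp⟩) ?_ h3
      rw [h2, dsum_append, dsum_cons, dsum_nil, add_zero, tagV_add, flagV, cond_true]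
      abel
    rcases hq with hq | ⟨hq, hne⟩
    · rw [hq] at r1
      cases he with
      | @start e he =>
        simp only [pc_inj, true_and] at r1
        exact hstep e he r1 r2 r3
      | _ => simp [pc_inj] at r1
    · rw [hq] at r1
      cases he with
      | @cycle e he =>
        simp only [pc_inj, true_and] at r1
        exact hstep e he r1 r2 r3
      | @quit q1 hq1 =>
        simp only [pc_inj, true_and] at r1
        subst r1
        rw [hm, hn] at r3
        have hqq : q = q' := by
          by_contra hne
          have := DFunLike.congr_fun r3.1 (pc 4 q')
          simp [tagV_apply, pc_inj, hne] at this
        subst hqq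
        refine .final (u := m1) (v := m2) (w := dsum es) hqs ha hb hne (Or.inl r2)
          (fun _ => Or.inl ⟨rfl, rfl⟩) (fun _ => le_rfl) ?_ r3.2
        refine add_right_cancel (b := Finsupp.single (pc 4 q) 1) ?_
        have h1 := r3.1
        simp only [vec_cons, vec_nil, add_zero] at h1
        rw [h1]
        abel
      | _ => simp [pc_inj] at r1
  | @final q m m1 m2 u v w n n2 es hqs ha hb hne hq hall hw hm hn =>
    rcases hq with hq | ⟨p, hq, hp⟩
    · rw [hq] at r1
      cases he with
      | @visit p hp =>
        have hd : w p ≠ 0 := by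
          intro h0
          have := DFunLike.congr_fun r3.1 (pc 3 p)
          rw [hm] at this
          simp [tagV_apply, h0] at this
        have hd' : dsum es p ≠ 0 := by
          have := hw p
          omega
        refine LInv.final_step (p := p) (u' := 0) (v' := 0) (w' := Finsupp.single p 1) hqs ha hb
          hne (Or.inr r2) ⟨hd', ?_⟩ hall hw hm hn r3.2 ?_ (by simp) (by simp) (by simp)
        · rcases hall p with h | h
          · omega
          · exact h.2
        · simpa [tagV_zero, tagV_single] using r3.1
      | _ => simp [pc_inj] at r1
    · rw [hq] at r1
      cases he with
      | @both p' hp' =>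
        simp only [pc_inj, true_and] at r1
        subst r1
        refine LInv.final_step (p := p) (u' := Finsupp.single p 1) (v' := Finsupp.single p 1)
          (w' := 0) hqs ha hb hne (Or.inr r2) hp hall hw hm hn r3.2 ?_
          (by simp +contextual [eq_comm])
          (by simp +contextual [eq_comm]) (by simp)
        have h1 := r3.1
        simp only [vec_cons, vec_nil, add_zero] at h1
        rw [← h1, tagV_zero, tagV_single, tagV_single]
        abel
      | @drop p' hp' =>
        simp only [pc_inj, true_and] at r1
        subst r1
        refine LInv.final_step (p := p) (u' := 0) (v' := Finsupp.single p 1)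
          (w' := 0) hqs ha hb hne (Or.inr r2) hp hall hw hm hn r3.2 ?_ (by simp)
          (by simp +contextual [eq_comm]) (by simp)
        simpa [tagV_zero, tagV_single] using r3.1
      | @unflag p' hp' =>
        simp only [pc_inj, true_and] at r1
        subst r1
        refine LInv.final_step (p := p) (u' := 0) (v' := 0) (w' := Finsupp.single p 1) hqs ha hb
          hne (Or.inr r2) hp hall hw hm hn r3.2 ?_ (by simp) (by simp) (by simp)
        simpa [tagV_zero, tagV_single] using r3.1
      | @leave p' hp' =>
        simp only [pc_inj, true_and] at r1
        subst r1
        refine LInv.final_step (p := p) (u' := 0) (v' := 0) (w' := 0) hqs ha hb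
          hne (Or.inl r2) hp hall hw hm hn r3.2 ?_ (by simp) (by simp) (by simp)
        simpa [tagV_zero] using r3.1
      | _ => simp [pc_inj] at r1

theorem wit_of_reach {q0 : ℕ} {m0 : Vec}
    (h : RReach (lassoE Ea Eb Qs Ps) ⟨pc 1 q0, tagV 0 m0, 0⟩ ⟨pc 5 0, 0, 0⟩) :
    Wit Ea Eb Qs ⟨q0, m0, 0⟩ := by
  have hinv : ∀ {c}, RReach (lassoE Ea Eb Qs Ps) ⟨pc 1 q0, tagV 0 m0, 0⟩ c →
      LInv Ea Eb Qs ⟨q0, m0, 0⟩ c := by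
    intro c hc
    induction hc with
    | refl => exact .first .refl rfl rfl (by simp)
    | tail _ h ih =>
      obtain ⟨e, he, hr⟩ := h
      exact ih.step (mem_lassoE.1 he) hr
  cases hinv h with
  | first _ hq => simp [pc_inj] at hq
  | mid _ _ hq => simp [pc_inj] at hq
  | loop _ _ _ hq => simp [pc_inj] at hq
  | @final q m m1 m2 u v w n n2 es hqs ha hb hne hq hall hw hm hn =>
    have hn' := hn.symm
    simp only [add_eq_zero, Multiset.map_eq_zero] at hn'
    have hz : ∀ x, m x = 0 ∧ u x = 0 ∧ v x = 0 := by
      intro x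
      have h0 := DFunLike.congr_fun hm (pc 0 x)
      have h1 := DFunLike.congr_fun hm (pc 1 x)
      have h2 := DFunLike.congr_fun hm (pc 2 x)
      simp [tagV_apply] at h0 h1 h2
      omega
    have hm0 : m = 0 := by
      ext x
      exact (hz x).1
    rw [hn'.1, hm0, zero_add] at ha
    rw [hn'.2] at hb
    refine ⟨q, hqs, m1, m2, es, ha, hne, hb, fun x => ?_⟩
    have := hz x
    rcases hall x with h | h
    · left
      omega
    · right
      exact ⟨h.1, by omega⟩

end

section

/-! ### Completeness of the lasso machine -/

/-- The places affected by an operation. -/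
def opPl : ROp → List ℕ
  | .inl (d, i) => d.map Prod.fst ++ i.map Prod.fst
  | .inr (.inl _) => []
  | .inr (.inr (.inl (_, _, _, p))) => [p]
  | .inr (.inr (.inr _)) => []

theorem ROpRel.support {op : ROp} {m m1 : Vec} {n n1 : Multiset Balloon}
    (h : ROpRel op m n m1 n1) {p : ℕ} (hp : m1 p ≠ 0) : m p ≠ 0 ∨ p ∈ opPl op := by
  rcases op with ⟨d, i⟩ | ⟨s, b, vs⟩ | ⟨s, s', pl, p'⟩ | s
  · by_contra! hc
    have h1 := DFunLike.congr_fun h.1 p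
    have h2 : vec i p = 0 := by
      by_contra h3
      exact hc.2 (List.mem_append_right _ (mem_keys_of_vec_ne h3))
    simp only [Finsupp.add_apply] at h1
    omega
  · obtain ⟨rfl, -⟩ := h
    exact Or.inl hp
  · obtain ⟨k, n0, -, rfl, -⟩ := h
    by_cases hpp : p' = p
    · simp [opPl, hpp]
    · left
      simpa [Finsupp.single_apply, hpp] using hp
  · obtain ⟨rfl, -⟩ := h
    exact Or.inl hp

theorem RReach.support {E : List REdge} {Ps : List ℕ} (hE : ∀ e ∈ E, opPl e.2.1 ⊆ Ps)
    {c c' : VConfig} (h : RReach E c c') (hc : ∀ p, c.m p ≠ 0 → p ∈ Ps) :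
    ∀ p, c'.m p ≠ 0 → p ∈ Ps := by
  induction h with
  | refl => exact hc
  | tail _ h ih =>
    obtain ⟨e, he, hr⟩ := h
    intro p hp
    rcases hr.2.2.support hp with h | h
    · exact ih p h
    · exact hE e he h

theorem dsum_support {E : List REdge} {Ps : List ℕ} (hE : ∀ e ∈ E, opPl e.2.1 ⊆ Ps)
    {c c' : VConfig} {es : List REdge} (h : RPath E c es c') {p : ℕ} (hp : dsum es p ≠ 0) :
    p ∈ Ps := by
  induction es generalizing c with
  | nil => simp at hp
  | cons e es ih =>
    obtain ⟨c1, he, hr, h⟩ := h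
    by_cases h0 : dsum es p = 0
    · rw [dsum_cons, Finsupp.add_apply, h0, add_zero] at hp
      refine hE e he ?_
      rcases hop : e.2.1 with ⟨d, i⟩ | o
      · rw [hop] at hp
        exact List.mem_append_left _ (mem_keys_of_vec_ne hp)
      · rw [hop] at hp
        exact absurd rfl hp
    · exact ih h h0

theorem RReach.upd {E : List REdge} {q q' : ℕ} {d i : Raw} (he : (q, ROp.upd d i, q') ∈ E)
    {m m' : Vec} (n : Multiset Balloon) (h : m' + vec d = m + vec i) :
    RReach E ⟨q, m, n⟩ ⟨q', m', n⟩ := .single ⟨_, he, rfl, rfl, h, rfl⟩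

theorem RReach.iterate {E : List REdge} {q : ℕ} {d i : Raw} (he : (q, ROp.upd d i, q) ∈ E)
    (k : ℕ) (C : Vec) (n : Multiset Balloon) :
    RReach E ⟨q, C + k • vec d, n⟩ ⟨q, C + k • vec i, n⟩ := by
  induction k generalizing C with
  | zero => simpa using Relation.ReflTransGen.refl
  | succ k ih =>
    have h1 : RReach E ⟨q, C + (k + 1) • vec d, n⟩ ⟨q, C + vec i + k • vec d, n⟩ := by
      refine RReach.upd he n ?_
      rw [succ_nsmul]
      abel
    have h2 : C + (k + 1) • vec i = C + vec i + k • vec i := by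
      rw [succ_nsmul]
      abel
    rw [h2]
    exact h1.trans (ih _)

variable {Ea Eb : List REdge} {Qs Ps : List ℕ}

theorem reach_first {c c' : VConfig} (h : RReach Ea c c') :
    RReach (lassoE Ea Eb Qs Ps) ⟨pc 1 c.q, tagV 0 c.m, c.bag.map (tagB 0)⟩
      ⟨pc 1 c'.q, tagV 0 c'.m, c'.bag.map (tagB 0)⟩ := by
  induction h with
  | refl => exact .refl
  | tail _ h ih =>
    obtain ⟨e, he, h1, h2, h3⟩ := h
    refine ih.tail ⟨_, mem_lassoE.2 (.first he), congrArg (pc 1) h1, congrArg (pc 1) h2, ?_⟩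
    simpa [flagV] using h3.tag 0 false 0 0

theorem reach_guess {v : Vec} (hv : ∀ p, v p ≠ 0 → p ∈ Ps) (C : Vec) (n : Multiset Balloon) :
    RReach (lassoE Ea Eb Qs Ps) ⟨pc 4 0, C + tagV 0 v, n⟩
      ⟨pc 4 0, C + tagV 1 v + tagV 2 v, n⟩ := by
  induction v using Finsupp.induction generalizing C with
  | zero => simpa [tagV_zero] using Relation.ReflTransGen.refl
  | @single_add p k v hp hk ih =>
    have hmem : p ∈ Ps := by
      apply hv
      rw [Finsupp.notMem_support_iff] at hp
      simpa [hp] using hk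
    have h1 := RReach.iterate (mem_lassoE.2 (LEdge.move (Ea := Ea) (Eb := Eb) (Qs := Qs) hmem)) k
      (C + tagV 0 v) n
    have h2 := ih (fun x hx => hv x (by simp [hx]))
      (C + Finsupp.single (pc 1 p) k + Finsupp.single (pc 2 p) k)
    simp only [vec_cons, vec_nil, add_zero, nsmul_add, Finsupp.smul_single_one] at h1
    have e1 : C + tagV 0 (Finsupp.single p k + v) =
        C + tagV 0 v + Finsupp.single (pc 0 p) k := by
      rw [tagV_add, tagV_single]
      abel
    have e2 : C + tagV 0 v + (Finsupp.single (pc 1 p) k + Finsupp.single (pc 2 p) k) =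
        C + Finsupp.single (pc 1 p) k + Finsupp.single (pc 2 p) k + tagV 0 v := by
      abel
    have e3 : C + tagV 1 (Finsupp.single p k + v) + tagV 2 (Finsupp.single p k + v) =
        C + Finsupp.single (pc 1 p) k + Finsupp.single (pc 2 p) k + tagV 1 v + tagV 2 v := by
      rw [tagV_add, tagV_add, tagV_single, tagV_single]
      abel
    rw [e1, e3]
    rw [e2] at h1
    exact h1.trans h2

theorem reach_cycle {c c' : VConfig} {es : List REdge} (h : RPath Eb c es c') (C : Vec) :
    RReach (lassoE Ea Eb Qs Ps) ⟨pc 2 c.q, C + tagV 1 c.m, c.bag.map (tagB 1)⟩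
      ⟨pc 2 c'.q, C + tagV 3 (dsum es) + tagV 1 c'.m, c'.bag.map (tagB 1)⟩ := by
  induction es generalizing c C with
  | nil =>
    cases h
    simpa [tagV_zero] using Relation.ReflTransGen.refl
  | cons e es ih =>
    obtain ⟨c1, he, ⟨h1, h2, h3⟩, h⟩ := h
    refine .head (b := ⟨pc 2 c1.q, C + tagV 3 (dec e.2.1) + tagV 1 c1.m, c1.bag.map (tagB 1)⟩)
      ⟨_, mem_lassoE.2 (.cycle he), congrArg (pc 2) h1, congrArg (pc 2) h2, ?_⟩ ?_
    · simpa [flagV] using h3.tag 1 true C 0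
    · rw [dsum_cons, tagV_add, ← add_assoc C]
      exact ih h _

theorem reach_loop {c c' : VConfig} {es : List REdge} (h : RPath Eb c es c') (hne : es ≠ [])
    (C : Vec) :
    RReach (lassoE Ea Eb Qs Ps) ⟨pc 3 c.q, C + tagV 1 c.m, c.bag.map (tagB 1)⟩
      ⟨pc 2 c'.q, C + tagV 3 (dsum es) + tagV 1 c'.m, c'.bag.map (tagB 1)⟩ := by
  cases es with
  | nil => exact absurd rfl hne
  | cons e es =>
    obtain ⟨c1, he, ⟨h1, h2, h3⟩, h⟩ := h
    refine .head (b := ⟨pc 2 c1.q, C + tagV 3 (dec e.2.1) + tagV 1 c1.m, c1.bag.map (tagB 1)⟩)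
      ⟨_, mem_lassoE.2 (.start he), congrArg (pc 3) h1, congrArg (pc 2) h2, ?_⟩ ?_
    · simpa [flagV] using h3.tag 1 true C 0
    · rw [dsum_cons, tagV_add, ← add_assoc C]
      exact reach_cycle h _

/-- The tokens to be removed at the place `p` in the final phase. -/
def atPl (u v w : Vec) (p : ℕ) : Vec :=
  Finsupp.single (pc 2 p) (u p) + Finsupp.single (pc 3 p) (w p) + Finsupp.single (pc 1 p) (v p)

theorem reach_visit {u v w : Vec} {p : ℕ} (hp : p ∈ Ps) (hw : w p ≠ 0) (huv : u p ≤ v p)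
    (C : Vec) (n : Multiset Balloon) :
    RReach (lassoE Ea Eb Qs Ps) ⟨pc 5 0, C + atPl u v w p, n⟩ ⟨pc 5 0, C, n⟩ := by
  obtain ⟨a, ha⟩ := Nat.exists_eq_add_of_le huv
  obtain ⟨b, hb⟩ := Nat.exists_eq_succ_of_ne_zero hw
  have h1 : RReach (lassoE Ea Eb Qs Ps) ⟨pc 5 0, C + atPl u v w p, n⟩
      ⟨pc 6 p, C + Finsupp.single (pc 2 p) (u p) + Finsupp.single (pc 3 p) b +
        Finsupp.single (pc 1 p) (v p), n⟩ := by
    refine RReach.upd (mem_lassoE.2 (.visit hp)) n ?_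
    simp only [vec_cons, vec_nil, add_zero, atPl, hb, Nat.succ_eq_add_one, Finsupp.single_add]
    abel
  have h2 := RReach.iterate (mem_lassoE.2 (LEdge.both (Ea := Ea) (Eb := Eb) (Qs := Qs) hp)) (u p)
    (C + Finsupp.single (pc 3 p) b + Finsupp.single (pc 1 p) a) n
  have h3 := RReach.iterate (mem_lassoE.2 (LEdge.drop (Ea := Ea) (Eb := Eb) (Qs := Qs) hp)) a
    (C + Finsupp.single (pc 3 p) b) n
  have h4 := RReach.iterate (mem_lassoE.2 (LEdge.unflag (Ea := Ea) (Eb := Eb) (Qs := Qs) hp)) b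
    C n
  have h5 : RReach (lassoE Ea Eb Qs Ps) ⟨pc 6 p, C, n⟩ ⟨pc 5 0, C, n⟩ :=
    RReach.upd (mem_lassoE.2 (.leave hp)) n rfl
  simp only [vec_cons, vec_nil, add_zero, nsmul_add, nsmul_zero, Finsupp.smul_single_one]
    at h2 h3 h4
  have e1 : C + Finsupp.single (pc 2 p) (u p) + Finsupp.single (pc 3 p) b +
      Finsupp.single (pc 1 p) (v p) = C + Finsupp.single (pc 3 p) b + Finsupp.single (pc 1 p) a +
        (Finsupp.single (pc 1 p) (u p) + Finsupp.single (pc 2 p) (u p)) := by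
    rw [ha, Finsupp.single_add]
    abel
  rw [e1] at h1
  exact (((h1.trans h2).trans h3).trans h4).trans h5

theorem reach_final {u v w : Vec} (S : Finset ℕ) (hS : ∀ p ∈ S, p ∈ Ps ∧ w p ≠ 0 ∧ u p ≤ v p)
    (n : Multiset Balloon) :
    RReach (lassoE Ea Eb Qs Ps) ⟨pc 5 0, ∑ p ∈ S, atPl u v w p, n⟩ ⟨pc 5 0, 0, n⟩ := by
  induction S using Finset.induction_on with
  | empty => exact .refl
  | insert p S hp ih =>
    obtain ⟨h1, h2, h3⟩ := hS p (by simp)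
    rw [Finset.sum_insert hp, add_comm]
    exact (reach_visit h1 h2 h3 _ n).trans (ih fun x hx => hS x (by simp [hx]))

theorem sum_single_tag (t : ℕ) {v : Vec} {S : Finset ℕ} (hS : ∀ p, v p ≠ 0 → p ∈ S) :
    ∑ p ∈ S, Finsupp.single (pc t p) (v p) = tagV t v := by
  have h : v.support ⊆ S := fun p hp => hS p (Finsupp.mem_support_iff.1 hp)
  rw [tagV, Finsupp.mapDomain, Finsupp.sum_of_support_subset v h _ (by simp)]

theorem reach_of_wit {q0 : ℕ} {m0 : Vec} (hm0 : ∀ p, m0 p ≠ 0 → p ∈ Ps)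
    (hEa : ∀ e ∈ Ea, opPl e.2.1 ⊆ Ps) (hEb : ∀ e ∈ Eb, opPl e.2.1 ⊆ Ps)
    (h : Wit Ea Eb Qs ⟨q0, m0, 0⟩) :
    RReach (lassoE Ea Eb Qs Ps) ⟨pc 1 q0, tagV 0 m0, 0⟩ ⟨pc 5 0, 0, 0⟩ := by
  obtain ⟨q, hq, m1, m2, es, ha, hne, hb, hall⟩ := h
  have hm1 : ∀ p, m1 p ≠ 0 → p ∈ Ps := ha.support hEa hm0
  have s1 : RReach (lassoE Ea Eb Qs Ps) ⟨pc 1 q0, tagV 0 m0, 0⟩ ⟨pc 1 q, tagV 0 m1, 0⟩ :=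
    reach_first ha
  have s2 : RReach (lassoE Ea Eb Qs Ps) ⟨pc 1 q, tagV 0 m1, 0⟩
      ⟨pc 4 0, Finsupp.single (pc 4 q) 2 + tagV 0 m1, 0⟩ := by
    refine RReach.upd (mem_lassoE.2 (.guess hq)) 0 ?_
    simp [add_comm]
  have s3 := reach_guess (Ea := Ea) (Eb := Eb) (Qs := Qs) hm1 (Finsupp.single (pc 4 q) 2) 0
  have s4 : RReach (lassoE Ea Eb Qs Ps)
      ⟨pc 4 0, Finsupp.single (pc 4 q) 2 + tagV 1 m1 + tagV 2 m1, 0⟩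
      ⟨pc 3 q, Finsupp.single (pc 4 q) 1 + tagV 2 m1 + tagV 1 m1, 0⟩ := by
    refine RReach.upd (mem_lassoE.2 (.enter hq)) 0 ?_
    simp only [vec_cons, vec_nil, add_zero]
    rw [← one_add_one_eq_two, Finsupp.single_add]
    abel
  have s5 : RReach (lassoE Ea Eb Qs Ps)
      ⟨pc 3 q, Finsupp.single (pc 4 q) 1 + tagV 2 m1 + tagV 1 m1, 0⟩
      ⟨pc 2 q, Finsupp.single (pc 4 q) 1 + tagV 2 m1 + tagV 3 (dsum es) + tagV 1 m2, 0⟩ :=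
    reach_loop hb hne _
  have s6 : RReach (lassoE Ea Eb Qs Ps)
      ⟨pc 2 q, Finsupp.single (pc 4 q) 1 + tagV 2 m1 + tagV 3 (dsum es) + tagV 1 m2, 0⟩
      ⟨pc 5 0, tagV 2 m1 + tagV 3 (dsum es) + tagV 1 m2, 0⟩ := by
    refine RReach.upd (mem_lassoE.2 (.quit hq)) 0 ?_
    simp only [vec_cons, vec_nil, add_zero]
    abel
  have s7 : RReach (lassoE Ea Eb Qs Ps) ⟨pc 5 0, tagV 2 m1 + tagV 3 (dsum es) + tagV 1 m2, 0⟩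
      ⟨pc 5 0, 0, 0⟩ := by
    have hsum : tagV 2 m1 + tagV 3 (dsum es) + tagV 1 m2 =
        ∑ p ∈ (dsum es).support, atPl m1 m2 (dsum es) p := by
      simp only [atPl, Finset.sum_add_distrib]
      rw [sum_single_tag, sum_single_tag, sum_single_tag] <;> intro p hp <;>
        rw [Finsupp.mem_support_iff] <;> rcases hall p with h | h <;> omega
    rw [hsum]
    refine reach_final _ (fun p hp => ?_) 0
    rw [Finsupp.mem_support_iff] at hp
    refine ⟨dsum_support hEb hb hp, hp, ?_⟩
    rcases hall p with h | h
    · omega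
    · exact h.2
  exact (((((s1.trans s2).trans s3).trans s4).trans s5).trans s6).trans s7

end

/-! ### Codes of multisets and vectors -/

theorem sort_spec {α : Type*} (s : Multiset α) (r : α → α → Prop) (h1 : DecidableRel r)
    (h2 : IsTrans α r)
    (h3 : Std.Antisymm r) (h4 : Std.Total r) : (s.sort r : Multiset α) = s ∧
      (s.sort r).Pairwise r :=
  ⟨Multiset.sort_eq _ _, Multiset.pairwise_sort _ _⟩

section

open Encodable

variable {α β : Type*} [Encodable α] [Encodable β]

theorem exists_list_encode (s : Multiset α) :
    ∃ l : List α, (l : Multiset α) = s ∧ l.Pairwise (fun a b => encode a ≤ encode b) ∧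
      encode s = encode l := by
  have h : encode s = encodeMultiset s := rfl
  unfold encodeMultiset at h
  refine ⟨_, ?_, ?_, h⟩
  · exact (sort_spec _ _ _ _ _ _).1
  · exact (sort_spec _ _ _ _ _ _).2

theorem encode_list_congr {f : α → β} (hf : ∀ a, encode (f a) = encode a) (l : List α) :
    encode (l.map f) = encode l := by
  induction l with
  | nil => rfl
  | cons a l ih => rw [List.map_cons, encode_list_cons, encode_list_cons, ih, hf]

/-- The sorted list of the members of a list of numbers. -/
def sortN (l : List ℕ) : List ℕ :=
  (List.range (l.foldr (fun a b => max a b) 0 + 1)).filter fun x => x ∈ l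

theorem mem_sortN {l : List ℕ} {x : ℕ} : x ∈ sortN l ↔ x ∈ l := by
  have : x ∈ l → x ≤ l.foldr (fun a b => max a b) 0 := by
    intro h
    induction l with
    | nil => simp at h
    | cons a l ih =>
      rcases List.mem_cons.1 h with rfl | h
      · exact le_max_left _ _
      · exact (ih h).trans (le_max_right _ _)
  simp only [sortN, List.mem_filter, List.mem_range, decide_eq_true_eq]
  exact ⟨fun h => h.2, fun h => ⟨Nat.lt_succ_of_le (this h), h⟩⟩

theorem encode_multiset {s : Multiset α} (hs : s.Nodup) {l : List ℕ}
    (h : ∀ x, x ∈ l ↔ ∃ a ∈ s, encode a = x) : encode s = encode (sortN l) := by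
  obtain ⟨l', rfl, hp, he⟩ := exists_list_encode s
  rw [he, ← encode_list_congr (f := (encode : α → ℕ)) (fun _ => rfl)]
  congr 1
  rw [Multiset.coe_nodup] at hs
  refine List.Perm.eq_of_pairwise (le := (· ≤ ·)) (fun a b _ _ => le_antisymm)
    (List.pairwise_map.2 hp) (List.pairwise_le_range.filter _) ?_
  refine (List.perm_ext_iff_of_nodup (hs.map encode_injective) (List.nodup_range.filter _)).2 ?_
  intro x
  have := h x
  simp only [Multiset.mem_coe] at this
  rw [List.mem_map, ← this]
  exact mem_sortN.symm

/-- The code of a finitely supported function given by a list of keys and its values. -/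
def graphCode (ks : List ℕ) (f : ℕ → ℕ) : ℕ :=
  encode (sortN ((ks.filter fun p => f p ≠ 0).map fun p => Nat.pair p (f p)))

theorem encode_graph {M : Type*} [Zero M] [Encodable M] (h0 : encode (0 : M) = 0) (v : ℕ →₀ M)
    {ks : List ℕ} (hk : ∀ p, v p ≠ 0 → p ∈ ks) {f : ℕ → ℕ} (hf : ∀ p, f p = encode (v p)) :
    encode v.graph.val = graphCode ks f := by
  have hz : ∀ p, f p ≠ 0 ↔ v p ≠ 0 := by
    intro p
    rw [hf, ← h0, not_iff_not]
    exact encode_injective.eq_iff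
  refine encode_multiset v.graph.nodup fun x => ?_
  simp only [List.mem_map, List.mem_filter, decide_eq_true_eq, Finset.mem_val, hz]
  constructor
  · rintro ⟨p, ⟨-, hp⟩, rfl⟩
    refine ⟨(p, v p), Finsupp.mk_mem_graph v (by simpa using hp), ?_⟩
    rw [hf]
    rfl
  · rintro ⟨⟨p, c⟩, hp, rfl⟩
    obtain ⟨rfl, hc⟩ := Finsupp.mk_mem_graph_iff.1 hp
    refine ⟨p, ⟨hk p hc, hc⟩, ?_⟩
    rw [hf]
    rfl

/-- The code of a vector. -/
def codeVec (l : Raw) : ℕ := graphCode (l.map Prod.fst) (rval l)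

theorem encodeVec_vec (l : Raw) : encodeVec (vec l) = codeVec l :=
  encode_graph rfl (vec l) (fun _ h => mem_keys_of_vec_ne h) fun p => (vec_apply l p).symm

/-- The code of an integer given as a difference. -/
def zcode (a b : ℕ) : ℕ := if b ≤ a then 2 * (a - b) else 2 * (b - a - 1) + 1

theorem encode_natCast (n : ℕ) : encode (n : ℤ) = 2 * n := rfl

theorem encode_negSucc (n : ℕ) : encode (Int.negSucc n) = 2 * n + 1 := rfl

theorem zcode_eq (a b : ℕ) : zcode a b = encode ((a : ℤ) - b) := by
  unfold zcode
  split_ifs with h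
  · rw [← Nat.cast_sub h, encode_natCast]
  · have : (a : ℤ) - b = Int.negSucc (b - a - 1) := by
      rw [Int.negSucc_eq]
      omega
    rw [this, encode_negSucc]

/-- The difference of two vectors. -/
def zvec (d i : Raw) : ZVec := (vec i).mapRange (fun n : ℕ => (n : ℤ)) rfl -
  (vec d).mapRange (fun n : ℕ => (n : ℤ)) rfl

theorem zvec_apply (d i : Raw) (p : ℕ) : zvec d i p = (vec i p : ℤ) - vec d p := by
  simp [zvec]

/-- The code of a difference of two vectors. -/
def codeZ (d i : Raw) : ℕ :=
  graphCode (d.map Prod.fst ++ i.map Prod.fst) fun p => zcode (rval i p) (rval d p)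

theorem encodeZVec_zvec (d i : Raw) : encodeZVec (zvec d i) = codeZ d i := by
  refine encode_graph rfl (zvec d i) (fun p h => ?_) fun p => ?_
  · rw [zvec_apply] at h
    by_cases hd : vec d p = 0
    · refine List.mem_append_right _ (mem_keys_of_vec_ne fun hi => h ?_)
      rw [hd, hi, sub_self]
    · exact List.mem_append_left _ (mem_keys_of_vec_ne hd)
  · rw [zcode_eq, zvec_apply, vec_apply, vec_apply]

/-! ### Decoding of machines -/

/-- Decode a list. -/
def decL (α : Type) [Encodable α] (n : ℕ) : List α := (decode n).getD []

theorem decL_encode {α : Type} [Encodable α] (l : List α) : decL α (encode l) = l := by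
  simp [decL]

/-- Decode a vector. -/
def decVec (n : ℕ) : Raw := decL (ℕ × ℕ) n

theorem sum_graph {M N : Type*} [Zero M] [AddCommMonoid N] (v : ℕ →₀ M) (F : ℕ → M → N) :
    (v.graph.val.map fun x => F x.1 x.2).sum = v.sum F := by
  unfold Finsupp.graph Finsupp.sum Finset.sum
  rw [Finset.map_val, Multiset.map_map]
  rfl

theorem vec_decVec (v : Vec) : vec (decVec (encodeVec v)) = v := by
  obtain ⟨l, hl, -, he⟩ := exists_list_encode v.graph.val
  rw [encodeVec, he, decVec, decL_encode]
  conv_rhs => rw [← Finsupp.sum_single v, ← sum_graph, ← hl]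
  rfl

/-- The tokens removed by a vector with coded integer entries. -/
def negPart (l : Raw) : Raw := l.map fun x => (x.1, if x.2 % 2 = 1 then (x.2 + 1) / 2 else 0)

/-- The tokens added by a vector with coded integer entries. -/
def posPart (l : Raw) : Raw := l.map fun x => (x.1, if x.2 % 2 = 1 then 0 else x.2 / 2)

theorem sum_single_apply {M : Type*} [Zero M] (v : ℕ →₀ M) {f : M → ℕ} (hf : f 0 = 0) (p : ℕ) :
    v.sum (fun q c => Finsupp.single q (f c)) p = f (v p) := by
  rw [Finsupp.sum, Finsupp.finsetSum_apply]
  simp only [Finsupp.single_apply, Finset.sum_ite_eq']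
  split_ifs with h
  · rfl
  · rw [Finsupp.notMem_support_iff.1 h, hf]

theorem vec_map_decVec (v : ZVec) {g : ℕ → ℕ} {f : ℤ → ℕ} (hg : ∀ z : ℤ, g (encode z) = f z)
    (hf : f 0 = 0) (p : ℕ) :
    vec ((decVec (encodeZVec v)).map fun x => (x.1, g x.2)) p = f (v p) := by
  obtain ⟨l, hl, -, he⟩ := exists_list_encode v.graph.val
  have h1 : encode (l.map fun x => (x.1, encode x.2)) = encode l :=
    encode_list_congr (fun a => by rfl) l
  rw [encodeZVec, he, ← h1, decVec, decL_encode, ← sum_single_apply v hf, ← sum_graph, ← hl, vec]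
  simp [Function.comp_def, hg]

theorem vec_posPart (v : ZVec) (p : ℕ) :
    vec (posPart (decVec (encodeZVec v))) p = (v p).toNat := by
  refine vec_map_decVec v (g := fun c => if c % 2 = 1 then 0 else c / 2)
    (f := fun z => z.toNat) (fun z => ?_) rfl p
  rcases z with n | n
  · rw [Int.ofNat_eq_natCast, encode_natCast]
    simp
  · rw [encode_negSucc]
    simp [Nat.add_mod]

theorem vec_negPart (v : ZVec) (p : ℕ) :
    vec (negPart (decVec (encodeZVec v))) p = (-(v p)).toNat := by
  refine vec_map_decVec v (g := fun c => if c % 2 = 1 then (c + 1) / 2 else 0)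
    (f := fun z => (-z).toNat) (fun z => ?_) rfl p
  rcases z with n | n
  · rw [Int.ofNat_eq_natCast, encode_natCast]
    simp
  · rw [encode_negSucc, Int.neg_negSucc]
    simp [Nat.add_mod]
    omega

/-- Decode an operation into a list of raw operations. -/
def decOp (o : ℕ) : List ROp :=
  if o.unpair.1 = 0 then [.upd (negPart (decVec o.unpair.2)) (posPart (decVec o.unpair.2))]
  else if o.unpair.1 = 1 then
    (decL (ℕ × List ℕ) o.unpair.2.unpair.2).map fun x =>
      .infl o.unpair.2.unpair.1 (decVec x.1) (x.2.map decVec)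
  else if o.unpair.1 = 2 then
    [.defl o.unpair.2.unpair.1 o.unpair.2.unpair.2.unpair.1
      o.unpair.2.unpair.2.unpair.2.unpair.1 o.unpair.2.unpair.2.unpair.2.unpair.2]
  else [.brst o.unpair.2]

/-- The raw operation `ro` is a part of the operation. -/
def IsPart (ro : ROp) : VOp → Prop
  | .delta d => ∃ l i, ro = .upd l i ∧ ∀ p, vec i p = (d p).toNat ∧ vec l p = (-(d p)).toNat
  | .inflate s L => ∃ b vs, ro = .infl s b vs ∧ (vec b, vs.map vec) ∈ L
  | .deflate s s' pl p => ro = .defl s s' pl p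
  | .burst s => ro = .brst s

theorem decOp_inflate (s : ℕ) (L : SemilinRep) : decOp (encodeVOp (.inflate s L)) =
    L.map fun x => ROp.infl s (decVec (encodeVec x.1)) ((x.2.map encodeVec).map decVec) := by
  simp [decOp, encodeVOp, encodeSL, decL_encode, Function.comp_def]

theorem vec_decVec_list (vs : List Vec) : ((vs.map encodeVec).map decVec).map vec = vs := by
  simp [Function.comp_def, vec_decVec]

theorem isPart_of_mem {o : VOp} {ro : ROp} (h : ro ∈ decOp (encodeVOp o)) : IsPart ro o := by
  cases o with
  | delta d =>
    simp only [decOp, encodeVOp, Nat.unpair_pair, if_true, List.mem_singleton] at h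
    exact ⟨_, _, h, fun p => ⟨vec_posPart d p, vec_negPart d p⟩⟩
  | inflate s L =>
    rw [decOp_inflate] at h
    obtain ⟨x, hx, rfl⟩ := List.mem_map.1 h
    refine ⟨_, _, rfl, ?_⟩
    rw [vec_decVec_list, vec_decVec]
    exact hx
  | deflate s s' pl p =>
    simpa [decOp, encodeVOp, IsPart] using h
  | burst s =>
    simpa [decOp, encodeVOp, IsPart] using h

theorem opRel_iff (o : VOp) (m : Vec) (n : Multiset Balloon) (m' : Vec) (n' : Multiset Balloon) :
    OpRel o m n m' n' ↔ ∃ ro ∈ decOp (encodeVOp o), ROpRel ro m n m' n' := by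
  cases o with
  | delta d =>
    have h : ∀ p, (m' p : ℤ) = m p + d p ↔ m' p + vec (negPart (decVec (encodeZVec d))) p =
        m p + vec (posPart (decVec (encodeZVec d))) p := by
      intro p
      rw [vec_posPart, vec_negPart]
      omega
    simp only [decOp, encodeVOp, Nat.unpair_pair, if_true, List.mem_singleton, exists_eq_left,
      OpRel, ROpRel, DFunLike.ext_iff, Finsupp.add_apply, h]
  | inflate s L =>
    rw [decOp_inflate]
    simp only [List.mem_map, exists_exists_and_eq_and, ROpRel, OpRel]
    have hmem : ∀ k, memSL k L ↔ ∃ x ∈ L, ∃ y ∈ span ((x.2.map encodeVec).map decVec),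
        k = vec (decVec (encodeVec x.1)) + y := by
      intro k
      have h : ∀ x : Vec × List Vec, (∃ y ∈ span ((x.2.map encodeVec).map decVec),
          k = vec (decVec (encodeVec x.1)) + y) ↔ memSL k [x] := by
        intro x
        rw [← memSL_singleton, vec_decVec_list, vec_decVec]
      simp only [h]
      simp [memSL]
    constructor
    · rintro ⟨rfl, k, hk, rfl⟩
      obtain ⟨x, hx, y, hy, rfl⟩ := (hmem k).1 hk
      exact ⟨x, hx, rfl, y, hy, rfl⟩
    · rintro ⟨x, hx, rfl, y, hy, rfl⟩
      exact ⟨rfl, _, (hmem _).2 ⟨x, hx, y, hy, rfl⟩, rfl⟩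
  | deflate s s' pl p => simp [decOp, encodeVOp, OpRel, ROpRel]
  | burst s => simp [decOp, encodeVOp, OpRel, ROpRel]

end

/-! ### From a VASSB to a raw machine -/

/-- The raw edges described by a list of edge codes. -/
def decE (l : List (ℕ × ℕ × ℕ)) : List REdge :=
  l.flatMap fun x => (decOp x.2.1).map fun ro => (x.1, ro, x.2.2)

theorem mem_decE {V : VASSB} {l : List (ℕ × ℕ × ℕ)}
    (hl : (l : Multiset (ℕ × ℕ × ℕ)) = V.edges.val.map fun e => (e.1, encodeVOp e.2.1, e.2.2))
    {e' : REdge} : e' ∈ decE l ↔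
      ∃ e ∈ V.edges, ∃ ro ∈ decOp (encodeVOp e.2.1), e' = (e.1, ro, e.2.2) := by
  have h : ∀ x, x ∈ l ↔ ∃ e ∈ V.edges, (e.1, encodeVOp e.2.1, e.2.2) = x := by
    intro x
    rw [← Multiset.mem_coe, hl, Multiset.mem_map]
    rfl
  simp only [decE, List.mem_flatMap, h, List.mem_map]
  constructor
  · rintro ⟨_, ⟨e, he, rfl⟩, ro, hro, rfl⟩
    exact ⟨e, he, ro, hro, rfl⟩
  · rintro ⟨e, he, ro, hro, rfl⟩
    exact ⟨_, ⟨e, he, rfl⟩, ro, hro, rfl⟩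

theorem rTouch_of_touches {e : VEdge} {ro : ROp} (hp : IsPart ro e.2.1) {c c' : VConfig}
    (h : ROpRel ro c.m c.bag c'.m c'.bag) {b : Balloon} (ht : Touches e c c' b) :
    RTouch ro c c' b := by
  obtain ⟨s, k⟩ := b
  rcases ht with ⟨s', pl, p, ho, n0, hn, hn'⟩ | ⟨ho, n0, hn, hn'⟩
  · rw [ho] at hp
    obtain rfl := hp
    obtain ⟨k1, n1, h1, hm, h2⟩ := h
    refine ⟨rfl, n0, hn, ?_, hn'⟩
    suffices hk : k1 pl = k pl by rw [hm, hk]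
    rw [hn] at h1
    rw [hn'] at h2
    have h3 : ({(s, k)} : Multiset Balloon) + {(s', Finsupp.erase pl k1)} =
        {(s, k1)} + {(s', Finsupp.erase pl k)} := by
      refine add_left_cancel (a := n0 + n1) ?_
      calc n0 + n1 + ({(s, k)} + {(s', Finsupp.erase pl k1)})
          = (n0 + {(s, k)}) + (n1 + {(s', Finsupp.erase pl k1)}) := by abel
        _ = (n1 + {(s, k1)}) + (n0 + {(s', Finsupp.erase pl k)}) := by rw [h1, h2]
        _ = _ := by abel
    have hk : ((s, k) : Balloon) ∈ ({(s, k1)} + {(s', Finsupp.erase pl k)} : Multiset Balloon) := by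
      rw [← h3]
      simp
    have hk1 : ((s, k1) : Balloon) ∈
        ({(s, k)} + {(s', Finsupp.erase pl k1)} : Multiset Balloon) := by
      rw [h3]
      simp
    simp only [Multiset.mem_add, Multiset.mem_singleton, Prod.mk.injEq] at hk hk1
    rcases hk with ⟨-, rfl⟩ | ⟨-, hk⟩
    · rfl
    rcases hk1 with ⟨-, rfl⟩ | ⟨-, hk1⟩
    · rfl
    rw [hk, hk1]
    simp
  · rw [ho] at hp
    obtain rfl := hp
    exact ⟨rfl, h.1, n0, hn, hn'⟩

theorem touches_of_rTouch {e : VEdge} {ro : ROp} (hp : IsPart ro e.2.1) {c c' : VConfig}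
    {b : Balloon} (ht : RTouch ro c c' b) : Touches e c c' b := by
  obtain ⟨q, o, q'⟩ := e
  cases o with
  | delta d =>
    obtain ⟨l, i, rfl, -⟩ := hp
    exact ht.elim
  | inflate s L =>
    obtain ⟨l, i, rfl, -⟩ := hp
    exact ht.elim
  | deflate s s' pl p =>
    obtain rfl := hp
    obtain ⟨rfl, n0, h1, -, h2⟩ := ht
    exact Or.inl ⟨s', pl, p, rfl, n0, h1, h2⟩
  | burst s =>
    obtain rfl := hp
    obtain ⟨rfl, -, n0, h1, h2⟩ := ht
    exact Or.inr ⟨rfl, n0, h1, h2⟩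

theorem dec_ne_iff {o : VOp} {ro : ROp} (hp : IsPart ro o) (p : ℕ) :
    dec ro p ≠ 0 ↔ ∃ d : ZVec, o = VOp.delta d ∧ d p < 0 := by
  cases o with
  | delta d =>
    obtain ⟨l, i, rfl, h⟩ := hp
    have := (h p).2
    simp only [dec, VOp.delta.injEq, exists_eq_left', this]
    omega
  | inflate s L =>
    obtain ⟨l, i, rfl, -⟩ := hp
    simp [dec]
  | deflate s s' pl p =>
    obtain rfl := hp
    simp [dec]
  | burst s =>
    obtain rfl := hp
    simp [dec]

theorem hasProgRunV_iff {V : VASSB} {s : VConfig} {l : List (ℕ × ℕ × ℕ)}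
    (hl : (l : Multiset (ℕ × ℕ × ℕ)) = V.edges.val.map fun e => (e.1, encodeVOp e.2.1, e.2.2)) :
    HasProgRunV V s ↔ RProg (decE l) s := by
  constructor
  · rintro ⟨rho, es, ⟨h0, hrun⟩, hb, hm⟩
    have h : ∀ i, ∃ ro ∈ decOp (encodeVOp (es i).2.1),
        ROpRel ro (rho i).m (rho i).bag (rho (i + 1)).m (rho (i + 1)).bag :=
      fun i => (opRel_iff _ _ _ _ _).1 (hrun i).2.2.2
    choose ro hro hrel using h
    refine ⟨rho, fun i => ((es i).1, ro i, (es i).2.2), h0, fun i => ⟨?_, ?_⟩, ?_, ?_⟩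
    · exact (mem_decE hl).2 ⟨es i, (hrun i).1, ro i, hro i, rfl⟩
    · exact ⟨(hrun i).2.1, (hrun i).2.2.1, hrel i⟩
    · intro k b hbk
      obtain ⟨j, hj, ht⟩ := hb k b hbk
      exact ⟨j, hj, rTouch_of_touches (isPart_of_mem (hro j)) (hrel j) ht⟩
    · intro k p hp
      obtain ⟨j, hj, hd⟩ := hm k p hp
      exact ⟨j, hj, (dec_ne_iff (isPart_of_mem (hro j)) p).2 hd⟩
  · rintro ⟨rho, es, h0, hrun, hb, hm⟩
    have h : ∀ i, ∃ e ∈ V.edges, ∃ ro ∈ decOp (encodeVOp e.2.1), es i = (e.1, ro, e.2.2) :=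
      fun i => (mem_decE hl).1 (hrun i).1
    choose e he ro hro heq using h
    have hpart : ∀ i, IsPart (es i).2.1 (e i).2.1 := by
      intro i
      rw [heq i]
      exact isPart_of_mem (hro i)
    refine ⟨rho, e, ⟨h0, fun i => ⟨he i, ?_⟩⟩, ?_, ?_⟩
    · have := (hrun i).2
      rw [heq i] at this
      exact ⟨this.1, this.2.1, (opRel_iff _ _ _ _ _).2 ⟨ro i, hro i, this.2.2⟩⟩
    · intro k b hbk
      obtain ⟨j, hj, ht⟩ := hb k b hbk
      exact ⟨j, hj, touches_of_rTouch (hpart j) ht⟩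
    · intro k p hp
      obtain ⟨j, hj, hd⟩ := hm k p hp
      exact ⟨j, hj, (dec_ne_iff (hpart j) p).1 hd⟩

/-! ### From a raw machine to a VASSB -/

/-- The operation denoted by a raw operation. -/
def realOp : ROp → VOp
  | .inl (d, i) => .delta (zvec d i)
  | .inr (.inl (s, b, vs)) => .inflate s [(vec b, vs.map vec)]
  | .inr (.inr (.inl (s, s', pl, p))) => .deflate s s' pl p
  | .inr (.inr (.inr s)) => .burst s

/-- The edge denoted by a raw edge. -/
def realE (e : REdge) : VEdge := (e.1, realOp e.2.1, e.2.2)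

theorem opRel_realOp (ro : ROp) (m : Vec) (n : Multiset Balloon) (m' : Vec)
    (n' : Multiset Balloon) : OpRel (realOp ro) m n m' n' ↔ ROpRel ro m n m' n' := by
  rcases ro with ⟨d, i⟩ | ⟨s, b, vs⟩ | ⟨s, s', pl, p⟩ | s
  · have h : ∀ p, (m' p : ℤ) = m p + zvec d i p ↔ m' p + vec d p = m p + vec i p := by
      intro p
      rw [zvec_apply]
      omega
    simp only [realOp, OpRel, ROpRel, h, DFunLike.ext_iff, Finsupp.add_apply]
  · simp only [realOp, OpRel, ROpRel, memSL_singleton]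
    constructor
    · rintro ⟨rfl, _, ⟨y, hy, rfl⟩, rfl⟩
      exact ⟨rfl, y, hy, rfl⟩
    · rintro ⟨rfl, y, hy, rfl⟩
      exact ⟨rfl, _, ⟨y, hy, rfl⟩, rfl⟩
  · rfl
  · rfl

open Classical in
/-- The VASSB with the given raw edges. -/
def realV (E : List REdge) : VASSB where
  states := ∅
  places := ∅
  bstates := ∅
  bplaces := ∅
  edges := (E.map realE).toFinset

theorem mem_realV {E : List REdge} {e : VEdge} :
    e ∈ (realV E).edges ↔ ∃ e' ∈ E, realE e' = e := by
  simp [realV]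

theorem vReach_realV (E : List REdge) : VReach (realV E) = RReach E := by
  have : VStep (realV E) = RStep E := by
    funext c c'
    simp only [VStep, RStep, mem_realV, exists_exists_and_eq_and, EdgeRel, RRel, realE,
      opRel_realOp]
  rw [VReach, RReach, this]

theorem encodeVec_injective : Function.Injective encodeVec := fun _ _ h =>
  Finsupp.graph_injective _ _ (Finset.val_injective (Encodable.encode_injective h))

theorem encodeZVec_injective : Function.Injective encodeZVec := fun _ _ h =>
  Finsupp.graph_injective _ _ (Finset.val_injective (Encodable.encode_injective h))

theorem encodeSL_injective : Function.Injective encodeSL := by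
  intro L L' h
  refine List.map_injective_iff.2 ?_ (Encodable.encode_injective h)
  rintro ⟨b, vs⟩ ⟨b', vs'⟩ h
  obtain ⟨h1, h2⟩ := Prod.mk.inj h
  exact Prod.ext (encodeVec_injective h1) (List.map_injective_iff.2 encodeVec_injective h2)

theorem encodeVOp_injective : Function.Injective encodeVOp := by
  intro o o' h
  cases o <;> cases o' <;>
    simp only [encodeVOp, Nat.pair_eq_pair, Encodable.encode_inj, Prod.mk.injEq] at h <;>
    first
    | exact absurd h.1 (by decide)
    | skip
  · rw [encodeZVec_injective h.2]
  · rw [h.2.1, encodeSL_injective h.2.2]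
  · obtain ⟨-, rfl, rfl, rfl, rfl⟩ := h
    rfl
  · rw [h.2]

/-- The code of a raw operation. -/
def codeOp : ROp → ℕ
  | .inl (d, i) => Nat.pair 0 (codeZ d i)
  | .inr (.inl (s, b, vs)) =>
      Nat.pair 1 (Nat.pair s (Encodable.encode [(codeVec b, vs.map codeVec)]))
  | .inr (.inr (.inl x)) => Nat.pair 2 (Encodable.encode x)
  | .inr (.inr (.inr s)) => Nat.pair 3 s

theorem encodeVOp_realOp (ro : ROp) : encodeVOp (realOp ro) = codeOp ro := by
  rcases ro with ⟨d, i⟩ | ⟨s, b, vs⟩ | ⟨s, s', pl, p⟩ | s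
  · simp only [realOp, encodeVOp, encodeZVec_zvec, codeOp]
  · simp only [realOp, encodeVOp, codeOp, encodeSL, List.map_cons, List.map_nil, encodeVec_vec,
      List.map_map, Function.comp_def]
  · rfl
  · rfl

/-- The code of a raw edge. -/
def codeE (e : REdge) : ℕ := Nat.pair e.1 (Nat.pair (codeOp e.2.1) e.2.2)

/-- The code of the VASSB with the given raw edges. -/
def codeM (E : List REdge) : ℕ :=
  Nat.pair 0 (Nat.pair 0 (Nat.pair 0 (Nat.pair 0 (Encodable.encode (sortN (E.map codeE))))))

theorem encode_multiset_zero {α : Type*} [Encodable α] :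
    Encodable.encode (0 : Multiset α) = 0 :=
  encode_multiset (l := []) Multiset.nodup_zero (by simp)

theorem encodeVASSB_realV (E : List REdge) : encodeVASSB (realV E) = codeM E := by
  have hinj : Function.Injective fun e : VEdge => (e.1, encodeVOp e.2.1, e.2.2) := by
    rintro ⟨q, o, q'⟩ ⟨r, o', r'⟩ h
    simp only [Prod.mk.injEq, encodeVOp_injective.eq_iff] at h ⊢
    exact h
  have h := encode_multiset (s := (realV E).edges.val.map fun e => (e.1, encodeVOp e.2.1, e.2.2))
    ((realV E).edges.nodup.map hinj) (l := E.map codeE) (by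
      intro x
      simp only [List.mem_map, Multiset.mem_map, Finset.mem_val, mem_realV,
        exists_exists_and_eq_and, realE, encodeVOp_realOp]
      rfl)
  rw [codeM, ← h, ← encode_multiset_zero (α := ℕ)]
  rfl

/-- The code of a semiconfiguration. -/
def codeC (q : ℕ) (l : Raw) : ℕ := Nat.pair q (Nat.pair (codeVec l) 0)

theorem encodeVConfig_vec (q : ℕ) (l : Raw) : encodeVConfig ⟨q, vec l, 0⟩ = codeC q l := by
  rw [codeC, ← encodeVec_vec]
  exact congrArg (fun x => Nat.pair q (Nat.pair (encodeVec (vec l)) x))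
    (encode_multiset_zero (α := ℕ))

/-! ### The reduction -/

/-- The raw edges of the machine constructed from the raw edges `E` and the raw marking `m`. -/
def outE (E : List REdge) (m : Raw) : List REdge :=
  lassoE (edgesA E) (edgesB E) (statesG E)
    ((renP m).map Prod.fst ++ (edgesA E ++ edgesB E).flatMap fun e => opPl e.2.1)

theorem rProg_iff_reach (E : List REdge) (q : ℕ) (m : Raw) : RProg E ⟨q, vec m, 0⟩ ↔
    RReach (outE E m) ⟨pc 1 (st [] q), vec (tagR 0 (renP m)), 0⟩ ⟨pc 5 0, vec [], 0⟩ := by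
  rw [rProg_iff_wit rfl, vec_tagR, vec_renP]
  refine ⟨reach_of_wit ?_ ?_ ?_, wit_of_reach⟩
  · intro p hp
    rw [← vec_renP] at hp
    exact List.mem_append_left _ (mem_keys_of_vec_ne hp)
  · exact fun e he p hp => List.mem_append_right _
      (List.mem_flatMap.2 ⟨e, List.mem_append_left _ he, hp⟩)
  · exact fun e he p hp => List.mem_append_right _
      (List.mem_flatMap.2 ⟨e, List.mem_append_right _ he, hp⟩)

/-- The code of the instance constructed from the raw edges `E`, the state `q` and the raw
marking `m`. -/
def codeOut (E : List REdge) (q : ℕ) (m : Raw) : ℕ :=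
  Nat.pair (codeM (outE E m))
    (Nat.pair (codeC (pc 1 (st [] q)) (tagR 0 (renP m))) (codeC (pc 5 0) []))

/-- The reduction on codes. -/
def reduction (n : ℕ) : ℕ :=
  codeOut (decE (decL (ℕ × ℕ × ℕ) n.unpair.1.unpair.2.unpair.2.unpair.2.unpair.2))
    n.unpair.2.unpair.1 (decVec n.unpair.2.unpair.2.unpair.1)

theorem reduction_spec (V : VASSB) (s : VConfig) (hs : IsSemi s) :
    ∃ (V' : VASSB) (s1' s2' : VConfig), IsSemi s1' ∧ IsSemi s2' ∧
      reduction (Nat.pair (encodeVASSB V) (encodeVConfig s)) =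
        Nat.pair (encodeVASSB V') (Nat.pair (encodeVConfig s1') (encodeVConfig s2')) ∧
      (HasProgRunV V s ↔ VReach V' s1' s2') := by
  obtain ⟨q, m, n⟩ := s
  obtain rfl : n = 0 := hs
  obtain ⟨l, hl, -, he⟩ := exists_list_encode
    (V.edges.val.map fun e => (e.1, encodeVOp e.2.1, e.2.2))
  have hV : (encodeVASSB V).unpair.2.unpair.2.unpair.2.unpair.2 = Encodable.encode l := by
    simp only [encodeVASSB, Encodable.encode_prod_val, Nat.unpair_pair, he]
  have hs : reduction (Nat.pair (encodeVASSB V) (encodeVConfig ⟨q, m, 0⟩)) =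
      codeOut (decE l) q (decVec (encodeVec m)) := by
    simp only [reduction, Nat.unpair_pair, hV, decL_encode, encodeVConfig,
      Encodable.encode_prod_val, Encodable.encode_nat]
  refine ⟨realV (outE (decE l) (decVec (encodeVec m))),
    ⟨pc 1 (st [] q), vec (tagR 0 (renP (decVec (encodeVec m)))), 0⟩, ⟨pc 5 0, vec [], 0⟩,
    rfl, rfl, ?_, ?_⟩
  · rw [hs, codeOut, encodeVASSB_realV, encodeVConfig_vec, encodeVConfig_vec]
  · rw [hasProgRunV_iff hl, vReach_realV, ← rProg_iff_reach, vec_decVec]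

/-! ### Primitive recursiveness -/

attribute [fun_prop] Primrec Primrec.id Primrec.const

section

variable {α β γ σ : Type} [Primcodable α] [Primcodable β] [Primcodable γ] [Primcodable σ]

@[fun_prop] theorem primrec_comp {f : β → σ} {g : α → β} (hf : Primrec f) (hg : Primrec g) :
    Primrec fun a => f (g a) := hf.comp hg

@[fun_prop] theorem primrec_fst {f : α → β × γ} (hf : Primrec f) : Primrec fun a => (f a).1 :=
  Primrec.fst.comp hf

@[fun_prop] theorem primrec_snd {f : α → β × γ} (hf : Primrec f) : Primrec fun a => (f a).2 :=
  Primrec.snd.comp hf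

@[fun_prop] theorem primrec_mk {f : α → β} {g : α → γ} (hf : Primrec f) (hg : Primrec g) :
    Primrec fun a => (f a, g a) := Primrec.pair hf hg

@[fun_prop] theorem primrec_append {f g : α → List β} (hf : Primrec f) (hg : Primrec g) :
    Primrec fun a => f a ++ g a := Primrec.list_append.comp hf hg

@[fun_prop] theorem primrec_cons {f : α → β} {g : α → List β} (hf : Primrec f)
    (hg : Primrec g) : Primrec fun a => f a :: g a := Primrec.list_cons.comp hf hg

@[fun_prop] theorem primrec_map {f : α → List β} {g : α → β → γ} (hf : Primrec f)
    (hg : Primrec fun p : α × β => g p.1 p.2) : Primrec fun a => (f a).map (g a) :=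
  Primrec.list_map hf hg

@[fun_prop] theorem primrec_flatMap {f : α → List β} {g : α → β → List γ} (hf : Primrec f)
    (hg : Primrec fun p : α × β => g p.1 p.2) : Primrec fun a => (f a).flatMap (g a) :=
  Primrec.list_flatMap hf hg

@[fun_prop] theorem primrec_foldr {f : α → List β} {g : α → σ} {h : α → β → σ → σ}
    (hf : Primrec f) (hg : Primrec g) (hh : Primrec fun p : α × β × σ => h p.1 p.2.1 p.2.2) :
    Primrec fun a => (f a).foldr (h a) (g a) :=
  Primrec.list_foldr (h := fun a x => h a x.1 x.2) hf hg hh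

@[fun_prop] theorem primrec_range {f : α → ℕ} (hf : Primrec f) :
    Primrec fun a => List.range (f a) := Primrec.list_range.comp hf

@[fun_prop] theorem primrec_cond {c : α → Bool} {f g : α → β} (hc : Primrec c) (hf : Primrec f)
    (hg : Primrec g) : Primrec fun a => bif c a then f a else g a := Primrec.cond hc hf hg

@[fun_prop] theorem primrec_filter {f : α → List β} {c : α → β → Bool} (hf : Primrec f)
    (hc : Primrec fun p : α × β => c p.1 p.2) : Primrec fun a => (f a).filter (c a) := by
  have h : Primrec fun a => (f a).filterMap fun x => bif c a x then some x else none :=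
    Primrec.listFilterMap hf
      (Primrec₂.mk (Primrec.cond hc (Primrec.option_some.comp Primrec.snd) (Primrec.const none)))
  refine h.of_eq fun a => ?_
  induction f a with
  | nil => rfl
  | cons x l ih =>
    rw [List.filterMap_cons, List.filter_cons, ih]
    cases c a x <;> rfl

@[fun_prop] theorem primrec_inl {f : α → β} (hf : Primrec f) :
    Primrec fun a => (Sum.inl (f a) : β ⊕ γ) := Primrec.sumInl.comp hf

@[fun_prop] theorem primrec_inr {f : α → γ} (hf : Primrec f) :
    Primrec fun a => (Sum.inr (f a) : β ⊕ γ) := Primrec.sumInr.comp hf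

@[fun_prop] theorem primrec_elim {f : α → β ⊕ γ} {g : α → β → σ} {h : α → γ → σ}
    (hf : Primrec f) (hg : Primrec fun p : α × β => g p.1 p.2)
    (hh : Primrec fun p : α × γ => h p.1 p.2) : Primrec fun a => Sum.elim (g a) (h a) (f a) :=
  (Primrec.sumCasesOn hf (Primrec₂.mk hg) (Primrec₂.mk hh)).of_eq fun a => by
    cases f a <;> rfl

@[fun_prop] theorem primrec_natPair {f g : α → ℕ} (hf : Primrec f) (hg : Primrec g) :
    Primrec fun a => Nat.pair (f a) (g a) := Primrec₂.natPair.comp hf hg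

@[fun_prop] theorem primrec_unpair {f : α → ℕ} (hf : Primrec f) :
    Primrec fun a => (f a).unpair := Primrec.unpair.comp hf

@[fun_prop] theorem primrec_encode {f : α → β} (hf : Primrec f) :
    Primrec fun a => Encodable.encode (f a) := Primrec.encode.comp hf

@[fun_prop] theorem primrec_add {f g : α → ℕ} (hf : Primrec f) (hg : Primrec g) :
    Primrec fun a => f a + g a := Primrec.nat_add.comp hf hg

@[fun_prop] theorem primrec_sub {f g : α → ℕ} (hf : Primrec f) (hg : Primrec g) :
    Primrec fun a => f a - g a := Primrec.nat_sub.comp hf hg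

@[fun_prop] theorem primrec_mul {f g : α → ℕ} (hf : Primrec f) (hg : Primrec g) :
    Primrec fun a => f a * g a := Primrec.nat_mul.comp hf hg

@[fun_prop] theorem primrec_div {f g : α → ℕ} (hf : Primrec f) (hg : Primrec g) :
    Primrec fun a => f a / g a := Primrec.nat_div.comp hf hg

@[fun_prop] theorem primrec_mod {f g : α → ℕ} (hf : Primrec f) (hg : Primrec g) :
    Primrec fun a => f a % g a := Primrec.nat_mod.comp hf hg

@[fun_prop] theorem primrec_max {f g : α → ℕ} (hf : Primrec f) (hg : Primrec g) :
    Primrec fun a => max (f a) (g a) := Primrec.nat_max.comp hf hg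

@[fun_prop] theorem primrec_not {f : α → Bool} (hf : Primrec f) :
    Primrec fun a => !(f a) := Primrec.not.comp hf

@[fun_prop] theorem primrec_decide_eq {f g : α → ℕ} (hf : Primrec f) (hg : Primrec g) :
    Primrec fun a => decide (f a = g a) := (Primrec.eq.comp hf hg).decide

@[fun_prop] theorem primrec_decide_ne {f g : α → ℕ} (hf : Primrec f) (hg : Primrec g) :
    Primrec fun a => decide (f a ≠ g a) := (Primrec.eq.comp hf hg).not.decide

@[fun_prop] theorem primrec_ite_eq {f g : α → ℕ} {h k : α → β} (hf : Primrec f) (hg : Primrec g)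
    (hh : Primrec h) (hk : Primrec k) : Primrec fun a => if f a = g a then h a else k a :=
  Primrec.ite (Primrec.eq.comp hf hg) hh hk

@[fun_prop] theorem primrec_ite_le {f g : α → ℕ} {h k : α → β} (hf : Primrec f) (hg : Primrec g)
    (hh : Primrec h) (hk : Primrec k) : Primrec fun a => if f a ≤ g a then h a else k a :=
  Primrec.ite (Primrec.nat_le.comp hf hg) hh hk

@[fun_prop] theorem primrec_decide_mem {f : α → ℕ} {g : α → List ℕ} (hf : Primrec f)
    (hg : Primrec g) : Primrec fun a => decide (f a ∈ g a) := by
  have h : PrimrecPred fun a => ∃ x ∈ g a, x = f a :=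
    (PrimrecRel.exists_mem_list (R := fun x y : ℕ => x = y) Primrec.eq).comp hg hf
  exact h.decide.of_eq fun a => by simp

@[fun_prop] theorem primrec_decL {f : α → ℕ} (hf : Primrec f) :
    Primrec fun a => decL β (f a) :=
  Primrec.option_getD.comp (Primrec.decode.comp hf) (Primrec.const [])

@[fun_prop] theorem primrec_sum {f : α → List ℕ} (hf : Primrec f) :
    Primrec fun a => (f a).sum := by
  simp only [List.sum_eq_foldr]
  fun_prop

@[fun_prop] theorem primrec_sortN {f : α → List ℕ} (hf : Primrec f) :
    Primrec fun a => sortN (f a) := by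
  unfold sortN
  fun_prop

@[fun_prop] theorem primrec_rval {f : α → Raw} {g : α → ℕ} (hf : Primrec f) (hg : Primrec g) :
    Primrec fun a => rval (f a) (g a) := by
  unfold rval
  fun_prop

@[fun_prop] theorem primrec_er {f : α → ℕ} {g : α → Raw} (hf : Primrec f) (hg : Primrec g) :
    Primrec fun a => er (f a) (g a) := by
  unfold er
  fun_prop

@[fun_prop] theorem primrec_clos {f : α → List ℕ} {g : α → List Raw} (hf : Primrec f)
    (hg : Primrec g) : Primrec fun a => clos (f a) (g a) := by
  unfold clos
  fun_prop

theorem births_eq (b : Raw) (vs : List Raw) : births b vs =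
    vs.foldr (fun v acc => acc ++ acc.map fun x => (v ++ x.1, v :: x.2)) [(b, [])] := by
  induction vs with
  | nil => rfl
  | cons v vs ih => rw [births, ih, List.foldr_cons]

@[fun_prop] theorem primrec_births {f : α → Raw} {g : α → List Raw} (hf : Primrec f)
    (hg : Primrec g) : Primrec fun a => births (f a) (g a) := by
  simp only [births_eq]
  fun_prop

@[fun_prop] theorem primrec_st {f : α → Raw} {g : α → ℕ} (hf : Primrec f) (hg : Primrec g) :
    Primrec fun a => st (f a) (g a) :=
  primrec_encode (primrec_mk hf hg)

@[fun_prop] theorem primrec_bs {f : α → ℕ} {g : α → Raw} (hf : Primrec f) (hg : Primrec g) :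
    Primrec fun a => bs (f a) (g a) :=
  primrec_encode (primrec_mk hf hg)

@[fun_prop] theorem primrec_pT {f : α → ℕ} {g : α → Raw} (hf : Primrec f) (hg : Primrec g) :
    Primrec fun a => pT (f a) (g a) := by
  have h : Primrec fun a => 2 * bs (f a) (g a) + 1 := by fun_prop
  exact h

@[fun_prop] theorem primrec_renP {f : α → Raw} (hf : Primrec f) :
    Primrec fun a => renP (f a) := by
  unfold renP
  fun_prop

@[fun_prop] theorem primrec_births0 {f : α → REdge} (hf : Primrec f) :
    Primrec fun a => births0 (f a) := by
  have h : ∀ e : REdge, births0 e = Sum.elim (fun _ => [])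
      (fun o => Sum.elim (fun x => (births x.2.1 x.2.2).map fun y => y.1) (fun _ => []) o)
      e.2.1 := by
    rintro ⟨q, ⟨d, i⟩ | ⟨s, b, vs⟩ | ⟨s, s', pl, p⟩ | s, q'⟩ <;> rfl
  simp only [h]
  fun_prop

@[fun_prop] theorem primrec_deflPl {f : α → REdge} (hf : Primrec f) :
    Primrec fun a => deflPl (f a) := by
  have h : ∀ e : REdge, deflPl e = Sum.elim (fun _ => [])
      (fun o => Sum.elim (fun _ => []) (fun o => Sum.elim (fun x => [x.2.2.1]) (fun _ => []) o) o)
      e.2.1 := by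
    rintro ⟨q, ⟨d, i⟩ | ⟨s, b, vs⟩ | ⟨s, s', pl, p⟩ | s, q'⟩ <;> rfl
  simp only [h]
  fun_prop

@[fun_prop] theorem primrec_bstOf {f : α → REdge} (hf : Primrec f) :
    Primrec fun a => bstOf (f a) := by
  have h : ∀ e : REdge, bstOf e = Sum.elim (fun _ => [])
      (fun o => Sum.elim (fun x => [x.1])
        (fun o => Sum.elim (fun x => [x.2.1]) (fun _ => []) o) o)
      e.2.1 := by
    rintro ⟨q, ⟨d, i⟩ | ⟨s, b, vs⟩ | ⟨s, s', pl, p⟩ | s, q'⟩ <;> rfl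
  simp only [h]
  fun_prop

@[fun_prop] theorem primrec_rawsOf {f : α → List REdge} (hf : Primrec f) :
    Primrec fun a => rawsOf (f a) := by
  unfold rawsOf
  fun_prop

@[fun_prop] theorem primrec_pendD {f g h : α → ℕ} {k : α → Raw} (hf : Primrec f)
    (hg : Primrec g) (hh : Primrec h) (hk : Primrec k) :
    Primrec fun a => pendD (f a) (g a) (h a) (k a) := by
  unfold pendD
  fun_prop

@[fun_prop] theorem primrec_honestE {f : α → List Raw} {g : α → REdge} (hf : Primrec f)
    (hg : Primrec g) : Primrec fun a => honestE (f a) (g a) := by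
  have h : ∀ (R : List Raw) (e : REdge), honestE R e = Sum.elim
      (fun x => [(st [] e.1, Sum.inl (renP x.1, renP x.2), st [] e.2.2)])
      (fun o => Sum.elim
        (fun x => (births x.2.1 x.2.2).map fun y =>
          (st [] e.1, Sum.inr (Sum.inl (bs x.1 y.1, y.1, y.2)), st [] e.2.2))
        (fun o => Sum.elim
          (fun x => R.map fun r => (st [] e.1, Sum.inr (Sum.inr (Sum.inl
            (bs x.1 r, bs x.2.1 (er x.2.2.1 r), x.2.2.1, 2 * x.2.2.2))), st [] e.2.2))
          (fun s => R.map fun r => (st [] e.1, Sum.inl ([(pT s r, 1)], []), st [] e.2.2)) o) o)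
      e.2.1 := by
    rintro R ⟨q, ⟨d, i⟩ | ⟨s, b, vs⟩ | ⟨s, s', pl, p⟩ | s, q'⟩ <;> rfl
  simp only [h]
  fun_prop

@[fun_prop] theorem primrec_counterE {f : α → List Raw} {g : α → REdge} (hf : Primrec f)
    (hg : Primrec g) : Primrec fun a => counterE (f a) (g a) := by
  have h : ∀ (R : List Raw) (e : REdge), counterE R e = Sum.elim (fun _ => [])
      (fun o => Sum.elim (fun _ => [])
        (fun o => Sum.elim
          (fun x => R.flatMap fun r =>
            [(st [] e.1, Sum.inl ([(pT x.1 r, 1)], []),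
              st (pendD x.2.1 x.2.2.1 x.2.2.2 r) e.2.2),
            (st (pendD x.2.1 x.2.2.1 x.2.2.2 r) e.2.2,
              Sum.inl ([], pendD x.2.1 x.2.2.1 x.2.2.2 r), st [] e.2.2)])
          (fun _ => []) o) o)
      e.2.1 := by
    rintro R ⟨q, ⟨d, i⟩ | ⟨s, b, vs⟩ | ⟨s, s', pl, p⟩ | s, q'⟩ <;> rfl
  simp only [h]
  fun_prop

@[fun_prop] theorem primrec_convE {f : α → List ℕ} {g : α → List Raw} {h : α → ℕ}
    (hf : Primrec f) (hg : Primrec g) (hh : Primrec h) :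
    Primrec fun a => convE (f a) (g a) (h a) := by
  unfold convE ROp.upd ROp.brst
  fun_prop

@[fun_prop] theorem primrec_edgesA {f : α → List REdge} (hf : Primrec f) :
    Primrec fun a => edgesA (f a) := by
  unfold edgesA
  fun_prop

@[fun_prop] theorem primrec_edgesB {f : α → List REdge} (hf : Primrec f) :
    Primrec fun a => edgesB (f a) := by
  unfold edgesB
  fun_prop

@[fun_prop] theorem primrec_statesG {f : α → List REdge} (hf : Primrec f) :
    Primrec fun a => statesG (f a) := by
  unfold statesG
  fun_prop

@[fun_prop] theorem primrec_tagR {f : α → ℕ} {g : α → Raw} (hf : Primrec f) (hg : Primrec g) :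
    Primrec fun a => tagR (f a) (g a) := by
  unfold tagR pc
  fun_prop

@[fun_prop] theorem primrec_tagOp {f : α → ℕ} {c : α → Bool} {g : α → ROp} (hf : Primrec f)
    (hc : Primrec c) (hg : Primrec g) : Primrec fun a => tagOp (f a) (c a) (g a) := by
  have h : ∀ (t : ℕ) (flag : Bool) (op : ROp), tagOp t flag op = Sum.elim
      (fun x => Sum.inl (tagR t x.1, tagR t x.2 ++ bif flag then tagR 3 x.1 else []))
      (fun o => Sum.elim (fun x => Sum.inr (Sum.inl (Nat.pair t x.1, x.2)))
        (fun o => Sum.elim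
          (fun x => Sum.inr (Sum.inr (Sum.inl
            (Nat.pair t x.1, Nat.pair t x.2.1, x.2.2.1, Nat.pair t x.2.2.2))))
          (fun s => Sum.inr (Sum.inr (Sum.inr (Nat.pair t s)))) o) o)
      op := by
    rintro t flag (⟨d, i⟩ | ⟨s, b, vs⟩ | ⟨s, s', pl, p⟩ | s) <;> rfl
  simp only [h]
  fun_prop

@[fun_prop] theorem primrec_lassoE {f g : α → List REdge} {h k : α → List ℕ} (hf : Primrec f)
    (hg : Primrec g) (hh : Primrec h) (hk : Primrec k) :
    Primrec fun a => lassoE (f a) (g a) (h a) (k a) := by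
  unfold lassoE pc ROp.upd
  fun_prop

@[fun_prop] theorem primrec_opPl {f : α → ROp} (hf : Primrec f) :
    Primrec fun a => opPl (f a) := by
  have h : ∀ op : ROp, opPl op = Sum.elim
      (fun x => x.1.map (fun y => y.1) ++ x.2.map fun y => y.1)
      (fun o => Sum.elim (fun _ => [])
        (fun o => Sum.elim (fun x => [x.2.2.2]) (fun _ => []) o) o)
      op := by
    rintro (⟨d, i⟩ | ⟨s, b, vs⟩ | ⟨s, s', pl, p⟩ | s) <;> rfl
  simp only [h]
  fun_prop

@[fun_prop] theorem primrec_outE {f : α → List REdge} {g : α → Raw} (hf : Primrec f)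
    (hg : Primrec g) : Primrec fun a => outE (f a) (g a) := by
  unfold outE
  fun_prop

@[fun_prop] theorem primrec_decVec {f : α → ℕ} (hf : Primrec f) :
    Primrec fun a => decVec (f a) := by
  unfold decVec
  fun_prop

@[fun_prop] theorem primrec_negPart {f : α → Raw} (hf : Primrec f) :
    Primrec fun a => negPart (f a) := by
  unfold negPart
  fun_prop

@[fun_prop] theorem primrec_posPart {f : α → Raw} (hf : Primrec f) :
    Primrec fun a => posPart (f a) := by
  unfold posPart
  fun_prop

@[fun_prop] theorem primrec_decOp {f : α → ℕ} (hf : Primrec f) :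
    Primrec fun a => decOp (f a) := by
  unfold decOp ROp.upd ROp.infl ROp.defl ROp.brst
  fun_prop

@[fun_prop] theorem primrec_decE {f : α → List (ℕ × ℕ × ℕ)} (hf : Primrec f) :
    Primrec fun a => decE (f a) := by
  unfold decE
  fun_prop

@[fun_prop] theorem primrec_graphCode {f : α → List ℕ} {g : α → ℕ → ℕ} (hf : Primrec f)
    (hg : Primrec fun p : α × ℕ => g p.1 p.2) : Primrec fun a => graphCode (f a) (g a) := by
  unfold graphCode
  fun_prop

@[fun_prop] theorem primrec_codeVec {f : α → Raw} (hf : Primrec f) :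
    Primrec fun a => codeVec (f a) := by
  unfold codeVec
  fun_prop

@[fun_prop] theorem primrec_codeZ {f g : α → Raw} (hf : Primrec f) (hg : Primrec g) :
    Primrec fun a => codeZ (f a) (g a) := by
  unfold codeZ zcode
  fun_prop

@[fun_prop] theorem primrec_codeE {f : α → REdge} (hf : Primrec f) :
    Primrec fun a => codeE (f a) := by
  have h : ∀ e : REdge, codeE e = Nat.pair e.1 (Nat.pair (Sum.elim
      (fun x => Nat.pair 0 (codeZ x.1 x.2))
      (fun o => Sum.elim
        (fun x => Nat.pair 1 (Nat.pair x.1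
          (Encodable.encode [(codeVec x.2.1, x.2.2.map fun y => codeVec y)])))
        (fun o => Sum.elim (fun x => Nat.pair 2 (Encodable.encode x))
          (fun s => Nat.pair 3 s) o) o)
      e.2.1) e.2.2) := by
    rintro ⟨q, ⟨d, i⟩ | ⟨s, b, vs⟩ | ⟨s, s', pl, p⟩ | s, q'⟩ <;> rfl
  simp only [h]
  fun_prop

end

theorem primrec_reduction : Primrec reduction := by
  unfold reduction codeOut codeM codeC pc
  fun_prop

/-- The progressive run problem for VASSB reduces to the
reachability problem for VASSB: there is a computable function mapping each
pair `(V, s)` of a VASSB and a semiconfiguration to a triple `(V', s1', s2')`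
of a VASSB and two semiconfigurations such that `V` has an infinite
progressive run from `s` iff `V'` has a run `s1' →* s2'`. -/
theorem progressiveRun_reduces_to_reach :
    ∃ f : ℕ → ℕ, Computable f ∧
      ∀ (V : VASSB) (s : VConfig), IsSemi s →
        ∃ (V' : VASSB) (s1' s2' : VConfig), IsSemi s1' ∧ IsSemi s2' ∧
          f (Nat.pair (encodeVASSB V) (encodeVConfig s)) =
            Nat.pair (encodeVASSB V')
              (Nat.pair (encodeVConfig s1') (encodeVConfig s2')) ∧
          (HasProgRunV V s ↔ VReach V' s1' s2') := by
  exact ⟨reduction, primrec_reduction.to_comp, reduction_spec⟩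

end CBL
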